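/- For any two skew shapes λ/μ and ν/ρ (partitions with at most k parts, μ ⊆ λ and ρ ⊆ ν), the symmetric function s_{⌊(λ+ν)/2⌋/⌊(μ+ρ)/2⌋}·s_{⌈(λ+ν)/2⌉/⌈(μ+ρ)/2⌉} − s_{λ/μ}·s_{ν/ρ} is Schur nonnegative. -/

import Mathlib

/-- The complete homogeneous symmetric function `h_m` in `N` variables,
with `h_m = 0` for `m < 0`. -/
noncomputable def homog (N : ℕ) (m : ℤ) : MvPolynomial (Fin N) ℤ :=
  if 0 ≤ m then MvPolynomial.hsymm (Fin N) ℤ m.toNat else 0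

/-- The skew Schur polynomial `s_{λ/μ}` in `N` variables, given by the
Jacobi–Trudi determinant `det (h_{λ_i - μ_j - i + j})_{i,j=1}^k`, where the
partitions `lam`, `mu` are recorded 0-indexed (`lam 0 = λ_1`). -/
noncomputable def skewSchur (N k : ℕ) (lam mu : ℕ → ℕ) : MvPolynomial (Fin N) ℤ :=
  Matrix.det (Matrix.of fun i j : Fin k =>
    homog N ((lam i : ℤ) - (mu j : ℤ) - (i : ℤ) + (j : ℤ)))

/-- A symmetric polynomial is Schur nonnegative if it is a linear combination
with nonnegative coefficients of Schur polynomials `s_λ`. -/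
def IsSchurNonneg (N : ℕ) (f : MvPolynomial (Fin N) ℤ) : Prop :=
  ∃ (m : ℕ) (c : Fin m → ℕ) (k : Fin m → ℕ) (lam : Fin m → ℕ → ℕ),
    (∀ i, Antitone (lam i)) ∧ (∀ i j, k i ≤ j → lam i j = 0) ∧
    f = ∑ i, (c i : ℤ) • skewSchur N (k i) (lam i) (fun _ => 0)


set_option linter.unusedSimpArgs false
set_option linter.unusedVariables false

/-! ### Commuting products of truncated exponentials -/
section ExpComm

variable {R A : Type*} [CommRing R] [Algebra ℚ R] [Ring A] [Algebra R A]

/-- truncated exponential -/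
noncomputable def tE (g : A) (x : R) : A :=
  1 + x • g + (x ^ 2 * algebraMap ℚ R (1/2)) • (g * g)

lemma half_add_half : (algebraMap ℚ R (1/2)) + (algebraMap ℚ R (1/2)) = 1 := by
  rw [← map_add]; norm_num

lemma half_mul_two : (algebraMap ℚ R (1/2)) * 2 = 1 := by
  rw [mul_two]; exact half_add_half

lemma tE_comm_of_commute {g h : A} (c : Commute g h) (x y : R) :
    Commute (tE g x) (tE h y) := by
  have c2 : Commute (g * g) h := c.mul_left c
  have c3 : Commute g (h * h) := c.mul_right c
  have c4 : Commute (g * g) (h * h) := c2.mul_right c2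
  unfold tE
  refine Commute.add_left (Commute.add_left (Commute.one_left _) ?_) ?_ <;>
  refine Commute.add_right (Commute.add_right (Commute.one_right _) ?_) ?_
  · exact (c.smul_left x).smul_right y
  · exact (c3.smul_left x).smul_right _
  · exact (c2.smul_left _).smul_right _
  · exact (c4.smul_left _).smul_right _

variable (R) in
lemma rat_cancel (n : ℕ) (hn : n ≠ 0) {a : A} (h : (n : R) • a = 0) : a = 0 := by
  have h1 : (algebraMap ℚ R (1/n)) * (n : R) = 1 := by
    have : ((n : R)) = algebraMap ℚ R n := by simp
    rw [this, ← map_mul]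
    have hn' : (n : ℚ) ≠ 0 := by exact_mod_cast hn
    rw [one_div, inv_mul_cancel₀ hn', map_one]
  calc a = (1 : R) • a := (one_smul _ _).symm
    _ = (algebraMap ℚ R (1/n)) • ((n : R) • a) := by rw [smul_smul, h1]
    _ = 0 := by rw [h, smul_zero]

/-- the hypotheses: cubes vanish and the Serre relation `[h,[h,e]] = 0` -/
lemma serre_aux (R) [CommRing R] [Algebra ℚ R] [Algebra R A] {e h : A} (h3 : h * h * h = 0)
    (s : h * h * e + e * h * h = (2 : R) • (h * e * h)) :
    h * h * e * h = 0 ∧ h * e * h * h = 0 := by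
  have a1 : h * h * e * h = (2 : R) • (h * e * h * h) := by
    have := congrArg (· * h) s
    simp only [add_mul, smul_mul_assoc] at this
    rw [show e * h * h * h = e * (h * h * h) by noncomm_ring, h3, mul_zero, add_zero] at this
    exact this
  have a2 : h * e * h * h = (2 : R) • (h * h * e * h) := by
    have := congrArg (h * ·) s
    simp only [mul_add, mul_smul_comm] at this
    rw [show h * (h * h * e) = (h * h * h) * e by noncomm_ring, h3, zero_mul, zero_add] at this
    rw [show h * (e * h * h) = h * e * h * h by noncomm_ring,
      show h * (h * e * h) = h * h * e * h by noncomm_ring] at this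
    exact this
  have a3 : h * h * e * h = 0 := by
    apply rat_cancel R 3 (by norm_num)
    have : h * h * e * h = (2 : R) • ((2 : R) • (h * h * e * h)) := by rw [← a2, ← a1]
    rw [smul_smul] at this
    push_cast
    have e4 : (2 * 2 : R) = 3 + 1 := by norm_num
    rw [e4, add_smul, one_smul] at this
    exact left_eq_add.mp ((add_comm _ _).trans this.symm |>.symm)
  exact ⟨a3, by rw [a2, a3, smul_zero]⟩

lemma tE_neg_mul {h : A} (h3 : h * h * h = 0) (y : R) : tE h (-y) * tE h y = 1 := by
  unfold tE
  have h4 : h * (h * h) = 0 := by rw [← mul_assoc, h3]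
  have c := half_add_half (R := R)
  set k := algebraMap ℚ R (1/2)
  simp only [mul_add, add_mul, smul_mul_assoc, mul_smul_comm, smul_smul, mul_assoc, h4, mul_zero,
    smul_zero, mul_one, one_mul, add_zero, zero_add, even_two, Even.neg_pow]
  have : k = 1 - k := by rw [← c]; ring
  match_scalars
  · ring
  · ring
  · linear_combination (y^2) * c

lemma conj_e {e h : A} (h3 : h * h * h = 0)
    (s : h * h * e + e * h * h = (2 : R) • (h * e * h)) (y : R) :
    tE h (-y) * e * tE h y = e + y • (e * h - h * e) := by
  obtain ⟨z1, z2⟩ := serre_aux R h3 s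
  simp only [mul_assoc] at z1 z2 s
  have c := half_add_half (R := R)
  unfold tE
  set k := algebraMap ℚ R (1/2)
  have z3 : h * (h * (e * (h * h))) = 0 := by
    have := congrArg (· * h) z1
    simpa only [mul_assoc, zero_mul] using this
  simp only [mul_add, add_mul, smul_mul_assoc, mul_smul_comm, smul_smul, mul_assoc, z1, z2, z3,
    mul_zero,
    smul_zero, mul_one, one_mul, add_zero, zero_add, even_two, Even.neg_pow]
  have s' : e * (h * h) = (2 : R) • (h * (e * h)) - h * (h * e) := by rw [← s]; abel
  rw [s']
  match_scalars <;> first | ring1 | linear_combination (y^2) * c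

lemma tE_conj {e h : A} (h3 : h * h * h = 0)
    (s : h * h * e + e * h * h = (2 : R) • (h * e * h)) (x y : R) :
    tE h (-y) * tE e x * tE h y = tE (e + y • (e * h - h * e)) x := by
  have c1 := conj_e h3 s y
  have i1 := tE_neg_mul h3 y
  have i2 : tE h y * tE h (-y) = 1 := by
    have := tE_neg_mul h3 (-y); rwa [neg_neg] at this
  rw [← c1]
  have c2 : tE h (-y) * (e * e) * tE h y
      = (tE h (-y) * e * tE h y) * (tE h (-y) * e * tE h y) := by
    rw [show (tE h (-y) * e * tE h y) * (tE h (-y) * e * tE h y)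
      = tE h (-y) * e * (tE h y * tE h (-y)) * e * tE h y by noncomm_ring, i2]
    noncomm_ring
  have t1 : ∀ g : A, tE g x = 1 + x • g + (x ^ 2 * algebraMap ℚ R (1/2)) • (g * g) := fun _ => rfl
  rw [t1 e, t1 (_ * _ * _), ← c2]
  simp only [mul_add, add_mul, mul_one, i1, smul_mul_assoc, mul_smul_comm]

lemma w_cube {e h : A} (h3 : h * h * h = 0) (e3 : e * e * e = 0)
    (s : h * h * e + e * h * h = (2 : R) • (h * e * h)) (y : R) :
    (e + y • (e * h - h * e)) * (e + y • (e * h - h * e)) * (e + y • (e * h - h * e)) = 0 := by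
  have c1 := conj_e h3 s y
  have i2 : tE h y * tE h (-y) = 1 := by
    have := tE_neg_mul h3 (-y); rwa [neg_neg] at this
  rw [← c1]
  rw [show (tE h (-y) * e * tE h y) * (tE h (-y) * e * tE h y) * (tE h (-y) * e * tE h y)
    = tE h (-y) * e * (tE h y * tE h (-y)) * e * (tE h y * tE h (-y)) * e * tE h y by
      noncomm_ring, i2]
  rw [show tE h (-y) * e * 1 * e * 1 * e * tE h y = tE h (-y) * (e * e * e) * tE h y by
    noncomm_ring, e3]
  simp

lemma K_symm {e h : A} (h3 : h * h * h = 0) (e3 : e * e * e = 0)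
    (s : h * h * e + e * h * h = (2 : R) • (h * e * h))
    (s' : e * e * h + h * e * e = (2 : R) • (e * h * e)) (x y : R) :
    tE h (-y) * tE e x * tE h y * tE e y = tE h (-x) * tE e y * tE h x * tE e x := by
  rw [tE_conj h3 s, tE_conj h3 s]
  obtain ⟨z, hz⟩ : ∃ z, z = e * h - h * e := ⟨_, rfl⟩
  have hc : z * e = e * z := by
    rw [hz]
    have : e * h * e + e * h * e = e * e * h + h * e * e := by rw [s', two_smul]
    have e1 : (e * h - h * e) * e - e * (e * h - h * e)
      = (e * h * e + e * h * e) - (e * e * h + h * e * e) := by noncomm_ring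
    rw [this, sub_self] at e1
    exact sub_eq_zero.mp e1
  have w := fun y : R => w_cube h3 e3 s y
  rw [← hz] at w ⊢
  have hc' : ∀ t, z * (e * t) = e * (z * t) := fun t => by rw [← mul_assoc, hc, mul_assoc]
  have e3' : e * (e * e) = 0 := by rw [← mul_assoc, e3]
  have e3'' : ∀ t, e * (e * (e * t)) = 0 := fun t => by
    rw [← mul_assoc, ← mul_assoc, e3, zero_mul]
  have w' : ∀ y : R, (3 * y) • (e * (e * z)) + (3 * y ^ 2) • (e * (z * z))
      + (y ^ 3) • (z * (z * z)) = 0 := by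
    intro y
    have := w y
    simp only [mul_add, add_mul, smul_mul_assoc, mul_smul_comm, smul_smul, mul_assoc, hc, hc',
      e3', zero_add] at this
    rw [← this]
    module
  have q1 := w' 1
  have q2 := w' (-1)
  have q3 := w' 2
  have r1 : e * (z * z) = 0 := by
    apply rat_cancel R 6 (by norm_num)
    have := congrArg₂ (· + ·) q1 q2
    simp only [add_zero] at this
    rw [← this]; push_cast; module
  have r2 : e * (e * z) = 0 := by
    rw [r1] at q1 q3
    apply rat_cancel R 18 (by norm_num)
    have := congrArg₂ (fun a b => (8 : R) • a - b) q1 q3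
    simp only [smul_zero, sub_zero, add_zero] at this
    rw [← this]; push_cast; module
  have r1' : ∀ t, e * (z * (z * t)) = 0 := fun t => by
    rw [← mul_assoc z, ← mul_assoc, r1, zero_mul]
  have r2' : ∀ t, e * (e * (z * t)) = 0 := fun t => by
    rw [← mul_assoc e z, ← mul_assoc, r2, zero_mul]
  have c := half_mul_two (R := R)
  unfold tE
  set k := algebraMap ℚ R (1/2)
  simp only [mul_add, add_mul, smul_mul_assoc, mul_smul_comm, smul_smul, mul_assoc, hc, hc', r1,
    r2, r1', r2', e3', e3'', mul_one, one_mul, mul_zero, smul_zero, add_zero, zero_add, smul_add]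
  match_scalars <;> first | ring1 | linear_combination (x^2*y - x*y^2) * c | linear_combination (-x^2*y + x*y^2) * c

/-- product of the first `n` truncated exponentials -/
noncomputable def LP (g : ℕ → A) (n : ℕ) (x : R) : A :=
  ((List.range n).map fun c => tE (g c) x).prod

lemma LP_succ (g : ℕ → A) (n : ℕ) (x : R) : LP g (n+1) x = LP g n x * tE (g n) x := by
  simp [LP, List.range_succ]

lemma LP_comm (g : ℕ → A) (n : ℕ)
    (h3 : ∀ c, g c * g c * g c = 0)
    (far : ∀ c d, c + 2 ≤ d → Commute (g c) (g d))
    (s1 : ∀ c, g c * g c * g (c+1) + g (c+1) * g c * g c = (2 : R) • (g c * g (c+1) * g c))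
    (s2 : ∀ c, g (c+1) * g (c+1) * g c + g c * g (c+1) * g (c+1)
      = (2 : R) • (g (c+1) * g c * g (c+1))) (x y : R) :
    LP g n x * LP g n y = LP g n y * LP g n x := by
  have farL : ∀ m d, m + 1 ≤ d → ∀ x y : R, Commute (LP g m x) (tE (g d) y) := by
    intro m
    induction m with
    | zero => intro d _ x y; simp [LP]
    | succ m ih =>
      intro d hd x y
      rw [LP_succ]
      exact (ih d (by omega) x y).mul_left (tE_comm_of_commute (far _ _ (by omega)) x y)
  induction n with
  | zero => simp [LP]
  | succ n ih =>
    rcases n with _ | n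
    · have l1 : ∀ x : R, LP g 1 x = tE (g 0) x := fun x => by simp [LP]
      rw [zero_add, l1, l1]
      exact tE_comm_of_commute (Commute.refl _) x y
    have key : ∀ x y : R, LP g (n+2) x * LP g (n+2) y = (LP g (n+1) x * LP g (n+1) y) *
        (tE (g n) (-y) * tE (g (n+1)) x * tE (g n) y * tE (g (n+1)) y) := by
      intro x y
      have i2 : tE (g n) y * tE (g n) (-y) = 1 := by
        have := tE_neg_mul (h3 n) (-y); rwa [neg_neg] at this
      have f := (farL n (n+1) le_rfl y x).eq
      rw [LP_succ g (n+1), LP_succ g (n+1) y, LP_succ g n y]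
      calc _ = LP g (n+1) x * (tE (g (n+1)) x * LP g n y) * tE (g n) y * tE (g (n+1)) y := by
            simp only [mul_assoc]
        _ = LP g (n+1) x * (LP g n y * tE (g (n+1)) x) * tE (g n) y * tE (g (n+1)) y := by rw [f]
        _ = LP g (n+1) x * LP g n y * (tE (g n) y * tE (g n) (-y)) *
            tE (g (n+1)) x * tE (g n) y * tE (g (n+1)) y := by
            rw [i2]; simp only [mul_assoc, one_mul]
        _ = _ := by simp only [mul_assoc]
    rw [key, key, ih, K_symm (h3 n) (h3 (n+1)) (s1 n) (s2 n)]

end ExpComm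


/-! ### Complete homogeneous polynomials and the bialternant formula -/
section Bialt

/-- geometric series -/
noncomputable def geo {R : Type*} [CommRing R] (x : R) : PowerSeries R :=
  PowerSeries.mk fun n => x ^ n

lemma geo_mul {R : Type*} [CommRing R] (x : R) :
    geo x * (1 - PowerSeries.C x * PowerSeries.X) = 1 := by
  ext n
  rw [mul_sub, mul_one, ← mul_assoc, map_sub]
  rcases n with _ | n
  · simp [geo]
  · rw [PowerSeries.coeff_succ_mul_X]
    simp [geo, pow_succ, PowerSeries.coeff_one]

/-- complete homogeneous symmetric functions of a list of ring elements -/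
noncomputable def hl {R : Type*} [CommRing R] (l : List R) (m : ℤ) : R :=
  if 0 ≤ m then PowerSeries.coeff m.toNat (l.map geo).prod else 0

lemma hl_nil {R : Type*} [CommRing R] (m : ℤ) : hl ([] : List R) m = if m = 0 then 1 else 0 := by
  unfold hl
  simp only [List.map_nil, List.prod_nil, PowerSeries.coeff_one]
  split_ifs <;> first | rfl | omega

lemma hl_cons {R : Type*} [CommRing R] (x : R) (l : List R) (m : ℤ) :
    hl (x :: l) m = hl l m + x * hl (x :: l) (m - 1) := by
  have key : (List.map geo (x :: l)).prod = (l.map geo).prod +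
      PowerSeries.C x * ((List.map geo (x :: l)).prod * PowerSeries.X) := by
    have := geo_mul x
    simp only [List.map_cons, List.prod_cons]
    linear_combination (l.map geo).prod * this
  unfold hl
  by_cases h : 0 ≤ m
  · obtain ⟨n, rfl⟩ := Int.eq_ofNat_of_zero_le h
    rw [if_pos h, if_pos h]
    conv_lhs => rw [key]
    rw [map_add, PowerSeries.coeff_C_mul]
    congr 2
    rcases n with _ | n
    · simp
    · simp [PowerSeries.coeff_succ_mul_X]
  · rw [if_neg h, if_neg h, if_neg (by omega)]; simp

lemma coeff_prod_geo (N n : ℕ) :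
    PowerSeries.coeff n (∏ i : Fin N, geo (MvPolynomial.X i : MvPolynomial (Fin N) ℤ))
      = MvPolynomial.hsymm (Fin N) ℤ n := by
  classical
  rw [PowerSeries.coeff_prod, MvPolynomial.hsymm]
  symm
  refine Finset.sum_bij' (fun s _ => Multiset.toFinsupp s.1)
    (fun l hl => ⟨Finsupp.toMultiset l, ?_⟩) ?_ ?_ ?_ ?_ ?_
  · rw [Finset.mem_finsuppAntidiag] at hl
    rw [Finsupp.card_toMultiset, Finsupp.sum_fintype _ _ (by simp)]; exact hl.1
  · intro s _
    rw [Finset.mem_finsuppAntidiag]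
    refine ⟨?_, Finset.subset_univ _⟩
    change ∑ i, Multiset.count i s.1 = n
    rw [Multiset.sum_count_eq_card (by simp)]; exact s.2
  · intros; exact Finset.mem_univ _
  · intro s _; exact Subtype.ext (Multiset.toFinsupp_toMultiset s.1)
  · intro l _; simp
  · intro s _
    rw [Finset.prod_multiset_map_count]
    simp only [geo, PowerSeries.coeff_mk, Multiset.toFinsupp_apply]
    apply Finset.prod_subset (Finset.subset_univ _)
    intro i _ hi
    rw [Multiset.mem_toFinset] at hi
    rw [Multiset.count_eq_zero.2 hi, pow_zero]

lemma homog_eq_hl (N : ℕ) (m : ℤ) :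
    homog N m = hl (List.ofFn fun i : Fin N => (MvPolynomial.X i : MvPolynomial (Fin N) ℤ)) m := by
  unfold homog hl
  rw [← coeff_prod_geo, List.map_ofFn, List.prod_ofFn]
  rfl

/-- the alternant -/
noncomputable def altd (N : ℕ) (g : Fin N → ℕ) : MvPolynomial (Fin N) ℤ :=
  Matrix.det (Matrix.of fun i l : Fin N => (MvPolynomial.X l : MvPolynomial (Fin N) ℤ) ^ (g i))

/-- the product over all variables except one -/
noncomputable def Qp (N : ℕ) (l : Fin N) : Polynomial (MvPolynomial (Fin N) ℤ) :=
  ∏ i ∈ Finset.univ.erase l, (1 - Polynomial.C (MvPolynomial.X i) * Polynomial.X)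

lemma Qp_deg (N : ℕ) (l : Fin N) : (Qp N l).natDegree ≤ N - 1 := by
  unfold Qp
  refine (Polynomial.natDegree_prod_le _ _).trans ?_
  refine (Finset.sum_le_card_nsmul _ _ 1 ?_).trans ?_
  · intro i _
    compute_degree
  · simp

lemma X_pow_eq (N : ℕ) (l : Fin N) (n : ℕ) :
    (MvPolynomial.X l : MvPolynomial (Fin N) ℤ) ^ n
      = ∑ j : Fin N, homog N ((n : ℤ) - (N - 1 : ℤ) + j) * (Qp N l).coeff (N - 1 - j) := by
  have h1 : (∏ i : Fin N, geo (MvPolynomial.X i : MvPolynomial (Fin N) ℤ)) *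
      (Qp N l : PowerSeries (MvPolynomial (Fin N) ℤ)) = geo (MvPolynomial.X l) := by
    rw [← Finset.mul_prod_erase _ _ (Finset.mem_univ l), mul_assoc, Qp,
      ← Polynomial.coeToPowerSeries.ringHom_apply, map_prod, ← Finset.prod_mul_distrib]
    rw [Finset.prod_eq_one, mul_one]
    intro i _
    simp only [map_sub, map_one, map_mul, Polynomial.coeToPowerSeries.ringHom_apply,
      Polynomial.coe_C, Polynomial.coe_X]
    exact geo_mul _
  have h2 := congrArg (PowerSeries.coeff n) h1
  rw [geo, PowerSeries.coeff_mk, PowerSeries.coeff_mul,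
    Finset.Nat.sum_antidiagonal_eq_sum_range_succ_mk] at h2
  rw [← h2]
  simp only [coeff_prod_geo, Polynomial.coeff_coe]
  have hN : 0 < N := l.pos
  -- rewrite both as sums over b in range
  have lhs : ∑ k ∈ Finset.range n.succ, MvPolynomial.hsymm (Fin N) ℤ k * (Qp N l).coeff (n - k)
      = ∑ b ∈ Finset.range (n+1), homog N ((n : ℤ) - b) * (Qp N l).coeff b := by
    rw [← Finset.sum_range_reflect]
    apply Finset.sum_congr rfl
    intro b hb
    rw [Finset.mem_range] at hb
    have : 0 ≤ (n : ℤ) - b := by omega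
    rw [homog, if_pos this]
    congr 2 <;> omega
  rw [lhs]
  have rhs : ∑ j : Fin N, homog N ((n : ℤ) - (N - 1 : ℤ) + j) * (Qp N l).coeff (N - 1 - j)
      = ∑ b ∈ Finset.range N, homog N ((n : ℤ) - b) * (Qp N l).coeff b := by
    rw [← Finset.sum_range_reflect,
      ← Fin.sum_univ_eq_sum_range
        (fun j => homog N ((n : ℤ) - (N - 1 - j : ℕ)) * (Qp N l).coeff (N - 1 - j)) N]
    apply Finset.sum_congr rfl
    intro j _
    congr 2
    omega
  rw [rhs]
  trans ∑ b ∈ Finset.range (n+1+N), homog N ((n : ℤ) - b) * (Qp N l).coeff b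
  · apply Finset.sum_subset (Finset.range_mono (by omega))
    intro b _ hb
    rw [Finset.mem_range] at hb
    rw [homog, if_neg (by omega), zero_mul]
  · symm
    apply Finset.sum_subset (Finset.range_mono (by omega))
    intro b _ hb
    rw [Finset.mem_range] at hb
    rw [Polynomial.coeff_eq_zero_of_natDegree_lt, mul_zero]
    have := Qp_deg N l
    omega

lemma altd_fac (N : ℕ) (ka : ℕ → ℕ) :
    altd N (fun i => ka i + (N - 1 - i)) = skewSchur N N ka (fun _ => 0) *
      Matrix.det (Matrix.of fun j l : Fin N => (Qp N l).coeff (N - 1 - j)) := by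
  rw [altd, skewSchur, ← Matrix.det_mul]
  congr 1
  ext1 i l
  rw [Matrix.mul_apply, Matrix.of_apply, X_pow_eq]
  apply Finset.sum_congr rfl
  intro j _
  simp only [Matrix.of_apply]
  congr 2
  have := i.2
  push_cast
  omega

lemma skew_zero (N : ℕ) : skewSchur N N (fun _ => 0) (fun _ => 0) = 1 := by
  rw [skewSchur, Matrix.det_of_isUpperTriangular]
  · apply Finset.prod_eq_one
    intro i _
    simp [homog]
  · intro i j hij
    simp only [Matrix.of_apply, id] at hij ⊢
    rw [homog, if_neg]
    have : (j : ℕ) < i := hij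
    push_cast
    omega

/-- bialternant formula -/
lemma bialternant (N : ℕ) (ka : ℕ → ℕ) :
    altd N (fun i => ka i + (N - 1 - i)) = skewSchur N N ka (fun _ => 0) *
      altd N (fun i => N - 1 - i) := by
  have := altd_fac N (fun _ => 0)
  simp only [zero_add, skew_zero, one_mul] at this
  rw [altd_fac, this]

lemma altd_ne_zero (N : ℕ) : altd N (fun i => N - 1 - i) ≠ 0 := by
  have h : altd N (fun i => N - 1 - i) =
      ((Matrix.vandermonde (fun l : Fin N => (MvPolynomial.X l : MvPolynomial (Fin N) ℤ))).transpose.submatrix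
        Fin.revPerm id).det := by
    rw [altd]; congr 1
    ext1 i l
    simp only [Matrix.of_apply, Matrix.submatrix_apply, Matrix.transpose_apply,
      Matrix.vandermonde_apply, id, Fin.revPerm_apply, Fin.val_rev]
    congr 1; omega
  rw [h, Matrix.det_permute, Matrix.det_transpose]
  refine mul_ne_zero ?_ ?_
  · rcases Int.units_eq_one_or (Equiv.Perm.sign (Fin.revPerm : Equiv.Perm (Fin N))) with h | h <;>
      simp [h]
  · rw [Matrix.det_vandermonde_ne_zero_iff]
    exact MvPolynomial.X_injective

end Bialt


/-! ### Bead configurations: holes, truncated sizes, moves -/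
section Beads

/-- number of holes below `n` -/
def hb (C : Finset ℕ) : ℕ → ℕ
  | 0 => 0
  | n + 1 => hb C n + if n ∈ C then 0 else 1

/-- truncated size -/
def AA (K : ℕ) (C : Finset ℕ) : ℕ := ∑ s ∈ C, (hb C s - K)

/-- half positions -/
def pp (C : Finset ℕ) : ℕ := ∑ s ∈ C, s / 2

/-- the move of a bead from `j - 2` to `j` -/
def Mv (j : ℕ) (C C' : Finset ℕ) : Prop :=
  2 ≤ j ∧ j - 2 ∈ C ∧ j ∉ C ∧ C' = insert j (C.erase (j - 2))

lemma hb_mono_n (C : Finset ℕ) {m n : ℕ} (h : m ≤ n) : hb C m ≤ hb C n := by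
  induction n, h using Nat.le_induction with
  | base => exact le_rfl
  | succ n _ ih => rw [hb]; omega

lemma hb_le (C : Finset ℕ) (n : ℕ) : hb C n ≤ n := by
  induction n with
  | zero => simp [hb]
  | succ n ih => rw [hb]; split_ifs <;> omega

lemma hb_congr_low (C C' : Finset ℕ) (n : ℕ) (h : ∀ s < n, (s ∈ C' ↔ s ∈ C)) :
    hb C' n = hb C n := by
  induction n with
  | zero => rfl
  | succ n ih =>
    rw [hb, hb, ih (fun s hs => h s (by omega))]
    simp only [h n (by omega)]

lemma hb_congr_high (C C' : Finset ℕ) (z : ℕ) (h : ∀ s, z ≤ s → (s ∈ C' ↔ s ∈ C))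
    (h0 : hb C' z = hb C z) (n : ℕ) (hn : z ≤ n) :
    hb C' n = hb C n := by
  induction n, hn using Nat.le_induction with
  | base => exact h0
  | succ n hn ih =>
    rw [hb, hb, ih]
    simp only [h n hn]

section
variable {i : ℕ} {C C' : Finset ℕ}

lemma Mv.mem (h : Mv (i + 2) C C') (s : ℕ) : s ∈ C' ↔ s = i + 2 ∨ (s ≠ i ∧ s ∈ C) := by
  obtain ⟨-, h1, h2, rfl⟩ := h
  simp

lemma Mv.src (h : Mv (i + 2) C C') : i ∈ C := h.2.1
lemma Mv.tgt (h : Mv (i + 2) C C') : i + 2 ∉ C := h.2.2.1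

lemma Mv.hb_low (h : Mv (i + 2) C C') (n : ℕ) (hn : n ≤ i) : hb C' n = hb C n := by
  apply hb_congr_low
  intro s hs
  rw [h.mem]
  constructor
  · rintro (h | h)
    · omega
    · exact h.2
  · intro h; right; exact ⟨by omega, h⟩

lemma Mv.hb1 (h : Mv (i + 2) C C') : hb C' (i + 1) = hb C i + 1 := by
  rw [hb, h.hb_low i le_rfl, if_neg]
  rw [h.mem]; simp

lemma Mv.hb2 (h : Mv (i + 2) C C') : hb C' (i + 2) = hb C i + 1 + (if i + 1 ∈ C then 0 else 1) := by
  rw [hb, h.hb1]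
  have : i + 1 ∈ C' ↔ i + 1 ∈ C := by rw [h.mem]; simp
  simp only [this]

lemma Mv.hbC1 (h : Mv (i + 2) C C') : hb C (i + 1) = hb C i := by
  rw [hb, if_pos h.src]; rfl

lemma Mv.hbC2 (h : Mv (i + 2) C C') : hb C (i + 2) = hb C i + (if i + 1 ∈ C then 0 else 1) := by
  rw [hb, h.hbC1]

lemma Mv.hb_high (h : Mv (i + 2) C C') (n : ℕ) (hn : i + 3 ≤ n) : hb C' n = hb C n := by
  apply hb_congr_high C C' (i + 3) _ _ n hn
  · intro s hs
    rw [h.mem]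
    constructor
    · rintro (h | h)
      · omega
      · exact h.2
    · intro h; right; exact ⟨by omega, h⟩
  · have hm : i + 2 ∈ C' := by rw [h.mem]; simp
    rw [hb, h.hb2, hb, h.hbC2, if_pos hm, if_neg h.tgt]
    omega

lemma Mv.pp_eq (h : Mv (i + 2) C C') : pp C' = pp C + 1 := by
  obtain ⟨-, h1, h2, rfl⟩ := h
  unfold pp
  rw [Finset.sum_insert (by simp [h2]), ← Finset.add_sum_erase _ _ h1]
  omega

lemma Mv.AA_eq (h : Mv (i + 2) C C') (K : ℕ) : AA K C' = AA K C + (if K ≤ hb C i then 1 else 0)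
    + (if K ≤ hb C i + (if i + 1 ∈ C then 0 else 1) then 1 else 0) := by
  have hC' : C' = insert (i+2) (C.erase i) := h.2.2.2
  have e1 : AA K C' = (hb C' (i+2) - K) + ∑ s ∈ C.erase i, (hb C' s - K) := by
    unfold AA
    conv_lhs => rw [hC']
    rw [Finset.sum_insert (by simp [h.tgt])]
    rw [← hC']
  have e2 : AA K C = (hb C i - K) + ∑ s ∈ C.erase i, (hb C s - K) := by
    unfold AA
    rw [← Finset.add_sum_erase _ _ h.src]
  have key : ∀ s ∈ C, s ≠ i → s ≠ i + 1 → hb C' s = hb C s := by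
    intro s hs h1 h2
    have : s ≠ i + 2 := by rintro rfl; exact h.tgt hs
    rcases Nat.lt_or_ge s i with h3 | h3
    · exact h.hb_low s (by omega)
    · exact h.hb_high s (by omega)
  have r1 := h.hb1
  have r2 := h.hb2
  have r3 := h.hbC1
  by_cases hi : i + 1 ∈ C
  · have hm : i + 1 ∈ C.erase i := by simp [hi]
    rw [e1, e2, ← Finset.add_sum_erase _ _ hm, ← Finset.add_sum_erase _ _ hm]
    have : ∑ x ∈ (C.erase i).erase (i + 1), (hb C' x - K)
        = ∑ x ∈ (C.erase i).erase (i + 1), (hb C x - K) := by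
      apply Finset.sum_congr rfl
      intro s hs
      simp only [Finset.mem_erase] at hs
      rw [key s hs.2.2 hs.2.1 hs.1]
    rw [this]
    simp only [hi, if_true] at *
    split_ifs <;> omega
  · have : ∑ x ∈ (C.erase i), (hb C' x - K) = ∑ x ∈ (C.erase i), (hb C x - K) := by
      apply Finset.sum_congr rfl
      intro s hs
      simp only [Finset.mem_erase] at hs
      rw [key s hs.2 hs.1]
      rintro rfl; exact hi hs.2
    rw [e1, e2, this]
    simp only [hi, if_false] at *
    split_ifs <;> omega

end

/-- optional move -/
def Stp (j : ℕ) (C C' : Finset ℕ) : Prop := C' = C ∨ Mv j C C'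

/-- chain of optional moves -/
def Rch : List ℕ → Finset ℕ → Finset ℕ → Prop
  | [], C, C' => C' = C
  | j :: l, C, C' => ∃ C1, Stp j C C1 ∧ Rch l C1 C'

lemma Mv.exi {j : ℕ} {C C' : Finset ℕ} (h : Mv j C C') : ∃ i, j = i + 2 ∧ Mv (i + 2) C C' := by
  have := h.1
  refine ⟨j - 2, by omega, ?_⟩
  have e : j - 2 + 2 = j := by omega
  rw [e]; exact h

lemma Rch.append {l1 l2 : List ℕ} {C C1 C2 : Finset ℕ} (h1 : Rch l1 C C1) (h2 : Rch l2 C1 C2) :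
    Rch (l1 ++ l2) C C2 := by
  induction l1 generalizing C with
  | nil => rw [Rch] at h1; subst h1; exact h2
  | cons j l ih =>
    obtain ⟨D, hD, h⟩ := h1
    exact ⟨D, hD, ih h⟩

/-- a general induction principle -/
lemma Rch.ind {l : List ℕ} {C C' : Finset ℕ} (h : Rch l C C')
    (P : Finset ℕ → Finset ℕ → Prop) (hrefl : ∀ C, P C C)
    (hstep : ∀ i C C1 C2, i + 2 ∈ l → Mv (i+2) C C1 → P C1 C2 → P C C2) : P C C' := by
  induction l generalizing C with
  | nil => rw [Rch] at h; subst h; exact hrefl _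
  | cons j l ih =>
    obtain ⟨D, hD, h⟩ := h
    have h2 := ih h (fun i C C1 C2 hi => hstep i C C1 C2 (List.mem_cons_of_mem _ hi))
    rcases hD with rfl | hD
    · exact h2
    · obtain ⟨i, rfl, hD⟩ := hD.exi
      exact hstep i _ _ _ List.mem_cons_self hD h2

section
variable {l : List ℕ} {C C' : Finset ℕ}

lemma Rch.low (h : Rch l C C') (z : ℕ) (hl : ∀ j ∈ l, j < z) :
    (∀ s, z ≤ s → (s ∈ C' ↔ s ∈ C)) ∧ (∀ n, z ≤ n → hb C' n = hb C n) := by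
  refine h.ind (fun C C' => (∀ s, z ≤ s → (s ∈ C' ↔ s ∈ C)) ∧ (∀ n, z ≤ n → hb C' n = hb C n))
    (by simp) ?_
  intro i C C1 C2 hi hm ⟨h1, h2⟩
  have := hl _ hi
  refine ⟨fun s hs => (h1 s hs).trans ?_, fun n hn => (h2 n hn).trans (hm.hb_high n (by omega))⟩
  rw [hm.mem]
  constructor
  · rintro (h | h)
    · omega
    · exact h.2
  · intro h; right; exact ⟨by omega, h⟩

lemma Rch.high (h : Rch l C C') (z : ℕ) (hl : ∀ j ∈ l, z + 3 ≤ j) :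
    (∀ s, s ≤ z → (s ∈ C' ↔ s ∈ C)) ∧ (∀ n, n ≤ z + 1 → hb C' n = hb C n) := by
  refine h.ind (fun C C' => (∀ s, s ≤ z → (s ∈ C' ↔ s ∈ C)) ∧ (∀ n, n ≤ z + 1 → hb C' n = hb C n))
    (by simp) ?_
  intro i C C1 C2 hi hm ⟨h1, h2⟩
  have := hl _ hi
  refine ⟨fun s hs => (h1 s hs).trans ?_, fun n hn => (h2 n hn).trans (hm.hb_low n (by omega))⟩
  rw [hm.mem]
  constructor
  · rintro (h | h)
    · omega
    · exact h.2
  · intro h; right; exact ⟨by omega, h⟩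

lemma Mv.hb_mono {i : ℕ} (h : Mv (i + 2) C C') (n : ℕ) : hb C n ≤ hb C' n := by
  rcases Nat.lt_or_ge i n with h1 | h1
  · rcases Nat.lt_or_ge n (i+3) with h2 | h2
    · have r1 := h.hb1
      have r2 := h.hb2
      have r3 := h.hbC1
      have r4 := h.hbC2
      obtain rfl | rfl : n = i + 1 ∨ n = i + 2 := by omega
      all_goals omega
    · exact (h.hb_high n h2).ge
  · exact (h.hb_low n h1).ge

lemma Rch.hb_mono (h : Rch l C C') (n : ℕ) : hb C n ≤ hb C' n := by
  refine h.ind (fun C C' => hb C n ≤ hb C' n) (fun _ => le_rfl) ?_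
  intro i C C1 C2 _ hm h1
  exact (hm.hb_mono n).trans h1

lemma Rch.pp_mono (h : Rch l C C') : pp C ≤ pp C' := by
  refine h.ind (fun C C' => pp C ≤ pp C') (fun _ => le_rfl) ?_
  intro i C C1 C2 _ hm h1
  have := hm.pp_eq
  omega

lemma Rch.AA_mono (h : Rch l C C') (K : ℕ) : AA K C ≤ AA K C' := by
  refine h.ind (fun C C' => AA K C ≤ AA K C') (fun _ => le_rfl) ?_
  intro i C C1 C2 _ hm h1
  have := hm.AA_eq K
  omega

lemma Rch.AA_low (h : Rch l C C') (K z : ℕ) (hl : ∀ j ∈ l, j ≤ z) (hK : hb C' z ≤ K) :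
    AA K C' = AA K C := by
  suffices hb C z ≤ hb C' z ∧ (hb C' z ≤ K → AA K C' = AA K C) from this.2 hK
  refine h.ind (fun C C' => hb C z ≤ hb C' z ∧ (hb C' z ≤ K → AA K C' = AA K C))
    (fun _ => ⟨le_rfl, fun _ => rfl⟩) ?_
  intro i C C1 C2 hi hm ⟨h0, h1⟩
  refine ⟨(hm.hb_mono z).trans h0, fun h2 => ?_⟩
  rw [h1 h2, hm.AA_eq]
  have := hb_mono_n C1 (hl _ hi)
  rw [hm.hb2] at this
  rw [if_neg, if_neg] <;> omega

lemma Rch.AA_high (h : Rch l C C') (K z : ℕ) (hl : ∀ j ∈ l, z + 3 ≤ j) (hK : K ≤ hb C (z+1)) :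
    AA K C' + 2 * pp C = AA K C + 2 * pp C' := by
  revert hK
  refine h.ind (fun C C' => K ≤ hb C (z+1) → AA K C' + 2 * pp C = AA K C + 2 * pp C')
    (fun _ _ => rfl) ?_
  intro i C C1 C2 hi hm h1 hK
  have := hl _ hi
  have h2 := h1 (by rw [hm.hb_low _ (by omega)]; exact hK)
  have h3 := hm.pp_eq
  have h4 := hm.AA_eq K
  have h5 := hb_mono_n C (show z + 1 ≤ i by omega)
  rw [if_pos (by omega), if_pos (by omega)] at h4
  omega

lemma Rch.AA_zero (h : Rch l C C') : AA 0 C' + 2 * pp C = AA 0 C + 2 * pp C' := by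
  refine h.ind (fun C C' => AA 0 C' + 2 * pp C = AA 0 C + 2 * pp C') (fun _ => rfl) ?_
  intro i C C1 C2 _ hm h1
  have h3 := hm.pp_eq
  have h4 := hm.AA_eq 0
  rw [if_pos (by omega), if_pos (by omega)] at h4
  omega

end

/-- analysis of a level above a hole -/
lemma levelB {z K : ℕ} {l : List ℕ} {C C' : Finset ℕ} (hl : ∀ j ∈ l, z + 3 ≤ j)
    (h : Rch (z :: (z+1) :: (z+2) :: l) C C') (hz : z ∉ C) (hK : hb C z = K) :
    (AA K C' + 2 * pp C = AA K C + 2 * pp C' ∧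
        AA (K+1) C' + 2 * pp C = AA (K+1) C + 2 * pp C') ∨
    (AA K C' + 2 * pp C + 1 = AA K C + 2 * pp C' ∧
        AA (K+1) C' + 2 * pp C + 2 = AA (K+1) C + 2 * pp C') ∨
    (1 ≤ z ∧ z - 1 ∈ C ∧ AA K C' + 2 * pp C = AA K C + 2 * pp C' ∧
        (AA (K+1) C' + 2 * pp C + 2 = AA (K+1) C + 2 * pp C' ∨
         AA (K+1) C' + 2 * pp C + 1 = AA (K+1) C + 2 * pp C')) := by
  obtain ⟨C1, h1, C2, h2, C3, h3, h4⟩ := h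
  have hz1 : hb C (z+1) = K + 1 := by rw [hb, hK, if_neg hz]
  have hh1 := h4.AA_high K z hl
  have hh2 := h4.AA_high (K+1) z hl
  rcases h1 with rfl | h1
  · -- no move onto z
    rcases h3 with rfl | h3
    · rcases h2 with rfl | h2
      · left
        exact ⟨hh1 (by omega), hh2 (by omega)⟩
      · obtain ⟨i, hi, h2⟩ := h2.exi
        obtain rfl : z = i + 1 := by omega
        right; right
        have a1 := h2.AA_eq K
        have a2 := h2.AA_eq (K+1)
        have a3 := h2.pp_eq
        have b2 := h2.hb2
        have c1 := h2.hbC1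
        rw [if_neg hz] at b2
        rw [if_neg hz] at a1 a2
        rw [if_pos (by omega), if_pos (by omega)] at a1
        rw [if_neg (by omega), if_pos (by omega)] at a2
        have := hh1 (by show K ≤ hb C3 (i+2); omega)
        have := hh2 (by show K + 1 ≤ hb C3 (i+2); omega)
        exact ⟨by omega, h2.src, by omega, by omega⟩
    · exfalso
      have : z ∈ C2 := h3.src
      rcases h2 with rfl | h2
      · exact hz this
      · obtain ⟨i, hi, h2⟩ := h2.exi
        rw [h2.mem] at this
        rcases this with h | h
        · omega
        · exact hz h.2
  · obtain ⟨i, rfl, h1⟩ := h1.exi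
    have a1 := h1.AA_eq K
    have a2 := h1.AA_eq (K+1)
    have a3 := h1.pp_eq
    have b2 := h1.hb2
    have c1 := h1.hbC1
    have c2 := h1.hbC2
    have b3 := h1.hb_high (i+3) le_rfl
    have hz1' : hb C (i+3) = K + 1 := hz1
    by_cases hi1 : i + 1 ∈ C
    · -- type (a)
      rw [if_pos hi1] at a1 a2 b2 c2
      rw [if_pos (by omega), if_pos (by omega)] at a1
      rw [if_neg (by omega), if_neg (by omega)] at a2
      right; right
      refine ⟨by omega, hi1, ?_⟩
      have key : AA K C3 + 2 * pp C1 = AA K C1 + 2 * pp C3 ∧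
        AA (K+1) C3 + 2 * pp C1 = AA (K+1) C1 + 2 * pp C3 ∧ K + 1 ≤ hb C3 (i+3) := by
        have k1 : AA K C2 + 2 * pp C1 = AA K C1 + 2 * pp C2 ∧
          AA (K+1) C2 + 2 * pp C1 = AA (K+1) C1 + 2 * pp C2 ∧ K + 1 ≤ hb C2 (i+2) ∧
            K + 1 ≤ hb C2 (i+3) := by
          rcases h2 with rfl | h2
          · exact ⟨rfl, rfl, by omega, by omega⟩
          · have a1 := h2.AA_eq K
            have a2 := h2.AA_eq (K+1)
            have a3 := h2.pp_eq
            have b2 := h2.hb1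
            have b4 := h2.hb_mono (i+3)
            have c1 : hb C1 (i+2) = hb C1 (i+1) := h2.hbC1
            rw [if_pos (by omega), if_pos (by omega)] at a1
            rw [if_pos (by omega), if_pos (by omega)] at a2
            refine ⟨by omega, by omega, ?_, by omega⟩
            show K + 1 ≤ hb C2 (i+1+1)
            omega
        rcases h3 with rfl | h3
        · exact ⟨k1.1, k1.2.1, by omega⟩
        · have a1 := h3.AA_eq K
          have a2 := h3.AA_eq (K+1)
          have a3 := h3.pp_eq
          have b2 := h3.hb_mono (i+3)
          rw [if_pos (by omega), if_pos (by omega)] at a1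
          rw [if_pos (by omega), if_pos (by omega)] at a2
          exact ⟨by omega, by omega, by omega⟩
      have := hh1 (by show K ≤ hb C3 (i+3); omega)
      have := hh2 (by show K + 1 ≤ hb C3 (i+3); omega)
      constructor <;> omega
    · -- type (b)
      rw [if_neg hi1] at a1 a2 b2 c2
      rw [if_neg (by omega), if_pos (by omega)] at a1
      rw [if_neg (by omega), if_neg (by omega)] at a2
      have hC2 : C2 = C1 := by
        rcases h2 with h2 | h2
        · exact h2
        · exfalso
          have := h2.src
          rw [h1.mem] at this
          rcases this with h | h
          · omega
          · exact hi1 h.2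
      subst hC2
      right; left
      have key : AA K C3 + 2 * pp C2 = AA K C2 + 2 * pp C3 ∧
        AA (K+1) C3 + 2 * pp C2 = AA (K+1) C2 + 2 * pp C3 ∧ K + 1 ≤ hb C3 (i+3) := by
        rcases h3 with rfl | h3
        · exact ⟨rfl, rfl, by omega⟩
        · have a1 := h3.AA_eq K
          have a2 := h3.AA_eq (K+1)
          have a3 := h3.pp_eq
          have b2 := h3.hb_mono (i+3)
          rw [if_pos (by omega), if_pos (by omega)] at a1
          rw [if_pos (by omega), if_pos (by omega)] at a2
          exact ⟨by omega, by omega, by omega⟩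
      have := hh1 (by show K ≤ hb C3 (i+3); omega)
      have := hh2 (by show K + 1 ≤ hb C3 (i+3); omega)
      constructor <;> omega

/-- in a level with equal truncations no bead passes over the hole -/
lemma levelA {z K : ℕ} {l1 l2 : List ℕ} {C C1 C2 C' : Finset ℕ} (hl1 : ∀ j ∈ l1, j ≤ z + 1)
    (hl2 : ∀ j ∈ l2, z + 3 ≤ j) (h1 : Rch l1 C C1) (h2 : Mv (z+2) C1 C2) (h3 : Rch l2 C2 C')
    (hK : hb C' z = K) :
    (AA K C' - AA K C) / 2 ≠ (AA (K+1) C' - AA (K+1) C) / 2 := by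
  have k2 := (h3.high z hl2).2
  have e1 : hb C2 z = K := by rw [← k2 z (by omega), hK]
  have e2 : hb C1 z = K := by rw [← h2.hb_low z le_rfl, e1]
  have e3 : hb C1 (z+1) = K := by rw [h2.hbC1, e2]
  have e4 := h2.hb1
  have a1 := h1.AA_low K (z+1) hl1 (by omega)
  have a2 := h1.AA_low (K+1) (z+1) hl1 (by omega)
  have b1 := h3.AA_high K z hl2 (by omega)
  have b2 := h3.AA_high (K+1) z hl2 (by omega)
  have c1 := h2.AA_eq K
  have c2 := h2.AA_eq (K+1)
  rw [if_pos (by omega), if_pos (by omega)] at c1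
  rw [if_neg (by omega)] at c2
  have := h3.pp_mono
  split_ifs at c2 <;> omega

lemma exists_hole (C : Finset ℕ) (K : ℕ) : ∃ z, z ∉ C ∧ hb C z = K := by
  have hunb : ∀ K, ∃ n, K ≤ hb C n := by
    intro K
    obtain ⟨B, hB⟩ : ∃ B, ∀ s, B ≤ s → s ∉ C := by
      refine ⟨C.sup id + 1, fun s hs h => ?_⟩
      have := Finset.le_sup (f := id) h
      simp only [id] at this; omega
    have : ∀ K, K ≤ hb C (B + K) := by
      intro K
      induction K with
      | zero => omega
      | succ K ih => rw [← add_assoc, hb, if_neg (hB _ (by omega))]; omega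
    exact ⟨_, this K⟩
  classical
  have hex := hunb (K+1)
  have h1 := Nat.find_spec hex
  have h2 := fun m => @Nat.find_min _ _ hex m
  generalize Nat.find hex = n at h1 h2
  cases n with
  | zero => simp [hb] at h1
  | succ n =>
    have h3 := h2 n (by omega)
    rw [hb] at h1
    refine ⟨n, ?_, ?_⟩
    · intro h; rw [if_pos h] at h1; omega
    · split_ifs at h1 <;> omega

lemma hole_unique (C : Finset ℕ) {z z' : ℕ} (h : z ∉ C) (h' : z' ∉ C) (e : hb C z = hb C z') :
    z = z' := by
  by_contra hne
  rcases Nat.lt_or_gt_of_ne hne with h1 | h1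
  · have := hb_mono_n C (show z + 1 ≤ z' by omega)
    rw [hb, if_neg h] at this; omega
  · have := hb_mono_n C (show z' + 1 ≤ z by omega)
    rw [hb, if_neg h'] at this; omega

lemma AA_class {C C' : Finset ℕ} {z K K' : ℕ} (h : ∀ s, z ≤ s → (s ∈ C' ↔ s ∈ C))
    (h1 : hb C z = K) (h2 : hb C' z = K) (hK : K ≤ K') : AA K' C' = AA K' C := by
  have key : ∀ D : Finset ℕ, hb D z = K → AA K' D = ∑ s ∈ D.filter (z ≤ ·), (hb D s - K') := by
    intro D hD
    unfold AA
    rw [Finset.sum_filter]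
    apply Finset.sum_congr rfl
    intro s _
    split_ifs with hs
    · rfl
    · have := hb_mono_n D (show s ≤ z by omega)
      omega
  rw [key C h1, key C' h2]
  have e : C'.filter (z ≤ ·) = C.filter (z ≤ ·) := by
    ext s; simp only [Finset.mem_filter]
    constructor
    · rintro ⟨a, b⟩; exact ⟨(h s b).1 a, b⟩
    · rintro ⟨a, b⟩; exact ⟨(h s b).2 a, b⟩
  rw [e]
  apply Finset.sum_congr rfl
  intro s hs
  rw [hb_congr_high C C' z h (h2.trans h1.symm) s (Finset.mem_filter.1 hs).2]

lemma AA_big {C : Finset ℕ} {L K : ℕ} (h : ∀ s ∈ C, s < L) (hK : L ≤ K) : AA K C = 0 := by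
  unfold AA
  apply Finset.sum_eq_zero
  intro s hs
  have := hb_le C s
  have := h s hs
  omega

/-- the truncated multiplicities of a level -/
def RR (K : ℕ) (C C' : Finset ℕ) : ℕ := (AA K C' - AA K C) / 2

end Beads


/-! ### Matrices of moves -/
section Mats

variable {St : Type} [Fintype St] [DecidableEq St] {R : Type*} [CommRing R]

/-- one factor -/
def FF (U : ℕ → Matrix St St ℤ) (j : ℕ) (x : R) : Matrix St St R :=
  1 + x • (U j).map (Int.cast : ℤ → R)

/-- product of factors along a list -/
def PL (U : ℕ → Matrix St St ℤ) (l : List ℕ) (x : R) : Matrix St St R :=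
  (l.map fun j => FF U j x).prod

lemma PL_nil (U : ℕ → Matrix St St ℤ) (x : R) : PL U [] x = 1 := rfl
lemma PL_cons (U : ℕ → Matrix St St ℤ) (j : ℕ) (l : List ℕ) (x : R) :
    PL U (j :: l) x = FF U j x * PL U l x := by simp [PL]
lemma PL_append (U : ℕ → Matrix St St ℤ) (l1 l2 : List ℕ) (x : R) :
    PL U (l1 ++ l2) x = PL U l1 x * PL U l2 x := by simp [PL]
lemma PL_single (U : ℕ → Matrix St St ℤ) (j : ℕ) (x : R) :
    PL U [j] x = FF U j x := by simp [PL]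

lemma FF_map {R' : Type*} [CommRing R'] (U : ℕ → Matrix St St ℤ) (j : ℕ) (x : R) (f : R →+* R') :
    f.mapMatrix (FF U j x) = FF U j (f x) := by
  ext s s'
  simp [FF, Matrix.one_apply, apply_ite f]

lemma PL_map {R' : Type*} [CommRing R'] (U : ℕ → Matrix St St ℤ) (l : List ℕ) (x : R) (f : R →+* R') :
    f.mapMatrix (PL U l x) = PL U l (f x) := by
  rw [PL, map_list_prod, List.map_map]
  simp only [Function.comp_def, FF_map, PL]

/-- The abstract data. -/
structure BSys (St : Type) [Fintype St] [DecidableEq St] where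
  C : St → Finset ℕ
  U : ℕ → Matrix St St ℤ
  L : ℕ
  bd : ∀ s, ∀ x ∈ C s, x < L
  nn : ∀ j s s', 0 ≤ U j s s'
  P1 : ∀ j s s', U j s s' ≠ 0 → Mv j (C s) (C s')
  P2 : ∀ i j, i + 4 ≤ j → Commute (U i) (U j)
  P3 : ∀ (N n : ℕ) (x y : MvPolynomial (Fin N) ℤ),
    Commute (PL U (List.range n) x) (PL U (List.range n) y)
  P4 : ∀ (N n : ℕ) (x y : MvPolynomial (Fin N) ℤ),
    Commute (PL U (List.range n ++ [n+1]) x) (PL U (List.range n ++ [n+1]) y)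

lemma mul_supp {M N : Matrix St St R} {s s' : St} (h : (M * N) s s' ≠ 0) :
    ∃ s1, M s s1 ≠ 0 ∧ N s1 s' ≠ 0 := by
  rw [Matrix.mul_apply] at h
  obtain ⟨s1, -, h1⟩ := Finset.exists_ne_zero_of_sum_ne_zero h
  exact ⟨s1, left_ne_zero_of_mul h1, right_ne_zero_of_mul h1⟩

variable (S : BSys St)

lemma BSys.U_supp {j : ℕ} {x : R} {s s' : St}
    (h : (x • (S.U j).map (Int.cast : ℤ → R)) s s' ≠ 0) : Mv j (S.C s) (S.C s') := by
  apply S.P1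
  intro h0
  apply h
  simp [h0]

lemma BSys.FF_supp {j : ℕ} {x : R} {s s' : St}
    (h : FF S.U j x s s' ≠ 0) : Stp j (S.C s) (S.C s') := by
  by_cases hs : s = s'
  · left; rw [hs]
  · right
    apply S.U_supp (x := x)
    intro h0
    apply h
    rw [FF, Matrix.add_apply, h0, Matrix.one_apply_ne hs, add_zero]

lemma BSys.PL_supp {l : List ℕ} {x : R} {s s' : St}
    (h : PL S.U l x s s' ≠ 0) : Rch l (S.C s) (S.C s') := by
  induction l generalizing s with
  | nil =>
    rw [PL_nil] at h
    by_cases hs : s = s'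
    · rw [hs]; rfl
    · exact absurd (Matrix.one_apply_ne hs) h
  | cons j l ih =>
    rw [PL_cons] at h
    obtain ⟨s1, h1, h2⟩ := mul_supp h
    exact ⟨_, S.FF_supp h1, ih h2⟩

lemma BSys.PL_homog (l : List ℕ) (x : R) (s s' : St) :
    PL S.U l x s s' = x ^ (pp (S.C s') - pp (S.C s)) * PL S.U l 1 s s' := by
  induction l generalizing s with
  | nil =>
    by_cases hs : s = s'
    · subst hs; simp [PL_nil]
    · simp [PL_nil, Matrix.one_apply_ne hs]
  | cons j l ih =>
    rw [PL_cons, PL_cons, FF, FF, add_mul, add_mul, Matrix.add_apply, Matrix.add_apply, one_mul,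
      one_mul, mul_add, ← ih, add_right_inj, Matrix.mul_apply, Matrix.mul_apply, Finset.mul_sum]
    apply Finset.sum_congr rfl
    intro s1 _
    simp only [Matrix.smul_apply, Matrix.map_apply, smul_eq_mul, one_mul]
    by_cases hU : S.U j s s1 = 0
    · simp [hU]
    rw [ih s1]
    by_cases hM : PL S.U l (1 : R) s1 s' = 0
    · simp [hM]
    obtain ⟨i, rfl, hm⟩ := (S.P1 _ _ _ hU).exi
    have h1 := hm.pp_eq
    have h2 := (S.PL_supp hM).pp_mono
    have e : pp (S.C s') - pp (S.C s) = (pp (S.C s') - pp (S.C s1)) + 1 := by omega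
    rw [e, pow_succ]
    ring

lemma BSys.PL_nonneg (l : List ℕ) (s s' : St) : 0 ≤ PL S.U l (1 : ℤ) s s' := by
  induction l generalizing s with
  | nil =>
    rw [PL_nil, Matrix.one_apply]; split_ifs <;> simp
  | cons j l ih =>
    rw [PL_cons, Matrix.mul_apply]
    apply Finset.sum_nonneg
    intro s1 _
    apply mul_nonneg _ (ih s1)
    rw [FF, Matrix.add_apply, Matrix.one_apply]
    have := S.nn j s s1
    simp only [one_smul, Matrix.map_apply, Int.cast_id]
    split_ifs <;> omega

lemma BSys.U_big {j : ℕ} (hj : S.L ≤ j) : S.U j = 0 := by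
  ext s s'
  by_contra h
  have := S.P1 _ _ _ h
  have h2 : j ∈ S.C s' := by rw [this.2.2.2]; simp
  have := S.bd _ _ h2
  omega

lemma BSys.PL_range {n : ℕ} (hn : S.L ≤ n) (x : R) :
    PL S.U (List.range n) x = PL S.U (List.range S.L) x := by
  induction n, hn using Nat.le_induction with
  | base => rfl
  | succ n hn ih =>
    rw [List.range_succ, PL_append, ih, PL_single, FF, S.U_big hn]
    simp

lemma BSys.PL_comm (l1 l2 : List ℕ) (h : ∀ i ∈ l1, ∀ j ∈ l2, i + 4 ≤ j) (x y : R) :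
    Commute (PL S.U l1 x) (PL S.U l2 y) := by
  have key : ∀ i j, i + 4 ≤ j → Commute (FF S.U i x) (FF S.U j y) := by
    intro i j hij
    apply Commute.add_left (Commute.one_left _)
    apply Commute.add_right (Commute.one_right _)
    apply Commute.smul_left
    apply Commute.smul_right
    have := S.P2 i j hij
    exact this.map (Int.castRingHom R).mapMatrix
  apply Commute.list_prod_left
  intro a ha
  apply Commute.list_prod_right
  intro b hb
  rw [List.mem_map] at ha hb
  obtain ⟨i, hi, rfl⟩ := ha
  obtain ⟨j, hj, rfl⟩ := hb
  exact key i j (h i hi j hj)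

/-- class of states sharing the beads above a hole -/
def BSys.cls (z K : ℕ) (t0 t : St) : Prop :=
  (∀ s, z ≤ s → (s ∈ S.C t ↔ s ∈ S.C t0)) ∧ hb (S.C t) z = K

open Classical in
/-- the key local symmetry -/
lemma BSys.star {N : ℕ} (x y : MvPolynomial (Fin N) ℤ) (z K rho : ℕ) (a t0 b : St)
    (hz : z ∉ S.C t0) (hK : hb (S.C t0) z = K)
    (r1 : RR K (S.C a) (S.C t0) = rho) (r2 : RR (K+1) (S.C a) (S.C t0) = rho)
    (r3 : RR K (S.C t0) (S.C b) = rho + 1) (r4 : RR (K+1) (S.C t0) (S.C b) = rho) :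
    x * ∑ t, (if S.cls z K t0 t then
        PL S.U (List.range S.L) x a t * PL S.U (List.range S.L) y t b else 0)
    = y * ∑ t, (if S.cls z K t0 t then
        PL S.U (List.range S.L) y a t * PL S.U (List.range S.L) x t b else 0) := by
  set l2 := (List.range S.L).map (z + 3 + ·) with hl2
  have hl2m : ∀ j ∈ l2, z + 3 ≤ j := by
    intro j hj
    rw [hl2, List.mem_map] at hj
    obtain ⟨i, -, rfl⟩ := hj
    omega
  set Lo := fun x : MvPolynomial (Fin N) ℤ => PL S.U (List.range z) x with hLo
  set Lp := fun x : MvPolynomial (Fin N) ℤ => PL S.U (List.range z ++ [z+1]) x with hLp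
  set Rr := fun x : MvPolynomial (Fin N) ℤ => PL S.U l2 x with hRr
  set Bb := fun x : MvPolynomial (Fin N) ℤ => PL S.U (z :: (z+1) :: (z+2) :: l2) x with hBb
  have hH : ∀ x : MvPolynomial (Fin N) ℤ, PL S.U (List.range S.L) x = Lo x * Bb x := by
    intro x
    rw [← S.PL_range (show S.L ≤ z + 3 + S.L by omega), List.range_add, List.range_succ,
      List.range_succ, List.range_succ]
    simp only [hLo, hBb, ← PL_append]
    simp [hl2]
  set Pi : Matrix St St (MvPolynomial (Fin N) ℤ) :=
    Matrix.diagonal (fun t => if S.cls z K t0 t then 1 else 0) with hPi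
  have hcs : ∀ x y : MvPolynomial (Fin N) ℤ, ∑ t, (if S.cls z K t0 t then
        PL S.U (List.range S.L) x a t * PL S.U (List.range S.L) y t b else 0)
      = (PL S.U (List.range S.L) x * Pi * PL S.U (List.range S.L) y) a b := by
    intro x y
    rw [Matrix.mul_apply]
    apply Finset.sum_congr rfl
    intro t _
    rw [hPi, Matrix.mul_diagonal]
    split_ifs <;> simp
  -- class invariants
  have hclsA : ∀ t, S.cls z K t0 t → ∀ K', K ≤ K' → AA K' (S.C t) = AA K' (S.C t0) :=
    fun t ht K' hK' => AA_class ht.1 hK ht.2 hK'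
  have hclsz : ∀ t, S.cls z K t0 t → z ∉ S.C t := fun t ht h => hz ((ht.1 z le_rfl).1 h)
  -- step 1
  have step1 : ∀ (x : MvPolynomial (Fin N) ℤ) (t : St),
      (PL S.U (List.range S.L) x * Pi) a t = (Lp x * Rr x * Pi) a t := by
    intro x t
    rw [hPi, Matrix.mul_diagonal, Matrix.mul_diagonal]
    split_ifs with ht
    swap
    · simp
    rw [mul_one, mul_one, ← sub_eq_zero, ← Matrix.sub_apply]
    have e : PL S.U (List.range S.L) x - Lp x * Rr x
        = Lo x * (x • (S.U z).map (Int.cast : ℤ → MvPolynomial (Fin N) ℤ)) * PL S.U [z+1, z+2] x * Rr x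
        + Lp x * (x • (S.U (z+2)).map (Int.cast : ℤ → MvPolynomial (Fin N) ℤ)) * Rr x := by
      rw [hH]
      simp only [hLo, hLp, hBb, hRr, PL_append, PL_cons, PL_nil]
      rw [show FF S.U z x = 1 + (x • (S.U z).map (Int.cast : ℤ → MvPolynomial (Fin N) ℤ)) from rfl,
        show FF S.U (z+2) x = 1 + (x • (S.U (z+2)).map (Int.cast : ℤ → MvPolynomial (Fin N) ℤ)) from rfl]
      generalize x • (S.U z).map (Int.cast : ℤ → MvPolynomial (Fin N) ℤ) = V1
      generalize x • (S.U (z+2)).map (Int.cast : ℤ → MvPolynomial (Fin N) ℤ) = V2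
      noncomm_ring
    have hrr : (AA K (S.C t) - AA K (S.C a)) / 2 = (AA (K+1) (S.C t) - AA (K+1) (S.C a)) / 2 := by
      rw [hclsA t ht K le_rfl, hclsA t ht (K+1) (by omega)]
      exact r1.trans r2.symm
    have hrg : ∀ j ∈ List.range z, j ≤ z + 1 := by
      intro j hj; rw [List.mem_range] at hj; omega
    rw [e, Matrix.add_apply]
    have z1 : (Lo x * (x • (S.U z).map (Int.cast : ℤ → MvPolynomial (Fin N) ℤ)) *
        PL S.U [z+1, z+2] x * Rr x) a t = 0 := by
      by_contra h
      obtain ⟨t3, h, h4⟩ := mul_supp h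
      obtain ⟨t2, h, h3⟩ := mul_supp h
      obtain ⟨t1, h1, h2⟩ := mul_supp h
      have h1 := S.PL_supp h1
      have h2 := S.U_supp h2
      have h3 := S.PL_supp h3
      have h4 := S.PL_supp h4
      obtain ⟨D1, d1, D2, d2, d3⟩ := h3
      rw [Rch] at d3
      subst d3
      have hzm : z ∈ D1 := by
        have hz2 : z ∈ S.C t2 := by rw [h2.2.2.2]; simp
        rcases d1 with rfl | d1
        · exact hz2
        · obtain ⟨i, hi, d1⟩ := d1.exi
          rw [d1.mem]
          right; exact ⟨by omega, hz2⟩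
      rcases d2 with d2 | d2
      · have := (h4.high z hl2m).1 z le_rfl
        rw [d2] at this
        exact hclsz t ht (this.2 hzm)
      · refine levelA (l1 := List.range z ++ ([z] ++ [z+1])) ?_ hl2m
          (h1.append (Rch.append (C1 := S.C t2) ⟨_, Or.inr h2, rfl⟩ ⟨_, d1, rfl⟩)) d2 h4 ht.2 hrr
        intro j hj
        simp only [List.mem_append, List.mem_range, List.mem_singleton] at hj
        omega
    have z2 : (Lp x * (x • (S.U (z+2)).map (Int.cast : ℤ → MvPolynomial (Fin N) ℤ)) * Rr x) a t
        = 0 := by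
      by_contra h
      obtain ⟨t2, h, h3⟩ := mul_supp h
      obtain ⟨t1, h1, h2⟩ := mul_supp h
      refine levelA ?_ hl2m (S.PL_supp h1) (S.U_supp h2) (S.PL_supp h3) ht.2 hrr
      intro j hj
      simp only [List.mem_append, List.mem_range, List.mem_singleton] at hj
      omega
    rw [z1, z2, add_zero]
  -- step 2
  have hrz : ∀ j ∈ List.range z, j < z := fun j hj => List.mem_range.1 hj
  have cPi : ∀ y, Commute (Lo y) Pi := by
    intro y
    ext s s'
    rw [hPi, Matrix.mul_diagonal, Matrix.diagonal_mul]
    by_cases h : Lo y s s' = 0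
    · rw [h, mul_zero, zero_mul]
    · have h1 := (S.PL_supp h).low z hrz
      have : S.cls z K t0 s' ↔ S.cls z K t0 s := by
        unfold BSys.cls
        rw [h1.2 z le_rfl]
        constructor
        · rintro ⟨h2, h3⟩; exact ⟨fun u hu => (h1.1 u hu).symm.trans (h2 u hu), h3⟩
        · rintro ⟨h2, h3⟩; exact ⟨fun u hu => (h1.1 u hu).trans (h2 u hu), h3⟩
      simp only [this, mul_comm]
  have cR : ∀ x y, Commute (Lo y) (Rr x) := by
    intro x y
    apply S.PL_comm
    intro i hi j hj
    have := hrz i hi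
    have := hl2m j hj
    omega
  have step2 : ∀ x y : MvPolynomial (Fin N) ℤ,
      (PL S.U (List.range S.L) x * Pi * PL S.U (List.range S.L) y) a b
      = ∑ s1, (Lp x * Lo y) a s1 * (Rr x * Pi * Bb y) s1 b := by
    intro x y
    rw [← Matrix.mul_apply]
    have e : Lp x * Lo y * (Rr x * Pi * Bb y) = Lp x * Rr x * Pi * PL S.U (List.range S.L) y := by
      rw [hH y]
      calc Lp x * Lo y * (Rr x * Pi * Bb y) = Lp x * (Lo y * Rr x) * Pi * Bb y := by noncomm_ring
        _ = Lp x * Rr x * (Lo y * Pi) * Bb y := by rw [(cR x y).eq]; noncomm_ring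
        _ = _ := by rw [(cPi y).eq]; noncomm_ring
    rw [e, Matrix.mul_apply, Matrix.mul_apply]
    apply Finset.sum_congr rfl
    intro t _
    rw [step1]
  rw [hcs, hcs, step2, step2, Finset.mul_sum, Finset.mul_sum]
  -- level b
  have hB : ∀ (y : MvPolynomial (Fin N) ℤ) (t : St), S.cls z K t0 t → Bb y t b ≠ 0 →
      (1 ≤ z ∧ z - 1 ∈ S.C t) ∧ pp (S.C b) - pp (S.C t) = rho + 1 := by
    intro y t ht h
    have hr := S.PL_supp h
    have hpp := hr.pp_mono
    have m1 := hr.AA_mono K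
    have m2 := hr.AA_mono (K+1)
    have a1 := hclsA t ht K le_rfl
    have a2 := hclsA t ht (K+1) (by omega)
    unfold RR at r3 r4
    rw [← a1] at r3
    rw [← a2] at r4
    rcases levelB hl2m hr (hclsz t ht) ht.2 with h1 | h1 | h1
    · exfalso; omega
    · exfalso; omega
    · exact ⟨⟨h1.1, h1.2.1⟩, by omega⟩
  have hR : ∀ (x : MvPolynomial (Fin N) ℤ) (s1 t : St), S.cls z K t0 t → Rr x s1 t ≠ 0 →
      hb (S.C s1) (z+1) = K + 1 ∧ (AA (K+1) (S.C s1) = AA (K+1) (S.C a) →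
        pp (S.C t) - pp (S.C s1) = rho) := by
    intro x s1 t ht h
    have hr := S.PL_supp h
    have h1 := (hr.high z hl2m).2 (z+1) le_rfl
    have h2 : hb (S.C t) (z+1) = K + 1 := by rw [hb, ht.2, if_neg (hclsz t ht)]
    refine ⟨by omega, fun h3 => ?_⟩
    have h4 := hr.AA_high (K+1) z hl2m (by omega)
    have h5 := hclsA t ht (K+1) (by omega)
    have h6 := hr.pp_mono
    unfold RR at r2
    omega
  have hW : ∀ (x y : MvPolynomial (Fin N) ℤ) (s1 : St), AA (K+1) (S.C s1) = AA (K+1) (S.C a) →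
      (Rr x * Pi * Bb y) s1 b = x ^ rho * y ^ (rho + 1) * (Rr 1 * Pi * Bb 1) s1 b := by
    intro x y s1 h1
    rw [Matrix.mul_apply, Matrix.mul_apply, Finset.mul_sum]
    apply Finset.sum_congr rfl
    intro t _
    rw [hPi, Matrix.mul_diagonal, Matrix.mul_diagonal]
    split_ifs with ht
    swap
    · simp
    rw [mul_one, mul_one]
    have hx : Rr x s1 t = _ := S.PL_homog l2 x s1 t
    have hy : Bb y t b = _ := S.PL_homog _ y t b
    rw [hx, hy]
    by_cases n1 : Rr 1 s1 t = 0
    · rw [n1]; simp only [hRr] at n1; rw [n1]; simp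
    by_cases n2 : Bb 1 t b = 0
    · rw [n2]; simp only [hBb] at n2; rw [n2]; simp
    rw [(hR 1 s1 t ht n1).2 h1, (hB 1 t ht n2).2]
    simp only [hRr, hBb]
    ring
  have hgood : ∀ (x y x' y' : MvPolynomial (Fin N) ℤ) (s1 : St), (Lp x * Lo y) a s1 ≠ 0 →
      (Rr x' * Pi * Bb y') s1 b ≠ 0 →
      (1 ≤ z ∧ z - 1 ∈ S.C s1) ∧ AA (K+1) (S.C s1) = AA (K+1) (S.C a) := by
    intro x y x' y' s1 h1 h2
    obtain ⟨t, h2, h3⟩ := mul_supp h2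
    rw [hPi, Matrix.mul_diagonal] at h2
    have ht : S.cls z K t0 t := by
      by_contra hn
      rw [if_neg hn, mul_zero] at h2; exact h2 rfl
    rw [if_pos ht, mul_one] at h2
    have b1 := (hB y' t ht h3).1
    refine ⟨⟨b1.1, ?_⟩, ?_⟩
    · exact (((S.PL_supp h2).high z hl2m).1 (z-1) (by omega)).1 b1.2
    · obtain ⟨s2, h4, h5⟩ := mul_supp h1
      have h6 := (S.PL_supp h4).append (S.PL_supp h5)
      apply h6.AA_low (K+1) (z+1)
      · intro j hj
        simp only [List.mem_append, List.mem_range, List.mem_singleton] at hj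
        omega
      · exact (hR x' s1 t ht h2).1.le
  have hLL : ∀ (x y : MvPolynomial (Fin N) ℤ) (s1 : St), 1 ≤ z → z - 1 ∈ S.C s1 →
      (Lp x * Lo y) a s1 = (Lp x * Lp y) a s1 := by
    intro x y s1 hz1 hs1
    have e : Lp x * Lp y = Lp x * Lo y + Lp x * Lo y *
        (y • (S.U (z+1)).map (Int.cast : ℤ → MvPolynomial (Fin N) ℤ)) := by
      have : Lp y = Lo y * (1 + (y • (S.U (z+1)).map (Int.cast : ℤ → MvPolynomial (Fin N) ℤ))) := by
        simp only [hLp, hLo, PL_append, PL_single]; rfl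
      rw [this]; noncomm_ring
    rw [e, Matrix.add_apply]
    suffices (Lp x * Lo y * (y • (S.U (z+1)).map (Int.cast : ℤ → MvPolynomial (Fin N) ℤ))) a s1 = 0 by
      rw [this, add_zero]
    by_contra h
    obtain ⟨s2, -, h2⟩ := mul_supp h
    obtain ⟨i, hi, h3⟩ := (S.U_supp h2).exi
    rw [h3.mem] at hs1
    omega
  apply Finset.sum_congr rfl
  intro s1 _
  by_cases hg : (1 ≤ z ∧ z - 1 ∈ S.C s1) ∧ AA (K+1) (S.C s1) = AA (K+1) (S.C a)
  · rw [hW x y s1 hg.2, hW y x s1 hg.2, hLL x y s1 hg.1.1 hg.1.2, hLL y x s1 hg.1.1 hg.1.2]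
    have : Lp x * Lp y = Lp y * Lp x := S.P4 N z x y
    rw [this]
    ring
  · have : ∀ x y : MvPolynomial (Fin N) ℤ, (Lp x * Lo y) a s1 * (Rr x * Pi * Bb y) s1 b = 0 := by
      intro x y
      by_contra h
      exact hg (hgood x y x y s1 (left_ne_zero_of_mul h) (right_ne_zero_of_mul h))
    rw [this, this, mul_zero, mul_zero]

end Mats


/-! ### Schur nonnegativity: closure properties -/
section SNclosure

lemma sn_zero (N : ℕ) : IsSchurNonneg N 0 :=
  ⟨0, Fin.elim0, Fin.elim0, fun i => Fin.elim0 i, fun i => Fin.elim0 i, fun i => Fin.elim0 i, by simp⟩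

lemma sn_add {N : ℕ} {f g : MvPolynomial (Fin N) ℤ} (hf : IsSchurNonneg N f)
    (hg : IsSchurNonneg N g) : IsSchurNonneg N (f + g) := by
  obtain ⟨m, c, k, lam, h1, h2, rfl⟩ := hf
  obtain ⟨m', c', k', lam', h1', h2', rfl⟩ := hg
  refine ⟨m + m', Fin.append c c', Fin.append k k', Fin.append lam lam', ?_, ?_, ?_⟩
  · intro i
    refine Fin.addCases (fun i => ?_) (fun i => ?_) i
    · simpa using h1 i
    · simpa using h1' i
  · intro i
    refine Fin.addCases (fun i => ?_) (fun i => ?_) i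
    · simpa using h2 i
    · simpa using h2' i
  · rw [Fin.sum_univ_add]
    simp

lemma sn_single {N : ℕ} (c k : ℕ) (lam : ℕ → ℕ) (h1 : Antitone lam) (h2 : ∀ j, k ≤ j → lam j = 0) :
    IsSchurNonneg N ((c : ℤ) • skewSchur N k lam (fun _ => 0)) :=
  ⟨1, fun _ => c, fun _ => k, fun _ => lam, fun _ => h1, fun _ => h2, by simp⟩

lemma sn_sum {N : ℕ} {ι : Type*} (s : Finset ι) (f : ι → MvPolynomial (Fin N) ℤ)
    (h : ∀ i ∈ s, IsSchurNonneg N (f i)) : IsSchurNonneg N (∑ i ∈ s, f i) := by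
  classical
  induction s using Finset.induction_on with
  | empty => simpa using sn_zero N
  | insert a s ha ih =>
    rw [Finset.sum_insert ha]
    exact sn_add (h a (Finset.mem_insert_self _ _))
      (ih fun i hi => h i (Finset.mem_insert_of_mem hi))

end SNclosure

/-! ### Antisymmetrisation -/
section Alternation

/-- antisymmetrisation -/
noncomputable def Altn (N : ℕ) (f : MvPolynomial (Fin N) ℤ) : MvPolynomial (Fin N) ℤ :=
  ∑ w : Equiv.Perm (Fin N), ((Equiv.Perm.sign w : ℤˣ) : ℤ) • MvPolynomial.rename w f

lemma Altn_sum {N : ℕ} {ι : Type*} (s : Finset ι) (f : ι → MvPolynomial (Fin N) ℤ) :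
    Altn N (∑ i ∈ s, f i) = ∑ i ∈ s, Altn N (f i) := by
  unfold Altn
  rw [Finset.sum_comm]
  apply Finset.sum_congr rfl
  intro w _
  rw [map_sum, Finset.smul_sum]

lemma Altn_add {N : ℕ} (f g : MvPolynomial (Fin N) ℤ) :
    Altn N (f + g) = Altn N f + Altn N g := by
  unfold Altn
  rw [← Finset.sum_add_distrib]
  apply Finset.sum_congr rfl
  intro w _
  rw [map_add, smul_add]

lemma Altn_symm {N : ℕ} (f F : MvPolynomial (Fin N) ℤ)
    (hF : ∀ w : Equiv.Perm (Fin N), MvPolynomial.rename w F = F) : Altn N (f * F) = Altn N f * F := by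
  unfold Altn
  rw [Finset.sum_mul]
  apply Finset.sum_congr rfl
  intro w _
  rw [map_mul, hF, smul_mul_assoc]

lemma Altn_smul {N : ℕ} (c : ℤ) (f : MvPolynomial (Fin N) ℤ) : Altn N (c • f) = c • Altn N f := by
  unfold Altn
  rw [Finset.smul_sum]
  apply Finset.sum_congr rfl
  intro w _
  rw [map_zsmul, smul_comm]

lemma Altn_swap {N : ℕ} (f : MvPolynomial (Fin N) ℤ) (i j : Fin N) (hij : i ≠ j)
    (h : MvPolynomial.rename (Equiv.swap i j) f = f) : Altn N f = 0 := by
  have e : Altn N f = - Altn N f := by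
    unfold Altn
    rw [← Finset.sum_neg_distrib]
    refine Fintype.sum_equiv (Equiv.mulRight (Equiv.swap i j)) _ _ ?_
    intro w
    simp only [Equiv.coe_mulRight]
    rw [Equiv.Perm.sign_mul, Equiv.Perm.sign_swap hij]
    have : MvPolynomial.rename (w * Equiv.swap i j) f = MvPolynomial.rename w f := by
      conv_rhs => rw [← h]
      rw [MvPolynomial.rename_rename]; rfl
    rw [this]; simp
  exact self_eq_neg.1 e

lemma Altn_mono {N : ℕ} (g : Fin N → ℕ) :
    Altn N (∏ i, (MvPolynomial.X i : MvPolynomial (Fin N) ℤ) ^ g i) = altd N g := by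
  unfold Altn altd
  rw [← Matrix.det_transpose, Matrix.det_apply]
  apply Finset.sum_congr rfl
  intro w _
  simp only [map_prod, map_pow, MvPolynomial.rename_X, Matrix.transpose_apply, Matrix.of_apply]
  rfl

end Alternation

/-! ### Path expansion -/
section Paths

lemma prod_paths {St : Type} [Fintype St] [DecidableEq St] {R : Type*} [CommRing R] (N : ℕ)
    (M : Fin N → Matrix St St R) (s0 s1 : St) :
    (List.ofFn M).prod s0 s1 = ∑ p : Fin (N+1) → St,
      if p 0 = s0 ∧ p (Fin.last N) = s1 then ∏ t : Fin N, M t (p t.castSucc) (p t.succ) else 0 := by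
  induction N generalizing s0 with
  | zero =>
    rw [List.ofFn_zero, List.prod_nil, Matrix.one_apply]
    rw [← (Equiv.funUnique (Fin 1) St).symm.sum_comp]
    simp only [Equiv.funUnique_symm_apply, uniqueElim_const, Finset.univ_eq_empty,
      Finset.prod_empty]
    by_cases h : s0 = s1
    · subst h; simp
    · rw [if_neg h, Finset.sum_eq_zero]
      intro a _
      rw [if_neg]
      rintro ⟨rfl, h2⟩; exact h h2
  | succ N ih =>
    rw [List.ofFn_succ, List.prod_cons, Matrix.mul_apply]
    rw [← (Fin.consEquiv (fun _ : Fin (N+2) => St)).sum_comp, Fintype.sum_prod_type]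
    simp only [ih, Finset.mul_sum]
    symm
    rw [Finset.sum_eq_single s0]
    · rw [Finset.sum_comm]
      apply Finset.sum_congr rfl
      intro q _
      symm
      rw [Finset.sum_eq_single (q 0)]
      · have e0 : (Fin.consEquiv (fun _ : Fin (N+2) => St)) (s0, q) = Fin.cons s0 q := rfl
        rw [e0]
        have : (Fin.cons s0 q : Fin (N+2) → St) (Fin.last (N+1)) = q (Fin.last N) := by
          rw [← Fin.succ_last, Fin.cons_succ]
        rw [this, Fin.prod_univ_succ, mul_ite, mul_zero]
        rw [Fin.cons_zero]
        refine if_congr (by simp) ?_ rfl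
        simp
      · intro b _ hb
        rw [if_neg, mul_zero]
        rintro ⟨h, _⟩; exact hb h.symm
      · intro h; exact absurd (Finset.mem_univ _) h
    · intro b _ hb
      apply Finset.sum_eq_zero
      intro q _
      rw [if_neg]
      rintro ⟨h, _⟩
      exact hb h
    · intro h; exact absurd (Finset.mem_univ _) h

end Paths


/-! ### Abstract Littlewood-Richardson rule -/
section LR

variable {St : Type} [Fintype St] [DecidableEq St] (S : BSys St)

lemma Rch.split {l1 l2 : List ℕ} {C C' : Finset ℕ} (h : Rch (l1 ++ l2) C C') :
    ∃ C1, Rch l1 C C1 ∧ Rch l2 C1 C' := by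
  induction l1 generalizing C with
  | nil => exact ⟨C, rfl, h⟩
  | cons j l ih =>
    obtain ⟨D, hD, h⟩ := h
    obtain ⟨C1, h1, h2⟩ := ih h
    exact ⟨C1, ⟨D, hD, h1⟩, h2⟩

/-- one level -/
def BSys.H {R : Type*} [CommRing R] (x : R) : Matrix St St R := PL S.U (List.range S.L) x

lemma BSys.levelAny {R : Type*} [CommRing R] {x : R} {s s' : St} (h : S.H x s s' ≠ 0) (K : ℕ) :
    RR (K+1) (S.C s) (S.C s') ≤ RR K (S.C s) (S.C s') ∧
    RR K (S.C s) (S.C s') ≤ RR (K+1) (S.C s) (S.C s') + 1 := by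
  obtain ⟨z, hz, hK⟩ := exists_hole (S.C s) K
  rw [BSys.H, ← S.PL_range (show S.L ≤ z + 3 + S.L by omega)] at h
  have h1 := S.PL_supp h
  rw [List.range_add, List.range_succ, List.range_succ, List.range_succ] at h1
  have e : List.range z ++ [z] ++ [z+1] ++ [z+2] ++ (List.range S.L).map (fun x => z + 3 + x)
    = List.range z ++ (z :: (z+1) :: (z+2) :: (List.range S.L).map (fun x => z + 3 + x)) := by simp
  rw [e] at h1
  obtain ⟨C1, h2, h3⟩ := h1.split
  have h4 := h2.low z (fun j hj => List.mem_range.1 hj)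
  have hK1 : hb C1 z = K := (h4.2 z le_rfl).trans hK
  have hz1 : z ∉ C1 := fun h => hz ((h4.1 z le_rfl).1 h)
  have a1 := AA_class h4.1 hK hK1 le_rfl
  have a2 := AA_class h4.1 hK hK1 (show K ≤ K + 1 by omega)
  have m1 := h3.AA_mono K
  have m2 := h3.AA_mono (K+1)
  have m3 := h3.pp_mono
  unfold RR
  rw [← a1, ← a2]
  rcases levelB (by
    intro j hj
    rw [List.mem_map] at hj
    obtain ⟨i, -, rfl⟩ := hj
    omega) h3 hz1 hK1 with h | h | h <;> omega

lemma BSys.RR_zero {R : Type*} [CommRing R] {x : R} {s s' : St} (h : S.H x s s' ≠ 0) :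
    RR 0 (S.C s) (S.C s') = pp (S.C s') - pp (S.C s) := by
  have h1 := S.PL_supp h
  have := h1.AA_zero
  have := h1.pp_mono
  unfold RR
  omega

variable {N : ℕ}

/-- extension of a path -/
def pe (p : Fin (N+1) → St) (n : ℕ) : St := p ⟨min n N, by omega⟩

/-- truncated multiplicities of the levels of a path -/
def BSys.lv (p : Fin (N+1) → St) (K t : ℕ) : ℕ :=
  if t < N then RR K (S.C (pe p t)) (S.C (pe p (t+1))) else 0

/-- the Yamanouchi condition -/
def BSys.Yam (p : Fin (N+1) → St) : Prop := ∀ K t, S.lv p K (t+1) ≤ S.lv p K t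

/-- position of the canonical violation -/
structure BSys.Key (p : Fin (N+1) → St) (K m z : ℕ) : Prop where
  v : S.lv p K m < S.lv p K (m+1)
  mx : ∀ K', K < K' → ∀ m', S.lv p K' (m'+1) ≤ S.lv p K' m'
  mn : ∀ m', m' < m → S.lv p K (m'+1) ≤ S.lv p K m'
  hz : z ∉ S.C (pe p (m+1))
  hK : hb (S.C (pe p (m+1))) z = K

lemma pe_zero (p : Fin (N+1) → St) : pe p 0 = p 0 := by
  unfold pe; congr 1

lemma BSys.exists_key (p : Fin (N+1) → St) (h : ¬ S.Yam p) : ∃ K m z, S.Key p K m z := by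
  classical
  unfold BSys.Yam at h
  push Not at h
  obtain ⟨K0, m0, h0⟩ := h
  have hb' : ∀ K m, S.lv p K m < S.lv p K (m+1) → K ≤ S.L := by
    intro K m h
    by_contra hK
    have : S.lv p K (m+1) = 0 := by
      unfold BSys.lv RR
      split_ifs
      · rw [AA_big (S.bd _) (by omega), AA_big (S.bd _) (by omega)]
      · rfl
    omega
  let P : ℕ → Prop := fun K => ∃ m, S.lv p K m < S.lv p K (m+1)
  have hP : P (Nat.findGreatest P S.L) := Nat.findGreatest_spec (hb' K0 m0 h0) ⟨m0, h0⟩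
  set K := Nat.findGreatest P S.L with hKdef
  have h1 := Nat.find_spec hP
  have h2 := fun m => @Nat.find_min _ _ hP m
  set m := Nat.find hP
  obtain ⟨z, hz, hK⟩ := exists_hole (S.C (pe p (m+1))) K
  refine ⟨K, m, z, h1, ?_, ?_, hz, hK⟩
  · intro K' hK' m'
    by_contra hc
    push Not at hc
    exact Nat.findGreatest_is_greatest hK' (hb' K' m' hc) ⟨m', hc⟩
  · intro m' hm'
    exact not_lt.1 (h2 m' hm')

lemma BSys.Key.unique {p : Fin (N+1) → St} {K m z K' m' z' : ℕ} (h : S.Key p K m z)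
    (h' : S.Key p K' m' z') : K = K' ∧ m = m' ∧ z = z' := by
  have e1 : K = K' := by
    by_contra hne
    rcases Nat.lt_or_gt_of_ne hne with h1 | h1
    · exact absurd h'.v (not_lt.2 (h.mx _ h1 _))
    · exact absurd h.v (not_lt.2 (h'.mx _ h1 _))
  subst e1
  have e2 : m = m' := by
    by_contra hne
    rcases Nat.lt_or_gt_of_ne hne with h1 | h1
    · exact absurd h.v (not_lt.2 (h'.mn _ h1))
    · exact absurd h'.v (not_lt.2 (h.mn _ h1))
  subst e2
  exact ⟨rfl, rfl, hole_unique _ h.hz h'.hz (h.hK.trans h'.hK.symm)⟩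

lemma BSys.Key.lt {p : Fin (N+1) → St} {K m z : ℕ} (h : S.Key p K m z) : m + 1 < N := by
  by_contra hc
  have := h.v
  have : S.lv p K (m+1) = 0 := by rw [BSys.lv, if_neg hc]
  omega

/-- weight of a path -/
noncomputable def BSys.wt (p : Fin (N+1) → St) : MvPolynomial (Fin N) ℤ :=
  ∏ t : Fin N, S.H (MvPolynomial.X t : MvPolynomial (Fin N) ℤ) (p t.castSucc) (p t.succ)

/-- the staircase monomial -/
noncomputable def xdel (N : ℕ) : MvPolynomial (Fin N) ℤ :=
  ∏ t : Fin N, (MvPolynomial.X t : MvPolynomial (Fin N) ℤ) ^ (N - 1 - t : ℕ)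

lemma pe_update [DecidableEq (Fin (N+1))] (p : Fin (N+1) → St) (t : St) (m n : ℕ) (hm : m + 1 < N) :
    pe (Function.update p ⟨m+1, by omega⟩ t) n = if n = m + 1 then t else pe p n := by
  unfold pe
  split_ifs with h
  · subst h
    have : (⟨min (m+1) N, by omega⟩ : Fin (N+1)) = ⟨m+1, by omega⟩ := by ext; simp; omega
    rw [this, Function.update_self]
  · rw [Function.update_of_ne]
    intro h2
    rw [Fin.ext_iff] at h2
    simp only at h2
    omega

lemma pe_at (p : Fin (N+1) → St) (n : ℕ) (hn : n < N + 1) : pe p n = p ⟨n, hn⟩ := by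
  unfold pe; congr 1; ext; simp; omega

/-- lvl of updates -/
lemma BSys.Key.update {p : Fin (N+1) → St} {K m z : ℕ} (h : S.Key p K m z) {t : St}
    (ht : S.cls z K (pe p (m+1)) t) :
    S.Key (Function.update p ⟨m+1, by have := h.lt; omega⟩ t) K m z := by
  have hm := h.lt
  have hA : ∀ K', K ≤ K' → ∀ n,
      AA K' (S.C (pe (Function.update p ⟨m+1, by omega⟩ t) n)) = AA K' (S.C (pe p n)) := by
    intro K' hK' n
    rw [pe_update p t m n hm]
    split_ifs with hn
    · subst hn
      exact AA_class ht.1 h.hK ht.2 hK'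
    · rfl
  have hlv : ∀ K', K ≤ K' → ∀ n,
      S.lv (Function.update p ⟨m+1, by omega⟩ t) K' n = S.lv p K' n := by
    intro K' hK' n
    unfold BSys.lv RR
    rw [hA K' hK', hA K' hK']
  refine ⟨?_, ?_, ?_, ?_, ?_⟩
  · rw [hlv K le_rfl, hlv K le_rfl]; exact h.v
  · intro K' hK' m'
    rw [hlv K' hK'.le, hlv K' hK'.le]; exact h.mx K' hK' m'
  · intro m' hm'
    rw [hlv K le_rfl, hlv K le_rfl]; exact h.mn m' hm'
  · rw [pe_update p t m _ hm, if_pos rfl]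
    intro h1
    exact h.hz ((ht.1 z le_rfl).1 h1)
  · rw [pe_update p t m _ hm, if_pos rfl]
    exact ht.2

lemma BSys.H_map {R R' : Type*} [CommRing R] [CommRing R'] (x : R) (f : R →+* R') (s s' : St) :
    f (S.H x s s') = S.H (f x) s s' := by
  have := congrFun (congrFun (PL_map S.U (List.range S.L) x f) s) s'
  unfold BSys.H
  simpa using this

open Classical in
/-- a class of bad paths contributes nothing -/
lemma BSys.class_zero {p : Fin (N+1) → St} {K m z : ℕ} (h : S.Key p K m z) (hw : S.wt p ≠ 0) :
    Altn N (xdel N * ∑ t ∈ Finset.univ.filter (S.cls z K (pe p (m+1))),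
      S.wt (Function.update p ⟨m+1, by have := h.lt; omega⟩ t)) = 0 := by
  have hm := h.lt
  set a : Fin N := ⟨m, by omega⟩ with ha
  set b : Fin N := ⟨m+1, hm⟩ with hb
  have hab : a ≠ b := by rw [Ne, Fin.ext_iff]; simp [ha, hb]
  set c : Fin (N+1) := ⟨m+1, by omega⟩ with hc
  have split : ∀ f : Fin N → MvPolynomial (Fin N) ℤ, ∏ t, f t =
      f a * f b * ∏ t ∈ (Finset.univ.erase a).erase b, f t := by
    intro f
    rw [mul_assoc, Finset.mul_prod_erase _ _ (by simp [hab.symm]), Finset.mul_prod_erase _ _ (by simp)]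
  -- nonzero levels
  have hne : ∀ t : Fin N, S.H (MvPolynomial.X t : MvPolynomial (Fin N) ℤ) (p t.castSucc) (p t.succ) ≠ 0 := by
    intro t h0
    exact hw (Finset.prod_eq_zero (Finset.mem_univ t) h0)
  have pm : p a.castSucc = pe p m := by rw [pe_at p m (by omega)]; rfl
  have pm1 : p c = pe p (m+1) := by rw [pe_at p (m+1) (by omega)]
  have pm1' : p a.succ = pe p (m+1) := by rw [pe_at p (m+1) (by omega)]; rfl
  have pm1'' : p b.castSucc = pe p (m+1) := by rw [pe_at p (m+1) (by omega)]; rfl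
  have pm2 : p b.succ = pe p (m+2) := by rw [pe_at p (m+2) (by omega)]; rfl
  have n1 := hne a
  have n2 := hne b
  rw [pm, pm1'] at n1
  rw [pm1'', pm2] at n2
  have v1 := S.levelAny n1 K
  have v2 := S.levelAny n2 K
  have v3 := h.v
  have v4 := h.mx (K+1) (by omega) m
  simp only [BSys.lv] at v3 v4
  rw [if_pos (by omega), if_pos (by omega)] at v3 v4
  change RR K (S.C (pe p m)) (S.C (pe p (m+1))) < RR K (S.C (pe p (m+1))) (S.C (pe p (m+2))) at v3
  change RR (K+1) (S.C (pe p (m+1))) (S.C (pe p (m+2))) ≤ RR (K+1) (S.C (pe p m)) (S.C (pe p (m+1))) at v4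
  set rho := RR K (S.C (pe p m)) (S.C (pe p (m+1))) with hrho
  have star := fun x y : MvPolynomial (Fin N) ℤ => S.star x y z K rho (pe p m) (pe p (m+1)) (pe p (m+2)) h.hz h.hK
    hrho.symm (by omega) (by omega) (by omega)
  -- the weight
  set rest : MvPolynomial (Fin N) ℤ := ∏ t ∈ (Finset.univ.erase a).erase b,
    S.H (MvPolynomial.X t : MvPolynomial (Fin N) ℤ) (p t.castSucc) (p t.succ) with hrest
  have hwt : ∀ t, S.wt (Function.update p c t) =
      S.H (MvPolynomial.X a) (pe p m) t * S.H (MvPolynomial.X b) t (pe p (m+2)) * rest := by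
    intro t
    rw [BSys.wt, split]
    have u1 : Function.update p c t a.castSucc = pe p m := by
      rw [Function.update_of_ne, pm]
      rw [Ne, Fin.ext_iff]; simp [ha, hc]
    have u2 : Function.update p c t a.succ = t := by
      have : a.succ = c := by rw [Fin.ext_iff]; simp [ha, hc]
      rw [this, Function.update_self]
    have u3 : Function.update p c t b.castSucc = t := by
      have : b.castSucc = c := by rw [Fin.ext_iff]; simp [hb, hc]
      rw [this, Function.update_self]
    have u4 : Function.update p c t b.succ = pe p (m+2) := by
      rw [Function.update_of_ne, pm2]
      rw [Ne, Fin.ext_iff]; simp [hb, hc]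
    rw [u1, u2, u3, u4, hrest]
    congr 1
    apply Finset.prod_congr rfl
    intro i hi
    simp only [Finset.mem_erase, Ne, Fin.ext_iff, ha, hb] at hi
    rw [Function.update_of_ne, Function.update_of_ne]
    · rw [Ne, Fin.ext_iff]; simp [hc]; omega
    · rw [Ne, Fin.ext_iff]; simp [hc]; omega
  set CS := fun x y : MvPolynomial (Fin N) ℤ => ∑ t, (if S.cls z K (pe p (m+1)) t then
        S.H x (pe p m) t * S.H y t (pe p (m+2)) else 0) with hCS
  have star' : ∀ x y, x * CS x y = y * CS y x := star
  have hsum : ∑ t ∈ Finset.univ.filter (S.cls z K (pe p (m+1))), S.wt (Function.update p c t)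
      = CS (MvPolynomial.X a) (MvPolynomial.X b) * rest := by
    rw [hCS, Finset.sum_filter, Finset.sum_mul]
    apply Finset.sum_congr rfl
    intro t _
    rw [hwt t, ite_mul, zero_mul]
  rw [hsum]
  apply Altn_swap _ a b hab
  -- the invariance
  set xr : MvPolynomial (Fin N) ℤ := ∏ t ∈ (Finset.univ.erase a).erase b,
    (MvPolynomial.X t : MvPolynomial (Fin N) ℤ) ^ (N - 1 - t : ℕ) with hxr
  have hx : xdel N = MvPolynomial.X a * ((MvPolynomial.X a * MvPolynomial.X b) ^ (N - 1 - (m+1)) * xr) := by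
    rw [xdel, split, ← hxr]
    have : N - 1 - (a : ℕ) = (N - 1 - (m+1)) + 1 := by simp only [ha]; omega
    rw [this]
    have : N - 1 - (b : ℕ) = (N - 1 - (m+1)) := by simp only [hb]
    rw [this]
    ring
  have fix : ∀ t ∈ (Finset.univ.erase a).erase b, Equiv.swap a b t = t := by
    intro t ht
    simp only [Finset.mem_erase] at ht
    exact Equiv.swap_apply_of_ne_of_ne ht.2.1 ht.1
  have rx : MvPolynomial.rename (Equiv.swap a b) xr = xr := by
    rw [hxr, map_prod]
    apply Finset.prod_congr rfl
    intro t ht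
    rw [map_pow, MvPolynomial.rename_X, fix t ht]
  have rr : MvPolynomial.rename (Equiv.swap a b) rest = rest := by
    rw [hrest, map_prod]
    apply Finset.prod_congr rfl
    intro t ht
    have := S.H_map (MvPolynomial.X t : MvPolynomial (Fin N) ℤ)
      (MvPolynomial.rename (Equiv.swap a b)).toRingHom (p t.castSucc) (p t.succ)
    simp only [AlgHom.toRingHom_eq_coe, RingHom.coe_coe] at this
    rw [this, MvPolynomial.rename_X, fix t ht]
  have rc : MvPolynomial.rename (Equiv.swap a b) (CS (MvPolynomial.X a) (MvPolynomial.X b)) =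
      CS (MvPolynomial.X b) (MvPolynomial.X a) := by
    rw [hCS, map_sum]
    apply Finset.sum_congr rfl
    intro t _
    have := fun (x : MvPolynomial (Fin N) ℤ) (s s' : St) => S.H_map x
      (MvPolynomial.rename (Equiv.swap a b)).toRingHom s s'
    simp only [AlgHom.toRingHom_eq_coe, RingHom.coe_coe] at this
    split_ifs
    · rw [map_mul, this, this, MvPolynomial.rename_X, MvPolynomial.rename_X, Equiv.swap_apply_left,
        Equiv.swap_apply_right]
    · rw [map_zero]
  rw [hx]
  have e : ∀ x y : MvPolynomial (Fin N) ℤ, x * ((x * y) ^ (N - 1 - (m+1)) * xr) * (CS x y * rest)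
    = (x * CS x y) * ((x * y) ^ (N - 1 - (m+1)) * xr * rest) := by intros; ring
  rw [e, star', ]
  simp only [map_mul, map_pow, rx, rr, MvPolynomial.rename_X, Equiv.swap_apply_left,
    Equiv.swap_apply_right]
  have rc' : MvPolynomial.rename (Equiv.swap a b) (CS (MvPolynomial.X b) (MvPolynomial.X a)) =
      CS (MvPolynomial.X a) (MvPolynomial.X b) := by
    rw [← rc, MvPolynomial.rename_rename]
    have : (⇑(Equiv.swap a b) ∘ ⇑(Equiv.swap a b)) = id := by ext i; simp
    rw [this, MvPolynomial.rename_id]; rfl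
  rw [rc', star', mul_comm (MvPolynomial.X b : MvPolynomial (Fin N) ℤ) (MvPolynomial.X a)]

lemma BSys.F_symm (s0 s1 : St) (w : Equiv.Perm (Fin N)) :
    MvPolynomial.rename w ((List.ofFn fun t : Fin N =>
      S.H (MvPolynomial.X t : MvPolynomial (Fin N) ℤ)).prod s0 s1) =
    (List.ofFn fun t : Fin N => S.H (MvPolynomial.X t : MvPolynomial (Fin N) ℤ)).prod s0 s1 := by
  set f := (MvPolynomial.rename w : MvPolynomial (Fin N) ℤ →ₐ[ℤ] MvPolynomial (Fin N) ℤ).toRingHom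
    with hf
  have e1 : f ((List.ofFn fun t : Fin N =>
      S.H (MvPolynomial.X t : MvPolynomial (Fin N) ℤ)).prod s0 s1) =
      (List.ofFn fun t : Fin N => S.H (MvPolynomial.X (w t) : MvPolynomial (Fin N) ℤ)).prod s0 s1 := by
    have h : f.mapMatrix (List.ofFn fun t : Fin N =>
        S.H (MvPolynomial.X t : MvPolynomial (Fin N) ℤ)).prod =
        (List.ofFn fun t : Fin N => S.H (MvPolynomial.X (w t) : MvPolynomial (Fin N) ℤ)).prod := by
      rw [map_list_prod, List.map_ofFn]
      congr 2
      ext1 t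
      simp only [Function.comp, BSys.H]
      rw [PL_map]
      simp [hf]
    rw [← h]; rfl
  change f _ = _
  rw [e1]
  have hp := Equiv.Perm.ofFn_comp_perm w
    (fun t : Fin N => S.H (MvPolynomial.X t : MvPolynomial (Fin N) ℤ))
  have heq : (List.ofFn ((fun t : Fin N => S.H (MvPolynomial.X t : MvPolynomial (Fin N) ℤ)) ∘ w)).prod
      = (List.ofFn fun t : Fin N => S.H (MvPolynomial.X t : MvPolynomial (Fin N) ℤ)).prod := by
    refine List.Perm.prod_eq' hp ?_
    rw [List.pairwise_ofFn]
    intro i j _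
    exact S.P3 N S.L _ _
  exact congrFun (congrFun heq s0) s1

lemma BSys.yam_wt (p : Fin (N+1) → St) (hw : S.wt p ≠ 0) :
    ∃ c : ℕ, S.wt p = (c : ℤ) • ∏ t : Fin N, (MvPolynomial.X t : MvPolynomial (Fin N) ℤ) ^ S.lv p 0 t := by
  have hne : ∀ t : Fin N, S.H (MvPolynomial.X t : MvPolynomial (Fin N) ℤ) (p t.castSucc) (p t.succ) ≠ 0 := by
    intro t h0
    exact hw (Finset.prod_eq_zero (Finset.mem_univ t) h0)
  have h1 : ∀ t : Fin N, S.H (MvPolynomial.X t : MvPolynomial (Fin N) ℤ) (p t.castSucc) (p t.succ)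
      = MvPolynomial.C (S.H (1:ℤ) (p t.castSucc) (p t.succ)) *
        (MvPolynomial.X t : MvPolynomial (Fin N) ℤ) ^ S.lv p 0 t := by
    intro t
    have e1 : p t.castSucc = pe p t := by rw [pe_at p t (by omega)]; rfl
    have e2 : p t.succ = pe p (t+1) := by rw [pe_at p (t+1) (by omega)]; rfl
    have e3 : S.lv p 0 t = pp (S.C (p t.succ)) - pp (S.C (p t.castSucc)) := by
      rw [BSys.lv, if_pos t.2, ← e1, ← e2, S.RR_zero (hne t)]
    rw [e3]
    have := S.H_map (1 : ℤ) (MvPolynomial.C : ℤ →+* MvPolynomial (Fin N) ℤ) (p t.castSucc) (p t.succ)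
    rw [this, map_one, mul_comm]
    exact S.PL_homog _ _ _ _
  refine ⟨(∏ t : Fin N, S.H (1:ℤ) (p t.castSucc) (p t.succ)).toNat, ?_⟩
  have hnn : 0 ≤ ∏ t : Fin N, S.H (1:ℤ) (p t.castSucc) (p t.succ) :=
    Finset.prod_nonneg fun t _ => S.PL_nonneg _ _ _
  rw [Int.toNat_of_nonneg hnn]
  rw [BSys.wt, Finset.prod_congr rfl (fun t _ => h1 t), Finset.prod_mul_distrib, ← map_prod,
    ← MvPolynomial.smul_eq_C_mul]

open Classical in
/-- The abstract Littlewood-Richardson rule -/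
theorem BSys.schur (N : ℕ) (s0 s1 : St) :
    IsSchurNonneg N ((List.ofFn fun t : Fin N =>
      S.H (MvPolynomial.X t : MvPolynomial (Fin N) ℤ)).prod s0 s1) := by
  set F := (List.ofFn fun t : Fin N =>
      S.H (MvPolynomial.X t : MvPolynomial (Fin N) ℤ)).prod s0 s1 with hF
  set T : Finset (Fin (N+1) → St) :=
    Finset.univ.filter (fun p => p 0 = s0 ∧ p (Fin.last N) = s1) with hT
  have hsum : F = ∑ p ∈ T, S.wt p := by
    rw [hF, prod_paths, hT, Finset.sum_filter]; rfl
  set Y := T.filter (fun p => S.Yam p) with hY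
  set Bd := T.filter (fun p => ¬ S.Yam p) with hBd
  have hsplit : F = ∑ p ∈ Y, S.wt p + ∑ p ∈ Bd, S.wt p := by
    rw [hsum, ← Finset.sum_filter_add_sum_filter_not T (fun p => S.Yam p)]
  -- the bad part
  have hbad : Altn N (xdel N * ∑ p ∈ Bd, S.wt p) = 0 := by
    have hk : ∀ p : Fin (N+1) → St, ∃ k : ℕ × ℕ × ℕ, ¬ S.Yam p → S.Key p k.1 k.2.1 k.2.2 := by
      intro p
      by_cases h : S.Yam p
      · exact ⟨(0, 0, 0), fun h' => absurd h h'⟩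
      · obtain ⟨K, m, z, h1⟩ := S.exists_key p h
        exact ⟨(K, m, z), fun _ => h1⟩
    choose k hk using hk
    set g : (Fin (N+1) → St) → (ℕ × ℕ × ℕ) × (ℕ → St) × Finset ℕ := fun p =>
      (k p, fun n => if n = (k p).2.1 + 1 then s0 else pe p n,
        (S.C (pe p ((k p).2.1 + 1))).filter ((k p).2.2 ≤ ·)) with hg
    rw [← Finset.sum_fiberwise_of_maps_to (t := Bd.image g)
      (fun p hp => Finset.mem_image_of_mem g hp), Finset.mul_sum, Altn_sum]
    apply Finset.sum_eq_zero
    intro key _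
    by_cases hz : ∀ p ∈ Bd.filter (fun p => g p = key), S.wt p = 0
    · rw [Finset.sum_eq_zero hz, mul_zero]
      simp [Altn]
    push Not at hz
    obtain ⟨p, hp, hw⟩ := hz
    rw [Finset.mem_filter] at hp
    obtain ⟨hpB, rfl⟩ := hp
    rw [hBd, Finset.mem_filter, hT, Finset.mem_filter] at hpB
    obtain ⟨⟨-, hp0, hpN⟩, hpY⟩ := hpB
    have hkp := hk p hpY
    set K := (k p).1 with hK
    set m := (k p).2.1 with hm
    set z := (k p).2.2 with hz
    have hmN := hkp.lt
    have := S.class_zero hkp hw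
    rw [← this]
    congr 2
    symm
    refine Finset.sum_bij (fun t _ => Function.update p ⟨m+1, by omega⟩ t) ?_ ?_ ?_ ?_
    · intro t ht
      rw [Finset.mem_filter] at ht
      have ht := ht.2
      have hk2 := hkp.update S ht
      have hnY : ¬ S.Yam (Function.update p ⟨m+1, by omega⟩ t) := by
        intro hY'
        exact absurd hk2.v (not_lt.2 (hY' _ _))
      have hk3 := hk _ hnY
      obtain ⟨u1, u2, u3⟩ := hk3.unique S hk2
      have hke : k (Function.update p ⟨m+1, by omega⟩ t) = k p := by
        ext
        · exact u1
        · exact u2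
        · exact u3
      rw [Finset.mem_filter, hBd, Finset.mem_filter, hT, Finset.mem_filter]
      refine ⟨⟨⟨Finset.mem_univ _, ?_, ?_⟩, hnY⟩, ?_⟩
      · rw [Function.update_of_ne, hp0]
        rw [Ne, Fin.ext_iff]; simp
      · rw [Function.update_of_ne, hpN]
        rw [Ne, Fin.ext_iff]; simp; omega
      · simp only [hg]
        rw [hke]
        refine Prod.ext rfl (Prod.ext ?_ ?_)
        · funext n
          simp only
          rw [← hm, pe_update p t m n hmN]
          split_ifs <;> rfl
        · simp only
          rw [← hm, ← hz, pe_update p t m _ hmN, if_pos rfl]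
          ext u
          simp only [Finset.mem_filter]
          constructor
          · rintro ⟨q1, q2⟩; exact ⟨(ht.1 u q2).1 q1, q2⟩
          · rintro ⟨q1, q2⟩; exact ⟨(ht.1 u q2).2 q1, q2⟩
    · intro t _ t' _ h
      have := congrFun h ⟨m+1, by omega⟩
      simpa using this
    · intro q hq
      rw [Finset.mem_filter] at hq
      obtain ⟨hqB, hqg⟩ := hq
      rw [hBd, Finset.mem_filter] at hqB
      have hkq := hk q hqB.2
      have g1 : k q = k p := congrArg Prod.fst hqg
      have g2 := congrArg (fun x => x.2.1) hqg
      have g3 := congrArg (fun x => x.2.2) hqg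
      simp only [hg] at g2 g3
      rw [g1] at g2 g3 hkq
      rw [← hm] at g2
      rw [← hm, ← hz] at g3
      rw [← hm, ← hz, ← hK] at hkq
      refine ⟨pe q (m+1), ?_, ?_⟩
      · rw [Finset.mem_filter]
        refine ⟨Finset.mem_univ _, ?_, hkq.hK⟩
        intro u hu
        have := Finset.ext_iff.1 g3 u
        simp only [Finset.mem_filter, hu, and_true] at this
        exact this
      · funext i
        have h2 := congrFun g2 i
        have e1 : pe p i = p i := pe_at p i i.2
        have e2 : pe q i = q i := pe_at q i i.2
        by_cases hi : (i : ℕ) = m + 1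
        · have : i = ⟨m+1, by omega⟩ := Fin.ext hi
          rw [this, Function.update_self, pe_at q (m+1) (by omega)]
        · rw [if_neg hi, if_neg hi, e1, e2] at h2
          rw [Function.update_of_ne, h2]
          intro h; apply hi; rw [h]
    · intro t _; rfl
  -- the good part
  have hyam : ∀ p : Fin (N+1) → St, ∃ c : ℕ, p ∈ Y → Altn N (xdel N * S.wt p) =
      ((c : ℤ) • skewSchur N N (S.lv p 0) (fun _ => 0)) * altd N (fun i => N - 1 - i) := by
    intro p
    by_cases hw : S.wt p = 0
    · refine ⟨0, fun _ => ?_⟩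
      rw [hw]; simp [Altn]
    obtain ⟨c, hc⟩ := S.yam_wt p hw
    refine ⟨c, fun hp => ?_⟩
    rw [hc, mul_smul_comm, Altn_smul, smul_mul_assoc, ← bialternant, xdel,
      ← Finset.prod_mul_distrib]
    congr 1
    rw [← Altn_mono]
    congr 1
    apply Finset.prod_congr rfl
    intro t _
    rw [← pow_add, add_comm]
  choose c hc using hyam
  have hFF : Altn N (xdel N) * F = Altn N (xdel N * F) := (Altn_symm _ _ (S.F_symm s0 s1)).symm
  have hdel : Altn N (xdel N) = altd N (fun i => N - 1 - i) := Altn_mono _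
  clear_value F
  have hR : Altn N (xdel N * F) = (∑ p ∈ Y, (c p : ℤ) • skewSchur N N (S.lv p 0) (fun _ => 0))
      * altd N (fun i => N - 1 - i) := by
    rw [hsplit, mul_add, Altn_add, hbad, add_zero, Finset.mul_sum, Altn_sum,
      Finset.sum_congr rfl (fun p hp => hc p hp), ← Finset.sum_mul]
  rw [hR, hdel, mul_comm] at hFF
  have := mul_right_cancel₀ (altd_ne_zero N) hFF
  rw [this]
  apply sn_sum
  intro p hp
  apply sn_single
  · apply antitone_nat_of_succ_le
    intro t
    rw [hY, Finset.mem_filter] at hp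
    exact hp.2 0 t
  · intro j hj
    rw [BSys.lv, if_neg (by omega)]

end LR


/-! ### From local relations to commuting levels -/
section WComm

variable {R A : Type*} [CommRing R] [Algebra ℚ R] [Ring A] [Algebra R A]

lemma tE_two {u v : A} (α β : R) (hu : u * u = 0) (hv : v * v = 0) (huv : Commute u v) (x : R) :
    tE (α • u + β • v) x = (1 + (x * α) • u) * (1 + (x * β) • v) := by
  have hc : v * u = u * v := huv.eq.symm
  have e : (α • u + β • v) * (α • u + β • v) = (2 * (α * β)) • (u * v) := by
    simp only [mul_add, add_mul, smul_mul_assoc, mul_smul_comm, hu, hv, hc, smul_zero, zero_add,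
      add_zero, smul_smul]
    rw [← add_smul]; congr 1; ring
  have e2 : x ^ 2 * algebraMap ℚ R (1/2) * (2 * (α * β)) = x * α * (x * β) := by
    have := half_mul_two (R := R)
    linear_combination (x^2 * α * β) * this
  rw [tE, e, smul_smul, e2]
  simp only [mul_add, add_mul, smul_mul_assoc, mul_smul_comm, one_mul, mul_one, smul_add, smul_smul]
  rw [mul_comm (x * β) (x * α)]
  abel

lemma serre_two {u v h : A} (α β : R) (hu : u * u = 0) (hv : v * v = 0) (huv : Commute u v)
    (nu : u * h * u = 0) (nv : v * h * v = 0)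
    (s : u * v * h + h * (u * v) = u * h * v + v * h * u) :
    (α • u + β • v) * (α • u + β • v) * h + h * (α • u + β • v) * (α • u + β • v)
      = (2 : R) • ((α • u + β • v) * h * (α • u + β • v)) := by
  have hc : v * u = u * v := huv.eq.symm
  have e : (α • u + β • v) * (α • u + β • v) = (2 * (α * β)) • (u * v) := by
    simp only [mul_add, add_mul, smul_mul_assoc, mul_smul_comm, hu, hv, hc, smul_zero, zero_add,
      add_zero, smul_smul]
    rw [← add_smul]; congr 1; ring
  have e3 : (α • u + β • v) * h * (α • u + β • v) = (α * β) • (u * h * v + v * h * u) := by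
    simp only [mul_add, add_mul, smul_mul_assoc, mul_smul_comm, nu, nv, smul_zero, zero_add,
      add_zero, smul_smul, smul_add]
    rw [add_comm, mul_comm β α]
  rw [mul_assoc h, e, e3, ← s, smul_mul_assoc, mul_smul_comm, ← smul_add, smul_smul]

lemma wcomm (V : ℕ → A) (χ : ℕ → R)
    (sq : ∀ j, V j * V j = 0)
    (same : ∀ q, Commute (V (2*q)) (V (2*q+1)))
    (far : ∀ i j, i / 2 + 2 ≤ j / 2 → Commute (V i) (V j))
    (nb : ∀ i h, (i / 2 = h / 2 + 1 ∨ h / 2 = i / 2 + 1) → V i * V h * V i = 0)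
    (ser : ∀ q h, (q = h / 2 + 1 ∨ h / 2 = q + 1) →
      V (2*q) * V (2*q+1) * V h + V h * (V (2*q) * V (2*q+1))
        = V (2*q) * V h * V (2*q+1) + V (2*q+1) * V h * V (2*q)) (n : ℕ) (x y : R) :
    Commute
      ((List.range n).map fun c => (1 + (x * χ (2*c)) • V (2*c)) * (1 + (x * χ (2*c+1)) • V (2*c+1))).prod
      ((List.range n).map fun c => (1 + (y * χ (2*c)) • V (2*c)) * (1 + (y * χ (2*c+1)) • V (2*c+1))).prod := by
  set g : ℕ → A := fun c => χ (2*c) • V (2*c) + χ (2*c+1) • V (2*c+1) with hg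
  have hE : ∀ z : R, ((List.range n).map fun c => (1 + (z * χ (2*c)) • V (2*c)) *
      (1 + (z * χ (2*c+1)) • V (2*c+1))).prod = LP g n z := by
    intro z
    rw [LP]
    congr 2
    funext c
    exact (tE_two _ _ (sq _) (sq _) (same c) z).symm
  rw [hE, hE]
  have main : ∀ c d, (c = d + 1 ∨ d = c + 1) →
      g c * g c * g d + g d * g c * g c = (2 : R) • (g c * g d * g c) := by
    intro c d hcd
    have key : ∀ h, (c = h / 2 + 1 ∨ h / 2 = c + 1) →
        g c * g c * V h + V h * g c * g c = (2 : R) • (g c * V h * g c) := by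
      intro h hh
      exact serre_two _ _ (sq _) (sq _) (same c) (nb _ _ (by omega)) (nb _ _ (by omega)) (ser c h hh)
    have k1 := key (2*d) (by omega)
    have k2 := key (2*d+1) (by omega)
    have : g d = χ (2*d) • V (2*d) + χ (2*d+1) • V (2*d+1) := rfl
    rw [this]
    generalize g c = G at *
    calc _ = χ (2*d) • (G * G * V (2*d) + V (2*d) * G * G) +
        χ (2*d+1) • (G * G * V (2*d+1) + V (2*d+1) * G * G) := by
          simp only [mul_add, add_mul, smul_mul_assoc, mul_smul_comm, smul_add]; abel
      _ = _ := by
          rw [k1, k2]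
          simp only [mul_add, add_mul, smul_mul_assoc, mul_smul_comm, smul_add]
          rw [smul_comm, smul_comm (χ (2*d+1))]
  refine LP_comm g n ?_ ?_ (fun c => main c (c+1) (Or.inr rfl)) (fun c => main (c+1) c (Or.inl rfl)) x y
  · intro c
    have hc : V (2*c+1) * V (2*c) = V (2*c) * V (2*c+1) := (same c).eq.symm
    have a1 : V (2*c) * V (2*c+1) * V (2*c) = 0 := by rw [mul_assoc, hc, ← mul_assoc, sq, zero_mul]
    have a2 : V (2*c) * V (2*c+1) * V (2*c+1) = 0 := by rw [mul_assoc, sq, mul_zero]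
    simp only [hg, mul_add, add_mul, smul_mul_assoc, mul_smul_comm, sq, hc, a1, a2, smul_zero,
      zero_mul, add_zero]
  · intro c d hcd
    have f : ∀ i j, i / 2 = c → j / 2 = d → ∀ a b : R, Commute (a • V i) (b • V j) := by
      intro i j hi hj a b
      exact ((far i j (by omega)).smul_left a).smul_right b
    exact Commute.add_left
      (Commute.add_right (f _ _ (by omega) (by omega) _ _) (f _ _ (by omega) (by omega) _ _))
      (Commute.add_right (f _ _ (by omega) (by omega) _ _) (f _ _ (by omega) (by omega) _ _))

end WComm

section WComm2
variable {St : Type} [Fintype St] [DecidableEq St]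

/-- The weighted product equals a `PL`. -/
lemma PLw_eq {R : Type*} [CommRing R] (U : ℕ → Matrix St St ℤ) (p : ℕ → Prop) [DecidablePred p] (n : ℕ) (x : R) :
    ((List.range n).map fun c => (1 + (x * (if p (2*c) then 1 else 0)) • (U (2*c)).map (Int.cast : ℤ → R)) *
      (1 + (x * (if p (2*c+1) then 1 else 0)) • (U (2*c+1)).map (Int.cast : ℤ → R))).prod
    = PL U ((List.range (2*n)).filter p) x := by
  induction n with
  | zero => simp [PL]
  | succ n ih =>
    rw [List.range_succ, List.map_append, List.prod_append, ih, show 2*(n+1) = 2*n+1+1 by ring,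
      List.range_succ, List.range_succ, List.filter_append, List.filter_append, PL_append, PL_append,
      mul_assoc]
    congr 1
    simp only [List.map_cons, List.map_nil, List.prod_cons, List.prod_nil, mul_one, List.filter_singleton]
    by_cases h1 : p (2*n) <;> by_cases h2 : p (2*n+1) <;> simp [h1, h2, PL, FF]

lemma PL_filter_comm (U : ℕ → Matrix St St ℤ)
    (sq : ∀ j, U j * U j = 0)
    (same : ∀ q, Commute (U (2*q)) (U (2*q+1)))
    (far : ∀ i j, i / 2 + 2 ≤ j / 2 → Commute (U i) (U j))
    (nb : ∀ i h, (i / 2 = h / 2 + 1 ∨ h / 2 = i / 2 + 1) → U i * U h * U i = 0)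
    (ser : ∀ q h, (q = h / 2 + 1 ∨ h / 2 = q + 1) →
      U (2*q) * U (2*q+1) * U h + U h * (U (2*q) * U (2*q+1))
        = U (2*q) * U h * U (2*q+1) + U (2*q+1) * U h * U (2*q))
    (p : ℕ → Prop) [DecidablePred p] (n N : ℕ) (x y : MvPolynomial (Fin N) ℤ) :
    Commute (PL U ((List.range (2*n)).filter p) x) (PL U ((List.range (2*n)).filter p) y) := by
  set f := MvPolynomial.map (σ := Fin N) (Int.castRingHom ℚ) with hf
  have hinj : Function.Injective (f.mapMatrix (m := St)) := by
    intro M M' h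
    ext1 s s'
    have := congrFun (congrFun h s) s'
    exact MvPolynomial.map_injective _ (RingHom.injective_int _) this
  set ι : Matrix St St ℤ →+* Matrix St St (MvPolynomial (Fin N) ℚ) :=
    (Int.castRingHom (MvPolynomial (Fin N) ℚ)).mapMatrix with hι
  have hV : ∀ j, ι (U j) = (U j).map (Int.cast : ℤ → MvPolynomial (Fin N) ℚ) := fun j => rfl
  have := wcomm (R := MvPolynomial (Fin N) ℚ) (fun j => ι (U j)) (fun j => if p j then 1 else 0)
    (by intro j; rw [← map_mul, sq, map_zero])
    (by intro q; exact (same q).map ι)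
    (by intro i j h; exact (far i j h).map ι)
    (by intro i h hh; simp only [← map_mul]; rw [nb i h hh, map_zero])
    (by intro q h hh; simp only [← map_mul, ← map_add]; rw [ser q h hh])
    n (f x) (f y)
  simp only [hV] at this
  rw [PLw_eq, PLw_eq, ← PL_map, ← PL_map] at this
  have h2 := this.eq
  rw [← map_mul, ← map_mul] at h2
  exact hinj h2

lemma PL_P3 (U : ℕ → Matrix St St ℤ) {N : ℕ}
    (H : ∀ (p : ℕ → Prop) [DecidablePred p] (n : ℕ) (x y : MvPolynomial (Fin N) ℤ),
    Commute (PL U ((List.range (2*n)).filter p) x) (PL U ((List.range (2*n)).filter p) y))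
    (n : ℕ) (x y : MvPolynomial (Fin N) ℤ) :
    Commute (PL U (List.range n) x) (PL U (List.range n) y) := by
  have e : (List.range (2*n)).filter (fun j => j < n) = List.range n := by
    rw [two_mul, List.range_add, List.filter_append]
    rw [List.filter_eq_self.2, List.filter_eq_nil_iff.2, List.append_nil]
    · simp
    · simp
  have := H (fun j => j < n) n x y
  rw [e] at this
  exact this

lemma PL_P4 (U : ℕ → Matrix St St ℤ) {N : ℕ}
    (H : ∀ (p : ℕ → Prop) [DecidablePred p] (n : ℕ) (x y : MvPolynomial (Fin N) ℤ),
    Commute (PL U ((List.range (2*n)).filter p) x) (PL U ((List.range (2*n)).filter p) y))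
    (n : ℕ) (x y : MvPolynomial (Fin N) ℤ) :
    Commute (PL U (List.range n ++ [n+1]) x) (PL U (List.range n ++ [n+1]) y) := by
  have e : (List.range (2*(n+1))).filter (fun j => j < n ∨ j = n + 1) = List.range n ++ [n+1] := by
    rw [show 2*(n+1) = n + 1 + 1 + n by ring, List.range_add, List.range_succ, List.range_succ,
      List.filter_append, List.filter_append, List.filter_append]
    have a1 : (List.range n).filter (fun j => j < n ∨ j = n + 1) = List.range n := by
      rw [List.filter_eq_self]; simp +contextual
    have a2 : ((List.range n).map (fun x => n + 1 + 1 + x)).filter (fun j => j < n ∨ j = n + 1) = [] := by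
      rw [List.filter_eq_nil_iff]; simp; omega
    rw [a1, a2]
    simp
  have := H (fun j => j < n ∨ j = n + 1) (n+1) x y
  rw [e] at this
  exact this

end WComm2


/-! ### Coloured beads and sets of colourings -/
section Colour
set_option linter.unusedSimpArgs false

/-- guard of a move into slot `j` -/
def grd (j : ℕ) (C : Finset ℕ) : Prop := 2 ≤ j ∧ j - 2 ∈ C ∧ j ∉ C

instance (j : ℕ) (C : Finset ℕ) : Decidable (grd j C) := by unfold grd; infer_instance

/-- move into slot `j` -/
def mv (j : ℕ) (C : Finset ℕ) : Finset ℕ := symmDiff C {j - 2, j}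

lemma mem_mv {x j : ℕ} {C : Finset ℕ} : x ∈ mv j C ↔ (x ∈ C ↔ ¬ (x = j - 2 ∨ x = j)) := by
  rw [mv, Finset.mem_symmDiff]
  simp only [Finset.mem_insert, Finset.mem_singleton]
  tauto

lemma mv_comm (i j : ℕ) (C : Finset ℕ) : mv i (mv j C) = mv j (mv i C) := by
  simp only [mv]; rw [symmDiff_right_comm]

lemma grd.Mv {j : ℕ} {C : Finset ℕ} (h : grd j C) : Mv j C (mv j C) := by
  obtain ⟨h1, h2, h3⟩ := h
  refine ⟨h1, h2, h3, ?_⟩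
  ext x
  rw [mem_mv]
  simp only [Finset.mem_insert, Finset.mem_erase]
  by_cases e1 : x = j - 2 <;> by_cases e2 : x = j <;> simp [e1, e2] <;> grind

/-- one coloured step at site `q` -/
def stp (q : ℕ) (E D : Finset ℕ) : Prop :=
  (grd (2*q) E ∧ D = mv (2*q) E) ∨ (grd (2*q+1) E ∧ D = mv (2*q+1) E)

/-- all results of one step at site `q` -/
def act (q : ℕ) (X : Finset (Finset ℕ)) : Finset (Finset ℕ) :=
  (X.filter (grd (2*q))).image (mv (2*q)) ∪ (X.filter (grd (2*q+1))).image (mv (2*q+1))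

lemma mem_act {q : ℕ} {X : Finset (Finset ℕ)} {D : Finset ℕ} :
    D ∈ act q X ↔ ∃ E ∈ X, stp q E D := by
  simp only [act, Finset.mem_union, Finset.mem_image, Finset.mem_filter, stp]
  constructor
  · rintro (⟨E, ⟨h1, h2⟩, rfl⟩ | ⟨E, ⟨h1, h2⟩, rfl⟩)
    · exact ⟨E, h1, Or.inl ⟨h2, rfl⟩⟩
    · exact ⟨E, h1, Or.inr ⟨h2, rfl⟩⟩
  · rintro ⟨E, h1, ⟨h2, rfl⟩ | ⟨h2, rfl⟩⟩
    · exact Or.inl ⟨E, ⟨h1, h2⟩, rfl⟩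
    · exact Or.inr ⟨E, ⟨h1, h2⟩, rfl⟩

/-- occupancy of a site -/
def occ (C : Finset ℕ) (q : ℕ) : ℕ := (if 2*q ∈ C then 1 else 0) + (if 2*q+1 ∈ C then 1 else 0)

lemma occ_mv {j : ℕ} {C : Finset ℕ} (h : grd j C) (q : ℕ) :
    occ (mv j C) q + (if q + 1 = j / 2 then 1 else 0) = occ C q + (if q = j / 2 then 1 else 0) := by
  obtain ⟨h1, h2, h3⟩ := h
  simp only [occ, mem_mv]
  by_cases e : q + 1 = j / 2
  · have e' : q ≠ j / 2 := by omega
    rcases Nat.mod_two_eq_zero_or_one j with hj | hj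
    · have a1 : j - 2 = 2 * q := by omega
      have a2 : 2 * q ≠ j := by omega
      have a3 : 2 * q + 1 ≠ j := by omega
      rw [a1] at h2
      simp [a1, a2, a3, e, e', h2]; omega
    · have a1 : j - 2 = 2 * q + 1 := by omega
      have a2 : 2 * q ≠ j := by omega
      have a3 : 2 * q + 1 ≠ j := by omega
      rw [a1] at h2
      simp [a1, a2, a3, e, e', h2]
  · by_cases e' : q = j / 2
    · rcases Nat.mod_two_eq_zero_or_one j with hj | hj
      · have a1 : 2 * q = j := by omega
        have a2 : 2 * q ≠ j - 2 := by omega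
        have a3 : 2 * q + 1 ≠ j - 2 := by omega
        have a4 : 2 * q + 1 ≠ j := by omega
        rw [← a1] at h3
        have b1 : 2 * q ∈ C ↔ ¬ (2 * q = j - 2 ∨ 2 * q = j) := by
          simp [h3, a1]; exact a1 ▸ h3
        have b2 : (2 * q + 1 ∈ C ↔ ¬ (2 * q + 1 = j - 2 ∨ 2 * q + 1 = j)) ↔ 2 * q + 1 ∈ C := by
          simp only [a3, a4]; simp
        rw [if_pos b1, if_neg h3, if_neg e, if_pos e']
        simp only [b2]
        omega
      · have a1 : 2 * q + 1 = j := by omega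
        have a2 : 2 * q ≠ j - 2 := by omega
        have a3 : 2 * q + 1 ≠ j - 2 := by omega
        have a4 : 2 * q ≠ j := by omega
        have a5 : q = (2 * q + 1) / 2 := by omega
        rw [← a1] at h3
        have b1 : 2 * q + 1 ∈ C ↔ ¬ (2 * q + 1 = j - 2 ∨ 2 * q + 1 = j) := by
          simp [h3, a1]; exact a1 ▸ h3
        have b2 : (2 * q ∈ C ↔ ¬ (2 * q = j - 2 ∨ 2 * q = j)) ↔ 2 * q ∈ C := by
          simp only [a2, a4]; simp
        rw [if_pos b1, if_neg h3, if_neg e, if_pos e']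
        simp only [b2]
    · have a1 : 2 * q ≠ j := by omega
      have a2 : 2 * q ≠ j - 2 := by omega
      have a3 : 2 * q + 1 ≠ j - 2 := by omega
      have a4 : 2 * q + 1 ≠ j := by omega
      simp [a1, a2, a3, a4, e, e']

lemma occ_two {C : Finset ℕ} {q : ℕ} : occ C q = 2 ↔ 2*q ∈ C ∧ 2*q+1 ∈ C := by
  unfold occ; split_ifs <;> simp_all
lemma occ_zero {C : Finset ℕ} {q : ℕ} : occ C q = 0 ↔ 2*q ∉ C ∧ 2*q+1 ∉ C := by
  unfold occ; split_ifs <;> simp_all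
lemma occ_one {C : Finset ℕ} {q : ℕ} : occ C q = 1 ↔ ((2*q ∈ C ∧ 2*q+1 ∉ C) ∨ (2*q ∉ C ∧ 2*q+1 ∈ C)) := by
  unfold occ; split_ifs <;> simp_all

/-- three steps -/
def stp3 (q r t : ℕ) (E D : Finset ℕ) : Prop := ∃ F G, stp q E F ∧ stp r F G ∧ stp t G D

lemma mem_act3 {q r t : ℕ} {X : Finset (Finset ℕ)} {D : Finset ℕ} :
    D ∈ act t (act r (act q X)) ↔ ∃ E ∈ X, stp3 q r t E D := by
  simp only [mem_act, stp3]
  grind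

/-- guards of three moves -/
def grd3 (i j k : ℕ) (E : Finset ℕ) : Prop := grd i E ∧ grd j (mv i E) ∧ grd k (mv j (mv i E))

lemma stp3_iff {q r t : ℕ} {E D : Finset ℕ} : stp3 q r t E D ↔
    ∃ i j k, (i = 2*q ∨ i = 2*q+1) ∧ (j = 2*r ∨ j = 2*r+1) ∧ (k = 2*t ∨ k = 2*t+1) ∧
      grd3 i j k E ∧ D = mv k (mv j (mv i E)) := by
  constructor
  · rintro ⟨F, G, h1, h2, h3⟩
    unfold stp at h1 h2 h3
    unfold grd3
    rcases h1 with ⟨g1, rfl⟩ | ⟨g1, rfl⟩ <;> rcases h2 with ⟨g2, rfl⟩ | ⟨g2, rfl⟩ <;>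
    rcases h3 with ⟨g3, rfl⟩ | ⟨g3, rfl⟩ <;>
    exact ⟨_, _, _, by simp, by simp, by simp, ⟨g1, g2, g3⟩, rfl⟩
  · rintro ⟨i, j, k, hi, hj, hk, ⟨g1, g2, g3⟩, rfl⟩
    refine ⟨mv i E, mv j (mv i E), ?_, ?_, ?_⟩ <;> unfold stp
    · rcases hi with rfl | rfl <;> simp [g1]
    · rcases hj with rfl | rfl <;> simp [g2]
    · rcases hk with rfl | rfl <;> simp [g3]


lemma ser_up (p h : ℕ) (hh : h = 2*(p+2) ∨ h = 2*(p+2)+1) (C : Finset ℕ) :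
    ((grd3 (2*(p+1)) (2*(p+1)+1) h C ∨ grd3 h (2*(p+1)) (2*(p+1)+1) C) ↔
     (grd3 (2*(p+1)) h (2*(p+1)+1) C ∨ grd3 (2*(p+1)+1) h (2*(p+1)) C)) ∧
    ¬ (grd3 (2*(p+1)) (2*(p+1)+1) h C ∧ grd3 h (2*(p+1)) (2*(p+1)+1) C) ∧
    ¬ (grd3 (2*(p+1)) h (2*(p+1)+1) C ∧ grd3 (2*(p+1)+1) h (2*(p+1)) C) ∧
    (grd3 (2*(p+1)) (2*(p+1)+1) h C → occ C p = 2 ∧ occ C (p+1) = 0) ∧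
    (grd3 h (2*(p+1)) (2*(p+1)+1) C → occ C p = 2 ∧ occ C (p+1) = 1) := by
  rcases hh with rfl | rfl <;>
  · simp only [grd3, grd, mem_mv, mul_add, mul_one, add_assoc, Nat.reduceAdd, Nat.reduceMul, Nat.add_sub_cancel,
      Nat.reduceSubDiff, Nat.add_left_cancel_iff, occ_two, occ_zero, occ_one]
    generalize 2 * p = m
    simp
    by_cases h0 : m ∈ C <;> by_cases h1 : m+1 ∈ C <;> by_cases h2 : m+2 ∈ C <;> by_cases h3 : m+3 ∈ C <;>
    by_cases h4 : m+4 ∈ C <;> by_cases h5 : m+5 ∈ C <;> simp [*]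

lemma ser_down (p h : ℕ) (hh : h = 2*(p+1) ∨ h = 2*(p+1)+1) (C : Finset ℕ) :
    ((grd3 (2*(p+2)) (2*(p+2)+1) h C ∨ grd3 h (2*(p+2)) (2*(p+2)+1) C) ↔
     (grd3 (2*(p+2)) h (2*(p+2)+1) C ∨ grd3 (2*(p+2)+1) h (2*(p+2)) C)) ∧
    ¬ (grd3 (2*(p+2)) (2*(p+2)+1) h C ∧ grd3 h (2*(p+2)) (2*(p+2)+1) C) ∧
    ¬ (grd3 (2*(p+2)) h (2*(p+2)+1) C ∧ grd3 (2*(p+2)+1) h (2*(p+2)) C) ∧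
    (grd3 (2*(p+2)) (2*(p+2)+1) h C → occ C (p+1) = 2 ∧ occ C (p+2) = 0) ∧
    (grd3 h (2*(p+2)) (2*(p+2)+1) C → occ C (p+1) = 1 ∧ occ C (p+2) = 0) := by
  rcases hh with rfl | rfl <;>
  · simp only [grd3, grd, mem_mv, mul_add, mul_one, add_assoc, Nat.reduceAdd, Nat.reduceMul, Nat.add_sub_cancel,
      Nat.reduceSubDiff, Nat.add_left_cancel_iff, occ_two, occ_zero, occ_one]
    generalize 2 * p = m
    simp
    by_cases h0 : m ∈ C <;> by_cases h1 : m+1 ∈ C <;> by_cases h2 : m+2 ∈ C <;> by_cases h3 : m+3 ∈ C <;>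
    by_cases h4 : m+4 ∈ C <;> by_cases h5 : m+5 ∈ C <;> simp [*]

lemma el_up1 (p : ℕ) (E D : Finset ℕ) (h0 : occ E p = 2) (h1 : occ E (p+1) = 0) :
    stp3 (p+1) (p+1) (p+2) E D ↔ stp3 (p+1) (p+2) (p+1) E D := by
  rw [stp3_iff, stp3_iff]
  rw [occ_two] at h0
  rw [occ_zero] at h1
  simp only [grd3, grd, mem_mv, mul_add, mul_one, add_assoc, Nat.reduceAdd, Nat.reduceMul, Nat.add_sub_cancel,
      Nat.reduceSubDiff, Nat.add_left_cancel_iff] at *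
  generalize 2 * p = m at *
  rcases h0 with ⟨h0, h0'⟩ <;> rcases h1 with ⟨h1, h1'⟩ <;>
  simp only [or_and_right, and_or_left, exists_or, and_assoc, exists_and_left, exists_eq_left] <;>
  simp [*, mv_comm] <;> tauto

lemma el_up2 (p : ℕ) (E D : Finset ℕ) (h0 : occ E p = 2) (h1 : occ E (p+1) = 1) :
    stp3 (p+2) (p+1) (p+1) E D ↔ stp3 (p+1) (p+2) (p+1) E D := by
  rw [stp3_iff, stp3_iff]
  rw [occ_two] at h0
  rw [occ_one] at h1
  simp only [grd3, grd, mem_mv, mul_add, mul_one, add_assoc, Nat.reduceAdd, Nat.reduceMul, Nat.add_sub_cancel,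
      Nat.reduceSubDiff, Nat.add_left_cancel_iff] at *
  generalize 2 * p = m at *
  rcases h0 with ⟨h0, h0'⟩ <;> rcases h1 with (⟨h1, h1'⟩ | ⟨h1, h1'⟩) <;>
  simp only [or_and_right, and_or_left, exists_or, and_assoc, exists_and_left, exists_eq_left] <;>
  simp [*, mv_comm] <;> tauto

lemma el_down1 (p : ℕ) (E D : Finset ℕ) (h0 : occ E (p+1) = 2) (h1 : occ E (p+2) = 0) :
    stp3 (p+2) (p+2) (p+1) E D ↔ stp3 (p+2) (p+1) (p+2) E D := by
  rw [stp3_iff, stp3_iff]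
  rw [occ_two] at h0
  rw [occ_zero] at h1
  simp only [grd3, grd, mem_mv, mul_add, mul_one, add_assoc, Nat.reduceAdd, Nat.reduceMul, Nat.add_sub_cancel,
      Nat.reduceSubDiff, Nat.add_left_cancel_iff] at *
  generalize 2 * p = m at *
  rcases h0 with ⟨h0, h0'⟩ <;> rcases h1 with ⟨h1, h1'⟩ <;>
  simp only [or_and_right, and_or_left, exists_or, and_assoc, exists_and_left, exists_eq_left] <;>
  simp [*, mv_comm] <;> tauto

lemma el_down2 (p : ℕ) (E D : Finset ℕ) (h0 : occ E (p+1) = 1) (h1 : occ E (p+2) = 0) :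
    stp3 (p+1) (p+2) (p+2) E D ↔ stp3 (p+2) (p+1) (p+2) E D := by
  rw [stp3_iff, stp3_iff]
  rw [occ_one] at h0
  rw [occ_zero] at h1
  simp only [grd3, grd, mem_mv, mul_add, mul_one, add_assoc, Nat.reduceAdd, Nat.reduceMul, Nat.add_sub_cancel,
      Nat.reduceSubDiff, Nat.add_left_cancel_iff] at *
  generalize 2 * p = m at *
  rcases h0 with (⟨h0, h0'⟩ | ⟨h0, h0'⟩) <;> rcases h1 with ⟨h1, h1'⟩ <;>
  simp only [or_and_right, and_or_left, exists_or, and_assoc, exists_and_left, exists_eq_left] <;>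
  simp [*, mv_comm] <;> tauto


lemma grd_comm {i j : ℕ} (h1 : i ≠ j) (h2 : i ≠ j + 2) (h3 : j ≠ i + 2) (E : Finset ℕ) :
    (grd i E ∧ grd j (mv i E)) ↔ (grd j E ∧ grd i (mv j E)) := by
  have a : ∀ {i j : ℕ}, i ≠ j → i ≠ j + 2 → j ≠ i + 2 → 2 ≤ i → 2 ≤ j → (grd j (mv i E) ↔ grd j E) := by
    intro i j h1 h2 h3 hi hj
    unfold grd
    rw [mem_mv, mem_mv]
    have b1 : ¬ (j - 2 = i - 2 ∨ j - 2 = i) := by omega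
    have b2 : ¬ (j = i - 2 ∨ j = i) := by omega
    simp [b1, b2]
  constructor
  · rintro ⟨p, q⟩
    have h := (a h1 h2 h3 p.1 q.1).1 q
    exact ⟨h, (a h1.symm h3 h2 q.1 p.1).2 p⟩
  · rintro ⟨p, q⟩
    have h := (a h1.symm h3 h2 p.1 q.1).1 q
    exact ⟨h, (a h1 h2 h3 q.1 p.1).2 p⟩

lemma stp_iff {q : ℕ} {E D : Finset ℕ} : stp q E D ↔ ∃ i, i / 2 = q ∧ grd i E ∧ D = mv i E := by
  unfold stp
  constructor
  · rintro (⟨g, rfl⟩ | ⟨g, rfl⟩)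
    · exact ⟨_, by omega, g, rfl⟩
    · exact ⟨_, by omega, g, rfl⟩
  · rintro ⟨i, hi, g, rfl⟩
    have : i = 2 * q ∨ i = 2 * q + 1 := by omega
    rcases this with rfl | rfl
    · exact Or.inl ⟨g, rfl⟩
    · exact Or.inr ⟨g, rfl⟩

lemma act_comm {q r : ℕ} (h : q + 2 ≤ r) (X : Finset (Finset ℕ)) :
    act q (act r X) = act r (act q X) := by
  have key : ∀ {q r : ℕ}, (q + 2 ≤ r ∨ r + 2 ≤ q) → ∀ E F D, stp q E F → stp r F D → ∃ F', stp r E F' ∧ stp q F' D := by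
    intro q r h E F D h1 h2
    obtain ⟨i, hi, g1, rfl⟩ := stp_iff.1 h1
    obtain ⟨j, hj, g2, rfl⟩ := stp_iff.1 h2
    obtain ⟨g3, g4⟩ := (grd_comm (by omega) (by omega) (by omega) E).1 ⟨g1, g2⟩
    exact ⟨mv j E, stp_iff.2 ⟨j, hj, g3, rfl⟩, stp_iff.2 ⟨i, hi, g4, mv_comm _ _ _⟩⟩
  ext D
  simp only [mem_act]
  constructor
  · rintro ⟨F, ⟨E, hE, h1⟩, h2⟩
    obtain ⟨F', a, b⟩ := key (Or.inr h) E F D h1 h2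
    exact ⟨F', ⟨E, hE, a⟩, b⟩
  · rintro ⟨F, ⟨E, hE, h1⟩, h2⟩
    obtain ⟨F', a, b⟩ := key (Or.inl h) E F D h1 h2
    exact ⟨F', ⟨E, hE, a⟩, b⟩

end Colour


/-! ### Matrices of partial functions; the bead system of colourings -/
section PMat

variable {σ : Type} [DecidableEq σ]

/-- matrix of a partial function restricted to a finite set -/
def gmat (F : Finset σ) (φ : σ → Option σ) : Matrix F F ℤ :=
  Matrix.of fun s s' => if φ s.1 = some s'.1 then 1 else 0

lemma gmat_apply (F : Finset σ) (φ : σ → Option σ) (s s' : F) :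
    gmat F φ s s' = if φ s.1 = some s'.1 then 1 else 0 := rfl

lemma gmat_mul (F : Finset σ) (φ ψ : σ → Option σ) (h : ∀ s ∈ F, ∀ t, φ s = some t → t ∈ F) :
    gmat F φ * gmat F ψ = gmat F (fun s => (φ s).bind ψ) := by
  ext s s'
  rw [Matrix.mul_apply, gmat_apply]
  cases hs : φ s.1 with
  | none => simp [gmat_apply, hs]
  | some t =>
    have ht := h s.1 s.2 t hs
    rw [Finset.sum_eq_single (⟨t, ht⟩ : F)]
    · simp [gmat_apply, hs]
    · intro b _ hb
      rw [gmat_apply, hs, if_neg, zero_mul]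
      intro e
      exact hb (Subtype.ext (Option.some.inj e).symm)
    · simp

lemma gmat_congr (F : Finset σ) (φ ψ : σ → Option σ) (h : ∀ s ∈ F, φ s = ψ s) :
    gmat F φ = gmat F ψ := by
  ext s s'
  rw [gmat_apply, gmat_apply, h s.1 s.2]

lemma gmat_none (F : Finset σ) (φ : σ → Option σ) (h : ∀ s ∈ F, φ s = none) :
    gmat F φ = 0 := by
  ext s s'
  rw [gmat_apply, h s.1 s.2]; simp

end PMat

section Sys

/-- states -/
abbrev SX := Finset ℕ × Finset (Finset ℕ)

/-- the partial move -/
def ph (j : ℕ) (s : SX) : Option SX :=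
  if grd j s.1 then some (mv j s.1, act (j/2) s.2) else none

/-- validity -/
def vld (s : SX) : Prop := ∀ E ∈ s.2, ∀ q, occ E q = occ s.1 q

/-- the finite set of states -/
noncomputable def FSt (B : ℕ) : Finset SX :=
  @Finset.filter _ vld (Classical.decPred _)
    ((Finset.range (2*B)).powerset ×ˢ (Finset.range (2*B)).powerset.powerset)

lemma mem_FSt {B : ℕ} {s : SX} : s ∈ FSt B ↔
    (∀ x ∈ s.1, x < 2*B) ∧ (∀ E ∈ s.2, ∀ x ∈ E, x < 2*B) ∧ vld s := by
  letI : DecidablePred vld := Classical.decPred _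
  rw [FSt, Finset.mem_filter, Finset.mem_product, Finset.mem_powerset, Finset.mem_powerset, and_assoc]
  simp only [Finset.subset_iff, Finset.mem_powerset, Finset.mem_range]

lemma mv_bd {B j : ℕ} (hj : j < B) {C : Finset ℕ} (h : ∀ x ∈ C, x < B) : ∀ x ∈ mv j C, x < B := by
  intro x hx
  rw [mem_mv] at hx
  by_cases e : x = j - 2 ∨ x = j
  · omega
  · exact h x (hx.2 e)

lemma ph_FSt {B j : ℕ} (hj : j < 2*B) (s : SX) (hs : s ∈ FSt B) (t : SX) (h : ph j s = some t) : t ∈ FSt B := by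
  unfold ph at h
  split_ifs at h with g
  cases h
  rw [mem_FSt] at hs ⊢
  obtain ⟨h1, h2, h3⟩ := hs
  refine ⟨mv_bd hj h1, ?_, ?_⟩
  · intro D hD
    obtain ⟨E, hE, hst⟩ := mem_act.1 hD
    obtain ⟨i, hi, -, rfl⟩ := stp_iff.1 hst
    exact mv_bd (by omega) (h2 E hE)
  · intro D hD q
    obtain ⟨E, hE, hst⟩ := mem_act.1 hD
    obtain ⟨i, hi, gi, rfl⟩ := stp_iff.1 hst
    have a := occ_mv g q
    have b := occ_mv gi q
    have c := h3 E hE q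
    rw [hi] at b
    change _ = occ (mv j s.1) q
    omega

/-- the move matrices -/
noncomputable def UX (B j : ℕ) : Matrix (FSt B) (FSt B) ℤ := if j < 2*B then gmat (FSt B) (ph j) else 0

lemma ph2 (i j : ℕ) (s : SX) : (ph i s).bind (ph j) =
    if grd i s.1 ∧ grd j (mv i s.1) then some (mv j (mv i s.1), act (j/2) (act (i/2) s.2)) else none := by
  unfold ph
  by_cases h1 : grd i s.1 <;> by_cases h2 : grd j (mv i s.1) <;> simp [h1, h2]

instance (i j k : ℕ) (C : Finset ℕ) : Decidable (grd3 i j k C) := by unfold grd3; infer_instance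

lemma ph3 (i j k : ℕ) (s : SX) : ((ph i s).bind (ph j)).bind (ph k) =
    if grd3 i j k s.1 then some (mv k (mv j (mv i s.1)), act (k/2) (act (j/2) (act (i/2) s.2))) else none := by
  rw [ph2]
  have e3 : grd3 i j k s.1 ↔ grd i s.1 ∧ grd j (mv i s.1) ∧ grd k (mv j (mv i s.1)) := Iff.rfl
  simp only [e3]
  by_cases h1 : grd i s.1 ∧ grd j (mv i s.1)
  · rw [if_pos h1]
    by_cases h2 : grd k (mv j (mv i s.1)) <;> simp [ph, h1, h2]
  · rw [if_neg h1, if_neg (by tauto)]; rfl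

lemma UX_mul (B i j : ℕ) : UX B i * UX B j = if i < 2*B ∧ j < 2*B then
    gmat (FSt B) (fun s => (ph i s).bind (ph j)) else 0 := by
  unfold UX
  by_cases hi : i < 2*B <;> by_cases hj : j < 2*B <;> simp [hi, hj]
  exact gmat_mul _ _ _ (ph_FSt hi)

lemma UX_mul3 (B i j k : ℕ) : UX B i * UX B j * UX B k = if i < 2*B ∧ j < 2*B ∧ k < 2*B then
    gmat (FSt B) (fun s => ((ph i s).bind (ph j)).bind (ph k)) else 0 := by
  rw [UX_mul]
  by_cases hi : i < 2*B <;> by_cases hj : j < 2*B <;> by_cases hk : k < 2*B <;> simp [hi, hj, hk, UX]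
  apply gmat_mul
  intro s hs t ht
  rw [Option.bind_eq_some_iff] at ht
  obtain ⟨u, hu, ht⟩ := ht
  exact ph_FSt hj u (ph_FSt hi s hs u hu) t ht

lemma UX_sq (B j : ℕ) : UX B j * UX B j = 0 := by
  rw [UX_mul]
  split_ifs
  · apply gmat_none
    intro s _
    rw [ph2, if_neg]
    rintro ⟨h1, h2⟩
    have := h2.2.2
    rw [mem_mv] at this
    have := h1.2.2
    tauto
  · rfl

lemma UX_same (B q : ℕ) : Commute (UX B (2*q)) (UX B (2*q+1)) := by
  rw [Commute, SemiconjBy, UX_mul, UX_mul]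
  simp only [and_comm]
  congr 1
  apply gmat_congr
  intro s _
  rw [ph2, ph2, show (2*q+1)/2 = 2*q/2 by omega, mv_comm]
  simp only [grd_comm (show 2*q ≠ 2*q+1 by omega) (by omega) (by omega) s.1]

lemma UX_far (B i j : ℕ) (h : i / 2 + 2 ≤ j / 2) : Commute (UX B i) (UX B j) := by
  rw [Commute, SemiconjBy, UX_mul, UX_mul]
  simp only [and_comm]
  congr 1
  apply gmat_congr
  intro s _
  rw [ph2, ph2, mv_comm, act_comm h]
  simp only [grd_comm (show i ≠ j by omega) (by omega) (by omega) s.1]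

lemma UX_nb (B i h : ℕ) (hh : i / 2 = h / 2 + 1 ∨ h / 2 = i / 2 + 1) : UX B i * UX B h * UX B i = 0 := by
  rw [UX_mul3]
  split_ifs
  · apply gmat_none
    intro s _
    rw [ph3, if_neg]
    rintro ⟨⟨h1, h2, h3⟩, ⟨h4, h5, h6⟩, ⟨h7, h8, h9⟩⟩
    simp only [mem_mv] at h5 h6 h8 h9
    by_cases e1 : h = i + 2
    · subst e1
      have : i - 2 ≠ i := by omega
      have : i - 2 ≠ i + 2 := by omega
      simp [*] at h8
    · by_cases e2 : i = h + 2
      · subst e2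
        simp [*] at h9
        omega
      · have a1 : i ≠ h := by omega
        have a2 : i ≠ h - 2 := by omega
        simp [*] at h9
  · rfl

lemma ser_gmat {F : Finset SX} {f1 f2 f3 f4 : SX → Option SX}
    (h : ∀ s ∈ F, ∃ G1 G2 G3 G4 : Prop, ∃ _ : Decidable G1, ∃ _ : Decidable G2, ∃ _ : Decidable G3,
      ∃ _ : Decidable G4, ∃ v1 v2 v3 v4 : SX,
      f1 s = (if G1 then some v1 else none) ∧ f2 s = (if G2 then some v2 else none) ∧
      f3 s = (if G3 then some v3 else none) ∧ f4 s = (if G4 then some v4 else none) ∧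
      ((G1 ∨ G2) ↔ (G3 ∨ G4)) ∧ ¬ (G1 ∧ G2) ∧ ¬ (G3 ∧ G4) ∧
      (G1 → v1 = v3) ∧ (G2 → v2 = v3) ∧ v3 = v4) :
    gmat F f1 + gmat F f2 = gmat F f3 + gmat F f4 := by
  ext s s'
  obtain ⟨G1, G2, G3, G4, _, _, _, _, v1, v2, v3, v4, e1, e2, e3, e4, a, b, c, d1, d2, d3⟩ := h s.1 s.2
  rw [Matrix.add_apply, Matrix.add_apply, gmat_apply, gmat_apply, gmat_apply, gmat_apply, e1, e2, e3, e4]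
  subst d3
  by_cases g1 : G1 <;> by_cases g2 : G2 <;> by_cases g3 : G3 <;> by_cases g4 : G4 <;> simp [g1, g2, g3, g4] at * <;>
    simp [*]

lemma act3_eq {q r t q' r' t' : ℕ} {X : Finset (Finset ℕ)}
    (h : ∀ E ∈ X, ∀ D, stp3 q r t E D ↔ stp3 q' r' t' E D) :
    act t (act r (act q X)) = act t' (act r' (act q' X)) := by
  ext D
  rw [mem_act3, mem_act3]
  constructor
  · rintro ⟨E, hE, h1⟩; exact ⟨E, hE, (h E hE D).1 h1⟩
  · rintro ⟨E, hE, h1⟩; exact ⟨E, hE, (h E hE D).2 h1⟩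

lemma UX_ser (B q h : ℕ) (hh : q = h / 2 + 1 ∨ h / 2 = q + 1) :
      UX B (2*q) * UX B (2*q+1) * UX B h + UX B h * (UX B (2*q) * UX B (2*q+1))
        = UX B (2*q) * UX B h * UX B (2*q+1) + UX B (2*q+1) * UX B h * UX B (2*q) := by
  rw [← mul_assoc, UX_mul3, UX_mul3, UX_mul3, UX_mul3]
  by_cases hq : 2*q+1 < 2*B
  swap
  · simp [hq]
  by_cases hB : h < 2*B
  swap
  · simp [hB]
  have hq' : 2*q < 2*B := by omega
  simp only [hq, hB, hq', and_self, if_true]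
  apply ser_gmat
  intro s hs
  have hv := (mem_FSt.1 hs).2.2
  refine ⟨grd3 (2*q) (2*q+1) h s.1, grd3 h (2*q) (2*q+1) s.1, grd3 (2*q) h (2*q+1) s.1, grd3 (2*q+1) h (2*q) s.1,
    inferInstance, inferInstance, inferInstance, inferInstance, _, _, _, _, ph3 _ _ _ s, ph3 _ _ _ s, ph3 _ _ _ s, ph3 _ _ _ s, ?_⟩
  have e1 : 2 * q / 2 = q := by omega
  have e2 : (2 * q + 1) / 2 = q := by omega
  rw [e1, e2]
  have m1 : mv h (mv (2*q+1) (mv (2*q) s.1)) = mv (2*q+1) (mv h (mv (2*q) s.1)) := mv_comm _ _ _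
  have m2 : mv (2*q+1) (mv (2*q) (mv h s.1)) = mv (2*q+1) (mv h (mv (2*q) s.1)) := by rw [mv_comm (2*q) h]
  have m3 : mv (2*q) (mv h (mv (2*q+1) s.1)) = mv (2*q+1) (mv h (mv (2*q) s.1)) := by
    rw [mv_comm h, mv_comm (2*q), mv_comm (2*q) h]
  rw [m1, m2, m3]
  rcases q with _ | p
  · have z0 : ∀ C, ¬ grd 0 C := fun C h => by have := h.1; omega
    have z1 : ∀ C, ¬ grd 1 C := fun C h => by have := h.1; omega
    simp [grd3, z0, z1]
  rcases hh with hh | hh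
  · -- `h` is below
    rcases p with _ | p
    · have z0 : ∀ C, ¬ grd h C := fun C h => by have := h.1; omega
      simp [grd3, z0]
    have hp : h / 2 = p + 1 := by omega
    rw [hp]
    obtain ⟨a, b, c, d1, d2⟩ := ser_down p h (by omega) s.1
    refine ⟨a, b, c, fun g => ?_, fun g => ?_, rfl⟩
    · obtain ⟨o1, o2⟩ := d1 g
      rw [act3_eq (fun E hE D => el_down1 p E D (by rw [hv E hE, o1]) (by rw [hv E hE, o2]))]
    · obtain ⟨o1, o2⟩ := d2 g
      rw [act3_eq (fun E hE D => el_down2 p E D (by rw [hv E hE, o1]) (by rw [hv E hE, o2]))]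
  · have hp : h / 2 = p + 2 := by omega
    rw [hp]
    obtain ⟨a, b, c, d1, d2⟩ := ser_up p h (by omega) s.1
    refine ⟨a, b, c, fun g => ?_, fun g => ?_, rfl⟩
    · obtain ⟨o1, o2⟩ := d1 g
      rw [act3_eq (fun E hE D => el_up1 p E D (by rw [hv E hE, o1]) (by rw [hv E hE, o2]))]
    · obtain ⟨o1, o2⟩ := d2 g
      rw [act3_eq (fun E hE D => el_up2 p E D (by rw [hv E hE, o1]) (by rw [hv E hE, o2]))]

/-- the bead system of colourings -/
noncomputable def SysX (B : ℕ) : BSys (FSt B) where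
  C := fun s => s.1.1
  U := UX B
  L := 2*B
  bd := fun s => (mem_FSt.1 s.2).1
  nn := by
    intro j s s'
    unfold UX
    split_ifs
    · rw [gmat_apply]; split_ifs <;> simp
    · simp
  P1 := by
    intro j s s' h
    unfold UX at h
    split_ifs at h with hj
    · rw [gmat_apply] at h
      have h2 : ph j s.1 = some s'.1 := by
        by_contra hc; rw [if_neg hc] at h; exact h rfl
      unfold ph at h2
      split_ifs at h2 with g
      have := congrArg Prod.fst (Option.some.inj h2)
      rw [← this]
      exact g.Mv
    · exact absurd rfl h
  P2 := fun i j h => UX_far B i j (by omega)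
  P3 := fun N n x y => PL_P3 _ (fun p _ n x y => PL_filter_comm _ (UX_sq B) (UX_same B) (UX_far B)
    (UX_nb B) (UX_ser B) p n N x y) n x y
  P4 := fun N n x y => PL_P4 _ (fun p _ n x y => PL_filter_comm _ (UX_sq B) (UX_same B) (UX_far B)
    (UX_nb B) (UX_ser B) p n N x y) n x y

end Sys


/-! ### Counting coloured paths -/
section Paths

/-- number of coloured paths along a word -/
def mw : List ℕ → Finset ℕ → Finset ℕ → ℕ
  | [], C, D => if C = D then 1 else 0
  | q :: w, C, D => (if grd (2*q) C then mw w (mv (2*q) C) D else 0) +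
      (if grd (2*q+1) C then mw w (mv (2*q+1) C) D else 0)

/-- same occupancies -/
def SO (C D : Finset ℕ) : Prop := ∀ q, occ C q = occ D q

lemma SO.mv {C D : Finset ℕ} (h : SO C D) {i j : ℕ} (hij : i / 2 = j / 2) (gi : grd i C) (gj : grd j D) :
    SO (mv i C) (mv j D) := by
  intro q
  have a := occ_mv gi q
  have b := occ_mv gj q
  have c := h q
  rw [hij] at a
  omega

lemma mw_ne_cons {q : ℕ} {w : List ℕ} {C D : Finset ℕ} (h : mw (q :: w) C D ≠ 0) :
    ∃ i, i / 2 = q ∧ grd i C ∧ mw w (mv i C) D ≠ 0 := by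
  rw [mw] at h
  by_cases h1 : grd (2*q) C
  · by_cases h2 : mw w (mv (2*q) C) D = 0
    · by_cases h3 : grd (2*q+1) C
      · refine ⟨2*q+1, by omega, h3, ?_⟩
        simpa [h1, h2, h3] using h
      · simp [h1, h2, h3] at h
    · exact ⟨2*q, by omega, h1, h2⟩
  · by_cases h3 : grd (2*q+1) C
    · refine ⟨2*q+1, by omega, h3, ?_⟩
      simpa [h1, h3] using h
    · simp [h1, h3] at h

lemma mw_ne_of {i : ℕ} {w : List ℕ} {C D : Finset ℕ} (g : grd i C) (h : mw w (mv i C) D ≠ 0) :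
    mw ((i/2) :: w) C D ≠ 0 := by
  rw [mw]
  have : i = 2*(i/2) ∨ i = 2*(i/2)+1 := by omega
  rcases this with e | e
  · rw [← e, if_pos g]; omega
  · rw [← e, if_pos g]; omega

/-- ternary xor -/
def tx (A B C : Finset ℕ) : Finset ℕ := symmDiff (symmDiff A B) C

lemma mem_tx {x : ℕ} {A B C : Finset ℕ} : x ∈ tx A B C ↔ ((x ∈ A ↔ x ∈ B) ↔ x ∈ C) := by
  simp only [tx, Finset.mem_symmDiff]; tauto

lemma tx_self (A B : Finset ℕ) : tx A A B = B := by simp [tx]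

lemma tx_site {S E F : Finset ℕ} {q : ℕ} (h1 : occ S q = occ E q) (h2 : occ S q = occ F q) :
    (((2*q ∈ E ↔ 2*q ∈ F) ∨ (2*q+1 ∈ E ↔ 2*q+1 ∈ F)) →
      ((2*q ∈ S ↔ 2*q ∈ tx S E F) ∧ (2*q+1 ∈ S ↔ 2*q+1 ∈ tx S E F))) ∧
    (((2*q ∈ E ↔ 2*q+1 ∈ F) ∨ (2*q+1 ∈ E ↔ 2*q ∈ F)) →
      ((2*q ∈ S ↔ 2*q+1 ∈ tx S E F) ∧ (2*q+1 ∈ S ↔ 2*q ∈ tx S E F))) := by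
  simp only [mem_tx]
  unfold occ at h1 h2
  by_cases a0 : 2*q ∈ S <;> by_cases a1 : 2*q+1 ∈ S <;> by_cases b0 : 2*q ∈ E <;>
  by_cases b1 : 2*q+1 ∈ E <;> simp [a0, a1, b0, b1] at h1 h2 ⊢ <;>
  by_cases c0 : 2*q ∈ F <;> by_cases c1 : 2*q+1 ∈ F <;> simp [c0, c1] at h2 ⊢

lemma tx_loc {S E E' : Finset ℕ} {p : ℕ} (h1 : occ S p = occ E p) (h2 : occ S p = occ E' p)
    (h3 : occ S (p+1) = occ E (p+1)) (h4 : occ S (p+1) = occ E' (p+1))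
    {a a' : ℕ} (ha : a = 2*(p+1) ∨ a = 2*(p+1)+1) (ha' : a' = 2*(p+1) ∨ a' = 2*(p+1)+1)
    (g : grd a E) (g' : grd a' E') {b b' : ℕ} (hb : b = 2*(p+1) ∨ b = 2*(p+1)+1)
    (hb' : b' = 2*(p+1) ∨ b' = 2*(p+1)+1) (hs : b = b' ↔ a = a') :
    grd b S ↔ grd b' (tx S E E') := by
  obtain ⟨k1, k2⟩ := tx_site h1 h2
  obtain ⟨l1, l2⟩ := tx_site h3 h4
  have z0 : 2*(p+1) - 2 = 2*p := by omega
  have z1 : 2*(p+1)+1 - 2 = 2*p+1 := by omega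
  have z2 : 2 ≤ 2*(p+1) := by omega
  have z3 : 2 ≤ 2*(p+1)+1 := by omega
  have z4 : 2*(p+1) ≠ 2*(p+1)+1 := by omega
  have z5 : 2*(p+1)+1 ≠ 2*(p+1) := by omega
  obtain ⟨-, i1, i2⟩ := g
  obtain ⟨-, i3, i4⟩ := g'
  unfold grd
  rcases ha with rfl | rfl <;> rcases ha' with rfl | rfl <;> rcases hb with rfl | rfl <;>
  rcases hb' with rfl | rfl <;> (try (exfalso; first | exact z4 (hs.1 rfl) | exact z5 (hs.1 rfl) | exact z4 (hs.2 rfl) | exact z5 (hs.2 rfl))) <;>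
  simp only [z0, z1, z2, z3, true_and] at * <;>
  clear hs h1 h2 h3 h4 <;>
  first
  | (have K := k1 (Or.inl (iff_of_true i1 i3))
     have L := l1 (Or.inl (iff_of_false i2 i4))
     first | rw [← K.1, ← L.1] | rw [← K.2, ← L.2])
  | (have K := k1 (Or.inr (iff_of_true i1 i3))
     have L := l1 (Or.inr (iff_of_false i2 i4))
     first | rw [← K.1, ← L.1] | rw [← K.2, ← L.2])
  | (have K := k2 (Or.inl (iff_of_true i1 i3))
     have L := l2 (Or.inl (iff_of_false i2 i4))
     first | rw [← K.1, ← L.1] | rw [← K.2, ← L.2])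
  | (have K := k2 (Or.inr (iff_of_true i1 i3))
     have L := l2 (Or.inr (iff_of_false i2 i4))
     first | rw [← K.1, ← L.1] | rw [← K.2, ← L.2])

lemma tx_mv {S E E' : Finset ℕ} {i a a' b b' : ℕ} 
    (ha : a = i ∨ a = i+1) (ha' : a' = i ∨ a' = i+1) (hb : b = i ∨ b = i+1)
    (hb' : b' = i ∨ b' = i+1) (hs : b = b' ↔ a = a') :
    mv b' (tx S E E') = tx (mv b S) (mv a E) (mv a' E') := by
  ext x
  simp only [mem_mv, mem_tx]
  have key : (b' = b ∧ a = a') ∨ (b' = a ∧ a' = b) ∨ (b' = a' ∧ a = b) := by omega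
  clear ha ha' hb hb' hs
  rcases key with ⟨e1, e2⟩ | ⟨e1, e2⟩ | ⟨e1, e2⟩
  · rw [e1, e2]
    by_cases t : x = b - 2 ∨ x = b <;> by_cases t' : x = a' - 2 ∨ x = a' <;> simp only [t, t'] <;>
      by_cases s1 : x ∈ S <;> by_cases s2 : x ∈ E <;> by_cases s3 : x ∈ E' <;> simp [s1, s2, s3]
  · rw [e1, e2]
    by_cases t : x = b - 2 ∨ x = b <;> by_cases t' : x = a - 2 ∨ x = a <;> simp only [t, t'] <;>
      by_cases s1 : x ∈ S <;> by_cases s2 : x ∈ E <;> by_cases s3 : x ∈ E' <;> simp [s1, s2, s3]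
  · rw [e1, e2]
    by_cases t : x = b - 2 ∨ x = b <;> by_cases t' : x = a' - 2 ∨ x = a' <;> simp only [t, t'] <;>
      by_cases s1 : x ∈ S <;> by_cases s2 : x ∈ E <;> by_cases s3 : x ∈ E' <;> simp [s1, s2, s3]

lemma CI_aux (w : List ℕ) : ∀ (E E' E1 E1' S S1 : Finset ℕ), SO S E → SO S E' →
    mw w E E1 ≠ 0 → mw w E' E1' ≠ 0 → mw w S S1 = mw w (tx S E E') (tx S1 E1 E1') := by
  induction w with
  | nil =>
    intro E E' E1 E1' S S1 _ _ h h'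
    have e : E = E1 := by by_contra hc; simp [mw, hc] at h
    have e' : E' = E1' := by by_contra hc; simp [mw, hc] at h'
    subst e e'
    simp only [mw]
    congr 1
    rw [eq_iff_iff]
    constructor
    · rintro rfl; rfl
    · intro h
      ext x
      have := Finset.ext_iff.1 h x
      rw [mem_tx, mem_tx] at this
      tauto
  | cons q w ih =>
    intro E E' E1 E1' S S1 hS hS' h h'
    obtain ⟨a, ha, ga, hm⟩ := mw_ne_cons h
    obtain ⟨a', ha', ga', hm'⟩ := mw_ne_cons h'
    have hq : q ≠ 0 := by have := ga.1; omega
    obtain ⟨p, rfl⟩ := Nat.exists_eq_succ_of_ne_zero hq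
    have key : ∀ b b', (b = 2*(p+1) ∨ b = 2*(p+1)+1) → (b' = 2*(p+1) ∨ b' = 2*(p+1)+1) → (b = b' ↔ a = a') →
        (if grd b S then mw w (mv b S) S1 else 0) =
        (if grd b' (tx S E E') then mw w (mv b' (tx S E E')) (tx S1 E1 E1') else 0) := by
      intro b b' hb hb' hs
      have := tx_loc (hS p) (hS' p) (hS (p+1)) (hS' (p+1)) (a := a) (a' := a') (by omega) (by omega)
        ga ga' hb hb' hs
      by_cases gb : grd b S
      · rw [if_pos gb, if_pos (this.1 gb), tx_mv (i := 2*(p+1)) (by omega) (by omega) hb hb' hs]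
        exact ih _ _ _ _ _ _ (hS.mv (by omega) gb ga) (hS'.mv (by omega) gb ga') hm hm'
      · rw [if_neg gb, if_neg (fun c => gb (this.2 c))]
    simp only [Nat.succ_eq_add_one, mw]
    by_cases haa : a = a'
    · rw [key (2*(p+1)) (2*(p+1)) (by simp) (by simp) (by simp [haa]),
        key (2*(p+1)+1) (2*(p+1)+1) (by simp) (by simp) (by simp [haa])]
    · rw [key (2*(p+1)) (2*(p+1)+1) (by simp) (by simp) (by simp [haa]),
        key (2*(p+1)+1) (2*(p+1)) (by simp) (by simp) (by simp [haa]), add_comm]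

lemma CI {w : List ℕ} {E E' E1 E1' : Finset ℕ} (hs : SO E E') (h : mw w E E1 ≠ 0) (h' : mw w E' E1' ≠ 0) :
    mw w E E1 = mw w E' E1' := by
  have := CI_aux w E E' E1 E1' E E1 (fun _ => rfl) hs h h'
  rwa [tx_self, tx_self] at this

/-- height function of one colour -/
def cnt (c : ℕ) (C : Finset ℕ) (q : ℕ) : ℕ := (C.filter (fun x => x % 2 = c ∧ q ≤ x / 2)).card

lemma cnt_succ {c : ℕ} (hc : c < 2) (C : Finset ℕ) (q : ℕ) :
    cnt c C q = cnt c C (q+1) + (if 2*q+c ∈ C then 1 else 0) := by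
  unfold cnt
  by_cases h : 2*q+c ∈ C
  · rw [if_pos h, ← Finset.card_insert_of_notMem (a := 2*q+c)]
    · congr 1
      ext x
      simp only [Finset.mem_insert, Finset.mem_filter]
      constructor
      · rintro ⟨h1, h2, h3⟩
        by_cases e : x = 2*q+c
        · exact Or.inl e
        · exact Or.inr ⟨h1, h2, by omega⟩
      · rintro (rfl | ⟨h1, h2, h3⟩)
        · exact ⟨h, by omega, by omega⟩
        · exact ⟨h1, h2, by omega⟩
    · simp only [Finset.mem_filter]; rintro ⟨-, -, h3⟩; omega
  · rw [if_neg h, add_zero]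
    congr 1
    ext x
    simp only [Finset.mem_filter]
    constructor
    · rintro ⟨h1, h2, h3⟩
      refine ⟨h1, h2, ?_⟩
      by_contra hh
      apply h
      have : x = 2*q+c := by omega
      rwa [← this]
    · rintro ⟨h1, h2, h3⟩
      exact ⟨h1, h2, by omega⟩

lemma cnt_large {c : ℕ} {C : Finset ℕ} {q : ℕ} (h : ∀ x ∈ C, x < 2 * q) : cnt c C q = 0 := by
  rw [cnt, Finset.card_eq_zero, Finset.filter_eq_empty_iff]
  rintro x hx ⟨-, h2⟩
  have := h x hx
  omega

lemma exists_large (C : Finset ℕ) : ∃ q, ∀ x ∈ C, x < 2 * q := by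
  refine ⟨C.sup id + 1, fun x hx => ?_⟩
  have := Finset.le_sup (f := id) hx
  simp at this
  omega

lemma cnt_ext {C D : Finset ℕ} (h : ∀ c < 2, ∀ q, cnt c C q = cnt c D q) : C = D := by
  ext x
  have h1 := h (x%2) (by omega) (x/2)
  rw [cnt_succ (by omega) C, cnt_succ (by omega) D, h (x%2) (by omega) (x/2+1)] at h1
  have e : 2 * (x/2) + x%2 = x := by omega
  rw [e] at h1
  split_ifs at h1 <;> simp_all

/-- two height functions with the same increments agree -/
lemma cnt_unique {c : ℕ} (hc : c < 2) (C : Finset ℕ) (f : ℕ → ℕ)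
    (h1 : ∀ q, f q = f (q+1) + (if 2*q+c ∈ C then 1 else 0)) (h2 : ∃ M, ∀ q ≥ M, f q = 0) (q : ℕ) :
    cnt c C q = f q := by
  obtain ⟨M, hM⟩ := h2
  obtain ⟨M', hM'⟩ := exists_large C
  have : ∀ n q, M + M' ≤ q + n → cnt c C q = f q := by
    intro n
    induction n with
    | zero =>
      intro q hq
      rw [hM q (by omega), cnt_large]
      intro x hx; have := hM' x hx; omega
    | succ n ih =>
      intro q hq
      rw [cnt_succ hc, h1, ih (q+1) (by omega)]
  exact this (M+M') q (by omega)

lemma cnt_mv {j : ℕ} {C : Finset ℕ} (g : grd j C) {c : ℕ} (hc : c < 2) (q : ℕ) :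
    cnt c (mv j C) q = cnt c C q + (if 2*q+c = j then 1 else 0) := by
  obtain ⟨g1, g2, g3⟩ := g
  refine cnt_unique hc _ (fun q => cnt c C q + (if 2*q+c = j then 1 else 0)) ?_ ?_ q
  · intro q
    rw [cnt_succ hc C q]
    by_cases e1 : 2*q+c = j
    · have : (2 * q + c ∈ mv j C) := by rw [mem_mv]; simp [e1, g3]
      have e2 : 2*(q+1)+c ≠ j := by omega
      have e3 : 2*q+c ∉ C := by rwa [e1]
      rw [if_pos this, if_pos e1, if_neg e2, if_neg e3]
    · by_cases e2 : 2*(q+1)+c = j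
      · have e3 : 2*q+c = j-2 := by omega
        have e4 : 2*q+c ∈ C := by rwa [e3]
        have : (2 * q + c ∉ mv j C) := by rw [mem_mv]; simp [e3, g2]
        rw [if_neg this, if_neg e1, if_pos e2, if_pos e4]
      · have : (2 * q + c ∈ mv j C) ↔ 2*q+c ∈ C := by
          rw [mem_mv]
          have : ¬ (2*q+c = j-2 ∨ 2*q+c = j) := by omega
          simp [this]
        simp only [this, e1, e2, if_false]; omega
  · obtain ⟨M', hM'⟩ := exists_large C
    refine ⟨M' + j, fun q hq => ?_⟩
    rw [cnt_large, if_neg (by omega)]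
    intro x hx; have := hM' x hx; omega

/-- `D` is the meet-join of `C` -/
def isflip (C D : Finset ℕ) : Prop := ∀ q, cnt 1 D q = max (cnt 1 C q) (cnt 0 C q) ∧
  cnt 0 D q = min (cnt 1 C q) (cnt 0 C q)

lemma isflip.SO {C D : Finset ℕ} (h : isflip C D) : SO D C := by
  intro q
  have h1 := h q
  have h2 := h (q+1)
  rw [cnt_succ (c := 1) (by omega) D, cnt_succ (c := 1) (by omega) C, cnt_succ (c := 0) (by omega) D,
    cnt_succ (c := 0) (by omega) C] at h1
  unfold occ
  simp only [add_zero] at h1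
  omega

set_option maxHeartbeats 2000000 in
lemma isflip.step {E E' D : Finset ℕ} (h : isflip E E') {q : ℕ} (hs : ∃ i, i / 2 = q ∧ grd i E ∧ D = mv i E) :
    ∃ i, i / 2 = q ∧ grd i E' ∧ isflip D (mv i E') := by
  obtain ⟨i, hi, g, rfl⟩ := hs
  have g0 := g
  obtain ⟨g1, g2, g3⟩ := g
  obtain ⟨p, rfl⟩ : ∃ p, q = p + 1 := ⟨q - 1, by omega⟩
  have a1 := cnt_succ (c := 1) (by omega) E p
  have a2 := cnt_succ (c := 1) (by omega) E (p+1)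
  have b1 := cnt_succ (c := 0) (by omega) E p
  have b2 := cnt_succ (c := 0) (by omega) E (p+1)
  have a1' := cnt_succ (c := 1) (by omega) E' p
  have a2' := cnt_succ (c := 1) (by omega) E' (p+1)
  have b1' := cnt_succ (c := 0) (by omega) E' p
  have b2' := cnt_succ (c := 0) (by omega) E' (p+1)
  have f0 := h p
  have f1 := h (p+1)
  have f2 := h (p+1+1)
  -- the slot that has to be moved
  have hdec : ∀ i', (i' / 2 = p + 1) → (i' - 2 ∈ E') → i' ∉ E' →
      (i' = 2*(p+1)+1 ↔ ((i = 2*(p+1)+1 ∧ cnt 0 E (p+1) ≤ cnt 1 E (p+1)) ∨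
        (i = 2*(p+1) ∧ cnt 1 E (p+1) ≤ cnt 0 E (p+1)))) →
      ∃ k, k / 2 = p+1 ∧ grd k E' ∧ isflip (mv i E) (mv k E') := by
    intro i' hi' k1 k2 k3
    refine ⟨i', hi', ⟨by omega, k1, k2⟩, ?_⟩
    intro x
    have g' : grd i' E' := ⟨by omega, k1, k2⟩
    rw [cnt_mv g' (by omega), cnt_mv g' (by omega), cnt_mv g0 (by omega), cnt_mv g0 (by omega)]
    have fx := h x
    by_cases hx : x = p + 1
    · subst hx
      have hii : i = 2*(p+1) ∨ i = 2*(p+1)+1 := by omega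
      have hii' : i' = 2*(p+1) ∨ i' = 2*(p+1)+1 := by omega
      split_ifs <;> omega
    · rw [if_neg (by omega), if_neg (by omega), if_neg (by omega), if_neg (by omega)]
      exact fx
  have hii : i = 2*(p+1) ∨ i = 2*(p+1)+1 := by omega
  rcases hii with rfl | rfl
  · have e1 : 2 * (p+1) - 2 = 2*p+0 := by omega
    rw [e1] at g2
    rw [if_pos g2] at b1
    rw [add_zero, if_neg g3] at b2
    by_cases hc : cnt 1 E (p+1) ≤ cnt 0 E (p+1)
    · apply hdec (2*(p+1)+1) (by omega)
      · rw [show 2*(p+1)+1-2 = 2*p+1 by omega]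
        by_contra hn; rw [if_neg hn] at a1'; split_ifs at * <;> omega
      · intro hn; rw [if_pos hn] at a2'; split_ifs at * <;> omega
      · simp [hc]
    · apply hdec (2*(p+1)) (by omega)
      · rw [e1]
        by_contra hn; rw [if_neg hn] at b1'; split_ifs at * <;> omega
      · intro hn; rw [add_zero, if_pos hn] at b2'; split_ifs at * <;> omega
      · simp [hc]
  · have e1 : 2 * (p+1) + 1 - 2 = 2*p+1 := by omega
    rw [e1] at g2
    rw [if_pos g2] at a1
    rw [if_neg g3] at a2
    by_cases hc : cnt 0 E (p+1) ≤ cnt 1 E (p+1)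
    · apply hdec (2*(p+1)+1) (by omega)
      · rw [show 2*(p+1)+1-2 = 2*p+1 by omega]
        by_contra hn; rw [if_neg hn] at a1'; split_ifs at * <;> omega
      · intro hn; rw [if_pos hn] at a2'; split_ifs at * <;> omega
      · simp [hc]
    · apply hdec (2*(p+1)) (by omega)
      · rw [show 2 * (p+1) - 2 = 2*p+0 by omega]
        by_contra hn; rw [if_neg hn] at b1'; split_ifs at * <;> omega
      · intro hn; rw [add_zero, if_pos hn] at b2'; split_ifs at * <;> omega
      · simp [hc]

lemma mw_flip (w : List ℕ) : ∀ {E E' E1 E1' : Finset ℕ}, isflip E E' → isflip E1 E1' →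
    mw w E E1 ≠ 0 → mw w E' E1' ≠ 0 := by
  induction w with
  | nil =>
    intro E E' E1 E1' h h1 hm
    have e : E = E1 := by by_contra hc; simp [mw, hc] at hm
    subst e
    have : E' = E1' := by
      apply cnt_ext
      intro c hc q
      obtain rfl | rfl : c = 0 ∨ c = 1 := by omega
      · rw [(h q).2, (h1 q).2]
      · rw [(h q).1, (h1 q).1]
    simp [mw, this]
  | cons q w ih =>
    intro E E' E1 E1' h h1 hm
    obtain ⟨i, hi, g, hm⟩ := mw_ne_cons hm
    obtain ⟨i', hi', g', hf⟩ := h.step ⟨i, hi, g, rfl⟩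
    have := mw_ne_of g' (ih hf h1 hm)
    rwa [hi'] at this

/-- act along a word -/
def actw (w : List ℕ) (X : Finset (Finset ℕ)) : Finset (Finset ℕ) := w.foldl (fun X q => act q X) X

lemma mem_actw (w : List ℕ) (X : Finset (Finset ℕ)) (D : Finset ℕ) :
    D ∈ actw w X ↔ ∃ E ∈ X, mw w E D ≠ 0 := by
  induction w generalizing X with
  | nil =>
    simp only [actw, List.foldl_nil, mw]
    constructor
    · intro h; exact ⟨D, h, by simp⟩
    · rintro ⟨E, hE, h⟩
      have : E = D := by by_contra hc; simp [hc] at h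
      rwa [← this]
  | cons q w ih =>
    have : actw (q :: w) X = actw w (act q X) := rfl
    rw [this, ih]
    constructor
    · rintro ⟨F, hF, h⟩
      obtain ⟨E, hE, hs⟩ := mem_act.1 hF
      obtain ⟨i, rfl, g, rfl⟩ := stp_iff.1 hs
      exact ⟨E, hE, mw_ne_of g h⟩
    · rintro ⟨E, hE, h⟩
      obtain ⟨i, hi, g, h⟩ := mw_ne_cons h
      exact ⟨_, mem_act.2 ⟨E, hE, stp_iff.2 ⟨i, hi, g, rfl⟩⟩, h⟩

/-- the meet-join identity on words -/
lemma mw_meetjoin {w : List ℕ} {E E' E1 E1' : Finset ℕ} (h : isflip E E') (h1 : isflip E1 E1') :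
    (if E1 ∈ actw w {E} then mw w E' E1' else 0) = mw w E E1 := by
  simp only [mem_actw, Finset.mem_singleton, exists_eq_left]
  by_cases hm : mw w E E1 = 0
  · simp [hm]
  · rw [if_pos hm]
    exact CI h.SO (mw_flip w h h1 hm) hm

end Paths


/-! ### Operators of partial functions and the meet-join formula -/
section Ops

variable {R : Type} [CommRing R]

/-- operator of a partial function -/
def pop (R : Type) [CommRing R] {σ : Type} (φ : σ → Option σ) : Module.End R (σ → R) where
  toFun v s := (φ s).elim 0 v
  map_add' v w := by
    ext s
    cases h : φ s <;> simp [h]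
  map_smul' c v := by
    ext s
    cases h : φ s <;> simp [h]

lemma pop_apply {σ : Type} (φ : σ → Option σ) (v : σ → R) (s : σ) : pop R φ v s = (φ s).elim 0 v := rfl

lemma pop_mul {σ : Type} (φ ψ : σ → Option σ) : pop R φ * pop R ψ = pop R (fun s => (φ s).bind ψ) := by
  ext v s
  rw [Module.End.mul_apply, pop_apply, pop_apply]
  cases h : φ s <;> simp [pop_apply]

/-- the partial move on colourings -/
def phC (j : ℕ) (C : Finset ℕ) : Option (Finset ℕ) := if grd j C then some (mv j C) else none

/-- list products of elementary factors -/
def OL {A : Type} [Ring A] [Algebra R A] (u : ℕ → A) (l : List ℕ) (x : R) : A :=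
  (l.map fun j => 1 + x • u j).prod

lemma OL_nil {A : Type} [Ring A] [Algebra R A] (u : ℕ → A) (x : R) : OL u [] x = 1 := rfl
lemma OL_cons {A : Type} [Ring A] [Algebra R A] (u : ℕ → A) (j : ℕ) (l : List ℕ) (x : R) :
    OL u (j :: l) x = (1 + x • u j) * OL u l x := by simp [OL]
lemma OL_append {A : Type} [Ring A] [Algebra R A] (u : ℕ → A) (l l' : List ℕ) (x : R) :
    OL u (l ++ l') x = OL u l x * OL u l' x := by simp [OL]

/-- the product over all variables -/
def OP {A : Type} [Ring A] [Algebra R A] (u : ℕ → A) (L : ℕ) (xs : List R) : A :=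
  (xs.map fun x => OL u (List.range L) x).prod

lemma OP_nil {A : Type} [Ring A] [Algebra R A] (u : ℕ → A) (L : ℕ) : OP u L ([] : List R) = 1 := rfl
lemma OP_cons {A : Type} [Ring A] [Algebra R A] (u : ℕ → A) (L : ℕ) (x : R) (xs : List R) :
    OP u L (x :: xs) = OL u (List.range L) x * OP u L xs := by simp [OP]

/-- move operators on colourings -/
def uC (R : Type) [CommRing R] (j : ℕ) : Module.End R (Finset ℕ → R) := pop R (phC j)
/-- move operators on states -/
def uS (R : Type) [CommRing R] (j : ℕ) : Module.End R (SX → R) := pop R (ph j)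

lemma uC_apply (j : ℕ) (v : Finset ℕ → R) (C : Finset ℕ) :
    uC R j v C = if grd j C then v (mv j C) else 0 := by
  rw [uC, pop_apply, phC]; split_ifs <;> rfl

lemma uS_apply (j : ℕ) (v : SX → R) (s : SX) :
    uS R j v s = if grd j s.1 then v (mv j s.1, act (j/2) s.2) else 0 := by
  rw [uS, pop_apply, ph]; split_ifs <;> rfl

/-- functions of the first coordinate -/
lemma uS_fst (j : ℕ) (v : Finset ℕ → R) : uS R j (fun s => v s.1) = fun s => uC R j v s.1 := by
  ext s
  rw [uS_apply, uC_apply]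

lemma OL_fst (l : List ℕ) (x : R) (v : Finset ℕ → R) :
    OL (uS R) l x (fun s => v s.1) = fun s => OL (uC R) l x v s.1 := by
  induction l with
  | nil => rfl
  | cons j l ih =>
    rw [OL_cons, OL_cons, Module.End.mul_apply, ih, Module.End.mul_apply]
    simp only [LinearMap.add_apply, Module.End.one_apply, LinearMap.smul_apply, uS_fst]
    rfl

lemma OP_fst (L : ℕ) (xs : List R) (v : Finset ℕ → R) :
    OP (uS R) L xs (fun s => v s.1) = fun s => OP (uC R) L xs v s.1 := by
  induction xs with
  | nil => rfl
  | cons x xs ih =>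
    rw [OP_cons, OP_cons, Module.End.mul_apply, ih, Module.End.mul_apply, OL_fst]

/-! bridge to matrices -/
lemma gmat_mulVec {σ : Type} [DecidableEq σ] (F : Finset σ) (φ : σ → Option σ)
    (h : ∀ s ∈ F, ∀ t, φ s = some t → t ∈ F) (w : σ → R) :
    ((gmat F φ).map (Int.cast : ℤ → R)).mulVec (fun s => w s.1) = fun s => pop R φ w s.1 := by
  ext s
  rw [Matrix.mulVec, dotProduct, pop_apply]
  simp only [Matrix.map_apply, gmat_apply]
  cases hs : φ s.1 with
  | none => simp
  | some t =>
    have ht := h s.1 s.2 t hs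
    rw [Finset.sum_eq_single (⟨t, ht⟩ : F)]
    · simp
    · intro b _ hb
      rw [if_neg, Int.cast_zero, zero_mul]
      intro e
      exact hb (Subtype.ext (Option.some.inj e).symm)
    · simp

lemma PL_mulVec (B : ℕ) (l : List ℕ) (hl : ∀ j ∈ l, j < 2*B) (x : R) (w : SX → R) :
    (PL (UX B) l x).mulVec (fun s => w s.1) = fun s => OL (uS R) l x w s.1 := by
  induction l with
  | nil => rw [PL_nil, Matrix.one_mulVec]; rfl
  | cons j l ih =>
    rw [PL_cons, ← Matrix.mulVec_mulVec, ih (fun i hi => hl i (by simp [hi])), OL_cons, FF,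
      Matrix.add_mulVec, Matrix.one_mulVec, Matrix.smul_mulVec, UX, if_pos (hl j (by simp)),
      gmat_mulVec _ _ (ph_FSt (hl j (by simp)))]
    rfl

lemma PLs_mulVec (B : ℕ) (xs : List R) (w : SX → R) :
    ((xs.map fun x => PL (UX B) (List.range (2*B)) x).prod).mulVec (fun s => w s.1)
      = fun s => OP (uS R) (2*B) xs w s.1 := by
  induction xs with
  | nil => rw [List.map_nil, List.prod_nil, Matrix.one_mulVec]; rfl
  | cons x xs ih =>
    rw [List.map_cons, List.prod_cons, ← Matrix.mulVec_mulVec, ih, PL_mulVec _ _ (by simp), OP_cons]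
    rfl

/-! words -/

/-- one site operator -/
def fC (R : Type) [CommRing R] (q : ℕ) : Module.End R (Finset ℕ → R) := uC R (2*q) + uC R (2*q+1)
/-- one site operator -/
def fS (R : Type) [CommRing R] (q : ℕ) : Module.End R (SX → R) := uS R (2*q) + uS R (2*q+1)

lemma fC_word (w : List ℕ) (D C : Finset ℕ) :
    ((w.map (fC R)).prod (fun C => if C = D then 1 else 0)) C = (mw w C D : R) := by
  induction w generalizing C with
  | nil => simp [mw]
  | cons q w ih =>
    rw [List.map_cons, List.prod_cons, Module.End.mul_apply, fC, LinearMap.add_apply, Pi.add_apply,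
      uC_apply, uC_apply, ih, ih, mw]
    push_cast
    rfl

/-- the test function -/
def w2 (R : Type) [CommRing R] (D D' : Finset ℕ) (s : SX) : R := if s.1 = D' ∧ D ∈ s.2 then 1 else 0

lemma fS_word (w : List ℕ) (D D' : Finset ℕ) (s : SX) :
    ((w.map (fS R)).prod (w2 R D D')) s = ((if D ∈ actw w s.2 then mw w s.1 D' else 0 : ℕ) : R) := by
  induction w generalizing s with
  | nil =>
    simp only [List.map_nil, List.prod_nil, Module.End.one_apply, w2, actw, List.foldl_nil, mw]
    by_cases h1 : s.1 = D' <;> by_cases h2 : D ∈ s.2 <;> simp [h1, h2]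
  | cons q w ih =>
    rw [List.map_cons, List.prod_cons, Module.End.mul_apply, fS, LinearMap.add_apply, Pi.add_apply,
      uS_apply, uS_apply, ih, ih, mw]
    have e1 : 2*q/2 = q := by omega
    have e2 : (2*q+1)/2 = q := by omega
    have : actw (q :: w) s.2 = actw w (act q s.2) := rfl
    rw [this, e1, e2]
    by_cases h : D ∈ actw w (act q s.2) <;> simp [h]

lemma uC_sq (j : ℕ) : uC R j * uC R j = 0 := by
  ext v C
  rw [Module.End.mul_apply, uC_apply, uC_apply]
  split_ifs with h1 h2
  · exfalso
    have := h2.2.2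
    rw [mem_mv] at this
    have := h1.2.2
    tauto
  · rfl
  · rfl

lemma uS_sq (j : ℕ) : uS R j * uS R j = 0 := by
  ext v s
  rw [Module.End.mul_apply, uS_apply, uS_apply]
  split_ifs with h1 h2
  · exfalso
    have := h2.2.2
    rw [mem_mv] at this
    have := h1.2.2
    tauto
  · rfl
  · rfl

lemma uC_same (q : ℕ) : uC R (2*q) * uC R (2*q+1) = uC R (2*q+1) * uC R (2*q) := by
  ext v C
  have := grd_comm (show 2*q ≠ 2*q+1 by omega) (by omega) (by omega) C
  simp only [Module.End.mul_apply, uC_apply, ← ite_and, this, mv_comm (2*q+1)]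

lemma uS_same (q : ℕ) : uS R (2*q) * uS R (2*q+1) = uS R (2*q+1) * uS R (2*q) := by
  ext v s
  have := grd_comm (show 2*q ≠ 2*q+1 by omega) (by omega) (by omega) s.1
  simp only [Module.End.mul_apply, uS_apply, ← ite_and, this, mv_comm (2*q+1),
    show (2*q+1)/2 = q by omega, show 2*q/2 = q by omega]

lemma pair_two {A : Type} [Ring A] [Algebra R A] {u v : A} (hu : u * u = 0) (hv : v * v = 0)
    (huv : u * v = v * u) (x : R) :
    (2:R) • ((1 + x • u) * (1 + x • v)) = (2:R) • 1 + (2*x) • (u+v) + (x*x) • ((u+v)*(u+v)) := by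
  simp only [mul_add, add_mul, hu, hv, huv, smul_add, mul_one, one_mul, smul_mul_assoc, mul_smul_comm,
    smul_zero, add_zero, zero_add, mul_smul]
  rw [show (2:R) = 1 + 1 by norm_num]
  simp only [add_smul, one_smul]
  abel

/-- pairs whose 2-multiples lie in the algebra generated by sites -/
def good2 (R : Type) [CommRing R] : Set (Module.End R (SX → R) × Module.End R (Finset ℕ → R)) :=
  {P | ∃ n : ℕ, (2:R)^n • P ∈ Algebra.adjoin R (Set.range fun q => (fS R q, fC R q))}

lemma good2_one : (1 : Module.End R (SX → R) × Module.End R (Finset ℕ → R)) ∈ good2 R :=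
  ⟨0, by rw [pow_zero, one_smul]; exact one_mem _⟩

lemma good2_mul {P Q : Module.End R (SX → R) × Module.End R (Finset ℕ → R)} (hP : P ∈ good2 R)
    (hQ : Q ∈ good2 R) : P * Q ∈ good2 R := by
  obtain ⟨n, hn⟩ := hP
  obtain ⟨m, hm⟩ := hQ
  refine ⟨n + m, ?_⟩
  rw [pow_add, ← smul_mul_smul_comm]
  exact mul_mem hn hm

lemma good2_site (q : ℕ) (x : R) :
    (((1 + x • uS R (2*q)) * (1 + x • uS R (2*q+1)), (1 + x • uC R (2*q)) * (1 + x • uC R (2*q+1))) :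
      Module.End R (SX → R) × Module.End R (Finset ℕ → R)) ∈ good2 R := by
  refine ⟨1, ?_⟩
  rw [pow_one, Prod.smul_mk, pair_two (uS_sq _) (uS_sq _) (uS_same q), pair_two (uC_sq _) (uC_sq _) (uC_same q)]
  have : ((2:R) • 1 + (2*x) • (fS R q) + (x*x) • (fS R q * fS R q),
    (2:R) • 1 + (2*x) • (fC R q) + (x*x) • (fC R q * fC R q)) = (2:R) • (1 : Module.End R (SX → R) × Module.End R (Finset ℕ → R))
      + (2*x) • (fS R q, fC R q) + (x*x) • ((fS R q, fC R q) * (fS R q, fC R q)) := rfl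
  have hm : (fS R q, fC R q) ∈ Algebra.adjoin R (Set.range fun q => (fS R q, fC R q)) :=
    Algebra.subset_adjoin ⟨q, rfl⟩
  exact this ▸ add_mem (add_mem (Subalgebra.smul_mem _ (one_mem _) _) (Subalgebra.smul_mem _ hm _))
    (Subalgebra.smul_mem _ (mul_mem hm hm) _)

lemma good2_OL (B : ℕ) (x : R) : (OL (uS R) (List.range (2*B)) x, OL (uC R) (List.range (2*B)) x) ∈ good2 R := by
  induction B with
  | zero => exact good2_one
  | succ B ih =>
    have : List.range (2*(B+1)) = List.range (2*B) ++ [2*B, 2*B+1] := by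
      rw [show 2*(B+1) = 2*B+1+1 by ring, List.range_succ, List.range_succ]; simp
    rw [this, OL_append, OL_append]
    have := good2_mul ih (good2_site B x)
    simpa [OL] using this

lemma good2_OP (B : ℕ) (xs : List R) : (OP (uS R) (2*B) xs, OP (uC R) (2*B) xs) ∈ good2 R := by
  induction xs with
  | nil => exact good2_one
  | cons x xs ih =>
    rw [OP_cons, OP_cons]
    exact good2_mul (good2_OL B x) ih

lemma adj_eval {E E' E1 E1' : Finset ℕ} (h : isflip E E') (h1 : isflip E1 E1')
    {P : Module.End R (SX → R) × Module.End R (Finset ℕ → R)}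
    (hP : P ∈ Algebra.adjoin R (Set.range fun q => (fS R q, fC R q))) :
    P.1 (w2 R E1 E1') (E', {E}) = P.2 (fun C => if C = E1 then 1 else 0) E := by
  rw [← Subalgebra.mem_toSubmodule, Algebra.adjoin_eq_span] at hP
  induction hP using Submodule.span_induction with
  | mem P hP =>
    obtain ⟨l, hl, rfl⟩ := Submonoid.exists_list_of_mem_closure hP
    have : ∃ w : List ℕ, l = w.map (fun q => (fS R q, fC R q)) := by
      clear hP
      induction l with
      | nil => exact ⟨[], rfl⟩
      | cons a l ih =>
        obtain ⟨w, rfl⟩ := ih (fun y hy => hl y (by simp [hy]))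
        obtain ⟨q, rfl⟩ := hl a (by simp)
        exact ⟨q :: w, rfl⟩
    obtain ⟨w, rfl⟩ := this
    have e : (w.map (fun q => (fS R q, fC R q))).prod = ((w.map (fS R)).prod, (w.map (fC R)).prod) := by
      clear hP hl
      induction w with
      | nil => rfl
      | cons q w ih => rw [List.map_cons, List.prod_cons, ih]; simp
    rw [e]
    dsimp only
    rw [fS_word, fC_word, mw_meetjoin h h1]
  | zero => rfl
  | add P Q _ _ hP hQ =>
    simp only [Prod.fst_add, Prod.snd_add, LinearMap.add_apply, Pi.add_apply, hP, hQ]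
  | smul a P _ hP =>
    simp only [Prod.smul_fst, Prod.smul_snd, LinearMap.smul_apply, Pi.smul_apply, hP]

lemma OP_meetjoin [IsDomain R] [CharZero R] {E E' E1 E1' : Finset ℕ} (h : isflip E E') (h1 : isflip E1 E1')
    (B : ℕ) (xs : List R) :
    OP (uS R) (2*B) xs (w2 R E1 E1') (E', {E}) = OP (uC R) (2*B) xs (fun C => if C = E1 then 1 else 0) E := by
  obtain ⟨n, hn⟩ := good2_OP B xs
  have := adj_eval h h1 hn
  simp only [Prod.smul_mk, LinearMap.smul_apply, Pi.smul_apply] at this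
  exact smul_right_injective _ (pow_ne_zero n (two_ne_zero (α := R))) this

/-- generating function of pairs of families of paths -/
noncomputable def GF (N B : ℕ) (C D : Finset ℕ) : MvPolynomial (Fin N) ℤ :=
  OP (uC _) (2*B) (List.ofFn fun t : Fin N => (MvPolynomial.X t : MvPolynomial (Fin N) ℤ))
    (fun C => if C = D then 1 else 0) C

theorem GF_meetjoin (N B : ℕ) {E E' E1 E1' : Finset ℕ} (h : isflip E E') (h1 : isflip E1 E1')
    (hb : ∀ x ∈ E, x < 2*B) (hb' : ∀ x ∈ E', x < 2*B) :
    IsSchurNonneg N (GF N B E' E1' - GF N B E E1) := by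
  classical
  set xs := List.ofFn fun t : Fin N => (MvPolynomial.X t : MvPolynomial (Fin N) ℤ) with hxs
  have hs0 : ((E', {E}) : SX) ∈ FSt B := by
    rw [mem_FSt]
    refine ⟨hb', ?_, ?_⟩
    · intro F hF; rw [Finset.mem_singleton] at hF; subst hF; exact hb
    · intro F hF q; rw [Finset.mem_singleton] at hF; subst hF; exact (h.SO q).symm
  have e1 : GF N B E' E1' = OP (uS _) (2*B) xs (fun s => if s.1 = E1' then 1 else 0) (E', {E}) := by
    rw [OP_fst (2*B) xs (fun C => if C = E1' then 1 else 0)]; rfl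
  have e2 : GF N B E E1 = OP (uS _) (2*B) xs (w2 _ E1 E1') (E', {E}) := by
    rw [OP_meetjoin h h1]; rfl
  have e3 : GF N B E' E1' - GF N B E E1 =
      OP (uS _) (2*B) xs (fun s => if s.1 = E1' ∧ E1 ∉ s.2 then 1 else 0) (E', {E}) := by
    have hf : (fun s : SX => if s.1 = E1' ∧ E1 ∉ s.2 then (1 : MvPolynomial (Fin N) ℤ) else 0) =
        (fun s : SX => if s.1 = E1' then 1 else 0) - w2 _ E1 E1' := by
      funext s
      simp only [Pi.sub_apply, w2]
      by_cases a : s.1 = E1' <;> by_cases b : E1 ∈ s.2 <;> simp [a, b]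
    rw [e1, e2, ← Pi.sub_apply, ← map_sub, hf]
  have e4 := congrFun (PLs_mulVec B xs (fun s => if s.1 = E1' ∧ E1 ∉ s.2 then 1 else 0)) ⟨_, hs0⟩
  rw [e3, ← e4, Matrix.mulVec, dotProduct]
  apply sn_sum
  intro s _
  have := (SysX B).schur N ⟨_, hs0⟩ s
  have e5 : (List.ofFn fun t : Fin N => (SysX B).H (MvPolynomial.X t : MvPolynomial (Fin N) ℤ))
    = xs.map fun x => PL (UX B) (List.range (2*B)) x := by
    rw [hxs, List.map_ofFn]; rfl
  rw [e5] at this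
  split_ifs
  · rw [mul_one]; exact this
  · rw [mul_zero]; exact sn_zero N

end Ops


/-! ### Jacobi–Trudi -/
section JT

variable {R : Type} [CommRing R] {k : ℕ}

/-- configuration of two strictly decreasing sequences -/
def conf (a b : Fin k → ℕ) : Finset ℕ :=
  Finset.univ.image (fun i => 2 * a i + 1) ∪ Finset.univ.image (fun i => 2 * b i)

lemma mem_conf1 {a b : Fin k → ℕ} {q : ℕ} : 2*q+1 ∈ conf a b ↔ ∃ i, a i = q := by
  simp only [conf, Finset.mem_union, Finset.mem_image, Finset.mem_univ, true_and]
  constructor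
  · rintro (⟨i, hi⟩ | ⟨i, hi⟩)
    · exact ⟨i, by omega⟩
    · omega
  · rintro ⟨i, rfl⟩; exact Or.inl ⟨i, rfl⟩

lemma mem_conf0 {a b : Fin k → ℕ} {q : ℕ} : 2*q ∈ conf a b ↔ ∃ i, b i = q := by
  simp only [conf, Finset.mem_union, Finset.mem_image, Finset.mem_univ, true_and]
  constructor
  · rintro (⟨i, hi⟩ | ⟨i, hi⟩)
    · omega
    · exact ⟨i, by omega⟩
  · rintro ⟨i, rfl⟩; exact Or.inr ⟨i, rfl⟩

lemma mem_upd {a : Fin k → ℕ} (ha : Function.Injective a) {i : Fin k} {q : ℕ} (hi : a i + 1 = q)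
    (hn : ¬ ∃ j, a j = q) (x : ℕ) :
    (∃ j, Function.update a i q j = x) ↔ ((∃ j, a j = x) ↔ ¬ (x + 1 = q ∨ x = q)) := by
  by_cases e1 : x = q
  · subst e1
    simp only [hn, or_true, not_true, iff_self, iff_true]
    exact ⟨i, by simp⟩
  · by_cases e2 : x + 1 = q
    · have : ∃ j, a j = x := ⟨i, by omega⟩
      simp only [this, e2, true_or, not_true, iff_false]
      rintro ⟨j, hj⟩
      by_cases ej : j = i
      · subst ej; simp at hj; omega
      · rw [Function.update_of_ne ej] at hj
        exact ej (ha (by omega))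
    · simp only [e1, e2, or_self, not_false_iff, iff_true]
      constructor
      · rintro ⟨j, hj⟩
        by_cases ej : j = i
        · subst ej; simp at hj; omega
        · rw [Function.update_of_ne ej] at hj; exact ⟨j, hj⟩
      · rintro ⟨j, hj⟩
        have ej : j ≠ i := by rintro rfl; omega
        exact ⟨j, by rw [Function.update_of_ne ej, hj]⟩

lemma conf_ext {C D : Finset ℕ} (h0 : ∀ q, 2*q ∈ C ↔ 2*q ∈ D) (h1 : ∀ q, 2*q+1 ∈ C ↔ 2*q+1 ∈ D) : C = D := by
  ext x
  rcases Nat.even_or_odd' x with ⟨q, rfl | rfl⟩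
  · exact h0 q
  · exact h1 q

lemma mv_conf1 {a b : Fin k → ℕ} (ha : Function.Injective a) {i : Fin k} {q : ℕ} (hi : a i + 1 = q)
    (hn : ¬ ∃ j, a j = q) : mv (2*q+1) (conf a b) = conf (Function.update a i q) b := by
  apply conf_ext
  · intro x
    rw [mem_mv, mem_conf0, mem_conf0]
    have : ¬ (2*x = 2*q+1-2 ∨ 2*x = 2*q+1) := by omega
    simp only [this, not_false_iff, iff_true]
  · intro x
    rw [mem_mv, mem_conf1, mem_conf1, mem_upd ha hi hn]
    have : (2*x+1 = 2*q+1-2 ∨ 2*x+1 = 2*q+1) ↔ (x + 1 = q ∨ x = q) := by omega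
    rw [this]

lemma mv_conf0 {a b : Fin k → ℕ} (ha : Function.Injective b) {i : Fin k} {q : ℕ} (hi : b i + 1 = q)
    (hn : ¬ ∃ j, b j = q) : mv (2*q) (conf a b) = conf a (Function.update b i q) := by
  apply conf_ext
  · intro x
    rw [mem_mv, mem_conf0, mem_conf0, mem_upd ha hi hn]
    have : (2*x = 2*q-2 ∨ 2*x = 2*q) ↔ (x + 1 = q ∨ x = q) := by omega
    rw [this]
  · intro x
    rw [mem_mv, mem_conf1, mem_conf1]
    have : ¬ (2*x+1 = 2*q-2 ∨ 2*x+1 = 2*q) := by omega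
    simp [this]

lemma grd_conf1 {a b : Fin k → ℕ} {q : ℕ} : grd (2*q+1) (conf a b) ↔ (∃ i, a i + 1 = q) ∧ ¬ ∃ i, a i = q := by
  unfold grd
  rcases q with _ | q
  · simp
  · rw [show 2*(q+1)+1-2 = 2*q+1 by omega, mem_conf1, mem_conf1]
    have : 2 ≤ 2*(q+1)+1 := by omega
    simp only [this, true_and, Nat.add_right_cancel_iff]

lemma grd_conf0 {a b : Fin k → ℕ} {q : ℕ} : grd (2*q) (conf a b) ↔ (∃ i, b i + 1 = q) ∧ ¬ ∃ i, b i = q := by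
  unfold grd
  rcases q with _ | q
  · simp
  · rw [show 2*(q+1)-2 = 2*q by omega, mem_conf0, mem_conf0]
    simp

/-- determinants of sequences of functions -/
def DT (φ : Fin k → ℕ → R) (a : Fin k → ℕ) : R := Matrix.det (Matrix.of fun i j => φ i (a j))

lemma upd_anti {a : Fin k → ℕ} (ha : StrictAnti a) {i : Fin k} {q : ℕ} (hi : a i + 1 = q)
    (hn : ¬ ∃ j, a j = q) : StrictAnti (Function.update a i q) := by
  intro x y hxy
  by_cases ex : x = i
  · subst ex
    rw [Function.update_self, Function.update_of_ne (ne_of_gt hxy)]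
    have := ha hxy; omega
  · rw [Function.update_of_ne ex]
    by_cases ey : y = i
    · subst ey
      rw [Function.update_self]
      have h1 := ha hxy
      have h2 : a x ≠ q := fun h => hn ⟨x, h⟩
      omega
    · rw [Function.update_of_ne ey]; exact ha hxy

lemma DT_step {φ φ' : Fin k → ℕ → R} {x : R} {q : ℕ} (h : ∀ i n, n + 1 ≠ q → φ' i n = φ i n)
    (h' : ∀ i n, n + 1 = q → φ' i n = φ i n + x * φ i q) {a : Fin k → ℕ} (ha : StrictAnti a) :
    (¬ ((∃ i, a i + 1 = q) ∧ ¬ ∃ i, a i = q) → DT φ' a = DT φ a) ∧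
    (∀ i, a i + 1 = q → (¬ ∃ i, a i = q) → DT φ' a = DT φ a + x * DT φ (Function.update a i q)) := by
  have key : ∀ i, a i + 1 = q → DT φ' a = DT φ a + x * DT φ (Function.update a i q) := by
    intro i hi
    have e1 : (Matrix.of fun i j => φ' i (a j)) = Matrix.updateCol (Matrix.of fun i j => φ i (a j)) i
        ((fun r => φ r (a i)) + x • (fun r => φ r q)) := by
      ext r c
      by_cases hc : c = i
      · subst hc
        simp [h' r (a c) hi]
      · rw [Matrix.updateCol_ne hc, Matrix.of_apply, Matrix.of_apply, h]
        intro hh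
        exact hc (ha.injective (by omega))
    have e2 : Matrix.updateCol (Matrix.of fun i j => φ i (a j)) i (fun r => φ r (a i)) = Matrix.of fun i j => φ i (a j) := by
      ext r c
      by_cases hc : c = i
      · subst hc; simp
      · rw [Matrix.updateCol_ne hc]
    have e3 : Matrix.updateCol (Matrix.of fun i j => φ i (a j)) i (fun r => φ r q) = Matrix.of fun r j => φ r (Function.update a i q j) := by
      ext r c
      by_cases hc : c = i
      · subst hc; simp
      · rw [Matrix.updateCol_ne hc, Matrix.of_apply, Matrix.of_apply, Function.update_of_ne hc]
    rw [DT, e1, Matrix.det_updateCol_add, Matrix.det_updateCol_smul, e2, e3]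
    rfl
  refine ⟨?_, fun i hi _ => key i hi⟩
  intro hn
  by_cases h1 : ∃ i, a i + 1 = q
  · have h2 : ∃ i, a i = q := by tauto
    obtain ⟨i, hi⟩ := h1
    obtain ⟨j, hj⟩ := h2
    have hij : j ≠ i := by rintro rfl; omega
    rw [key i hi]
    have : DT φ (Function.update a i q) = 0 := by
      apply Matrix.det_zero_of_column_eq hij
      intro r
      simp [Function.update_of_ne hij, hj]
    rw [this, mul_zero, add_zero]
  · unfold DT
    congr 1
    ext r c
    exact h r (a c) (fun hh => h1 ⟨c, hh⟩)

/-- functions on configurations given by determinants -/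
def isDT (v : Finset ℕ → R) (φ ψ : Fin k → ℕ → R) : Prop :=
  ∀ a b, StrictAnti a → StrictAnti b → v (conf a b) = DT φ a * DT ψ b

lemma isDT.step1 {v : Finset ℕ → R} {φ φ' ψ : Fin k → ℕ → R} (hv : isDT v φ ψ) {x : R} {q : ℕ}
    (h : ∀ i n, n + 1 ≠ q → φ' i n = φ i n)
    (h' : ∀ i n, n + 1 = q → φ' i n = φ i n + x * φ i q) :
    isDT ((1 + x • uC R (2*q+1)) v) φ' ψ := by
  intro a b ha hb
  obtain ⟨k1, k2⟩ := DT_step h h' ha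
  rw [LinearMap.add_apply, Module.End.one_apply, LinearMap.smul_apply, Pi.add_apply, Pi.smul_apply, uC_apply,
    hv a b ha hb]
  by_cases g : grd (2*q+1) (conf a b)
  · rw [if_pos g]
    obtain ⟨⟨i, hi⟩, hn⟩ := grd_conf1.1 g
    rw [mv_conf1 ha.injective hi hn, hv _ _ (upd_anti ha hi hn) hb, k2 i hi hn, smul_eq_mul]
    ring
  · rw [if_neg g, k1 (fun hh => g (grd_conf1.2 hh)), smul_zero, add_zero]

lemma isDT.step0 {v : Finset ℕ → R} {φ ψ ψ' : Fin k → ℕ → R} (hv : isDT v φ ψ) {x : R} {q : ℕ}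
    (h : ∀ i n, n + 1 ≠ q → ψ' i n = ψ i n)
    (h' : ∀ i n, n + 1 = q → ψ' i n = ψ i n + x * ψ i q) :
    isDT ((1 + x • uC R (2*q)) v) φ ψ' := by
  intro a b ha hb
  obtain ⟨k1, k2⟩ := DT_step h h' hb
  rw [LinearMap.add_apply, Module.End.one_apply, LinearMap.smul_apply, Pi.add_apply, Pi.smul_apply, uC_apply,
    hv a b ha hb]
  by_cases g : grd (2*q) (conf a b)
  · rw [if_pos g]
    obtain ⟨⟨i, hi⟩, hn⟩ := grd_conf0.1 g
    rw [mv_conf0 hb.injective hi hn, hv _ _ ha (upd_anti hb hi hn), k2 i hi hn, smul_eq_mul]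
    ring
  · rw [if_neg g, k1 (fun hh => g (grd_conf0.2 hh)), smul_zero, add_zero]

/-- complete functions after moves `≥ J` of colour `c` -/
noncomputable def mixh (l : List R) (x : R) (α : Fin k → ℕ) (J c : ℕ) (i : Fin k) (n : ℕ) : R :=
  if J ≤ 2*(n+1)+c then hl (x :: l) ((α i : ℤ) - n) else hl l ((α i : ℤ) - n)

/-- complete functions -/
noncomputable def fullh (l : List R) (α : Fin k → ℕ) (i : Fin k) (n : ℕ) : R := hl l ((α i : ℤ) - n)

lemma mixh_step {l : List R} {x : R} {α : Fin k → ℕ} {q c : ℕ} (hc : c < 2) :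
    (∀ i n, n + 1 ≠ q → mixh l x α (2*q+c) c i n = mixh l x α (2*q+c+1) c i n) ∧
    (∀ i n, n + 1 = q → mixh l x α (2*q+c) c i n = mixh l x α (2*q+c+1) c i n + x * mixh l x α (2*q+c+1) c i q) := by
  constructor
  · intro i n hn
    unfold mixh
    by_cases h : 2*q+c ≤ 2*(n+1)+c
    · rw [if_pos h, if_pos (by omega)]
    · rw [if_neg h, if_neg (by omega)]
  · rintro i n rfl
    unfold mixh
    rw [if_pos (by omega), if_neg (by omega), if_pos (by omega), hl_cons]
    congr 3
    push_cast; ring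

lemma mixh_other {l : List R} {x : R} {α : Fin k → ℕ} {q c d : ℕ} (hc : c < 2) (hd : d < 2) (hcd : c ≠ d) :
    mixh l x α (2*q+c) d = mixh l x α (2*q+c+1) d := by
  funext i n
  unfold mixh
  by_cases h : 2*q+c ≤ 2*(n+1)+d
  · rw [if_pos h, if_pos (by omega)]
  · rw [if_neg h, if_neg (by omega)]

lemma hl_neg (l : List R) {m : ℤ} (hm : m < 0) : hl l m = 0 := by
  rw [hl, if_neg (by omega)]

lemma isDT_OL {v : Finset ℕ → R} {l : List R} {α β : Fin k → ℕ} {B : ℕ} (hα : ∀ i, α i < B) (hβ : ∀ i, β i < B)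
    (hv : isDT v (fullh l α) (fullh l β)) (x : R) :
    isDT (OL (uC R) (List.range (2*B)) x v) (fullh (x :: l) α) (fullh (x :: l) β) := by
  have key : ∀ n J, J + n = 2*B → isDT (OL (uC R) (List.range' J n) x v) (mixh l x α J 1) (mixh l x β J 0) := by
    intro n
    induction n with
    | zero =>
      intro J hJ
      have : ∀ (α : Fin k → ℕ) c, c < 2 → (∀ i, α i < B) → mixh l x α J c = fullh l α := by
        intro α c hc hα
        funext i n
        unfold mixh fullh
        split_ifs with h
        · have := hα i
          rw [hl_cons, hl_neg (x :: l) (by omega), mul_zero, add_zero]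
        · rfl
      rw [this α 1 (by omega) hα, this β 0 (by omega) hβ]
      exact hv
    | succ n ih =>
      intro J hJ
      rw [List.range'_succ, OL_cons, Module.End.mul_apply]
      have := ih (J+1) (by omega)
      rcases Nat.even_or_odd' J with ⟨q, rfl | rfl⟩
      · rw [show mixh l x α (2*q) 1 = mixh l x α (2*q+1) 1 from mixh_other (c := 0) (by omega) (by omega) (by omega)]
        exact this.step0 (mixh_step (c := 0) (by omega)).1 (mixh_step (c := 0) (by omega)).2
      · rw [show mixh l x β (2*q+1) 0 = mixh l x β (2*q+1+1) 0 from mixh_other (c := 1) (by omega) (by omega) (by omega)]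
        exact this.step1 (mixh_step (c := 1) (by omega)).1 (mixh_step (c := 1) (by omega)).2
  have h0 := key (2*B) 0 (by omega)
  rw [← List.range_eq_range'] at h0
  have : ∀ (α : Fin k → ℕ) c, mixh l x α 0 c = fullh (x :: l) α := by
    intro α c
    funext i n
    unfold mixh fullh
    rw [if_pos (by omega)]
  rwa [this, this] at h0

lemma isDT_OP {v : Finset ℕ → R} {α β : Fin k → ℕ} {B : ℕ} (hα : ∀ i, α i < B) (hβ : ∀ i, β i < B)
    (hv : isDT v (fullh [] α) (fullh [] β)) (xs : List R) :
    isDT (OP (uC R) (2*B) xs v) (fullh xs α) (fullh xs β) := by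
  induction xs with
  | nil => exact hv
  | cons x xs ih =>
    rw [OP_cons, Module.End.mul_apply]
    exact isDT_OL hα hβ ih x

lemma strictAnti_eq {a b : Fin k → ℕ} (ha : StrictAnti a) (hb : StrictAnti b) (h : ∀ q, (∃ i, a i = q) ↔ ∃ i, b i = q) :
    a = b := by
  have h1 : StrictMono (a ∘ Fin.rev) := fun x y hxy => ha (Fin.rev_lt_rev.2 hxy)
  have h2 : StrictMono (b ∘ Fin.rev) := fun x y hxy => hb (Fin.rev_lt_rev.2 hxy)
  have h3 : Set.range (a ∘ Fin.rev) = Set.range (b ∘ Fin.rev) := by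
    rw [Fin.rev_surjective.range_comp, Fin.rev_surjective.range_comp]
    ext q
    exact h q
  have := (StrictMono.range_inj h1 h2).1 h3
  funext i
  have := congrFun this (Fin.rev i)
  simpa using this

lemma DT_base {α a : Fin k → ℕ} (hα : StrictAnti α) (ha : StrictAnti a) :
    DT (fullh ([] : List R) α) a = if a = α then 1 else 0 := by
  have hn : ∀ i n, fullh ([] : List R) α i n = if α i = n then 1 else 0 := by
    intro i n
    unfold fullh
    rw [hl_nil]
    congr 1
    rw [eq_iff_iff]
    omega
  by_cases h : a = α
  · subst h
    rw [if_pos rfl, DT, ← Matrix.det_one (n := Fin k)]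
    congr 1
    ext i j
    rw [Matrix.of_apply, hn, Matrix.one_apply]
    simp only [ha.injective.eq_iff]
  · rw [if_neg h]
    have : ∃ i, ∀ j, α i ≠ a j := by
      by_contra hc
      push Not at hc
      apply h
      choose f hf using hc
      have hinj : Function.Injective f := fun x y hxy => hα.injective (by rw [hf, hf, hxy])
      have hsur := Finite.surjective_of_injective hinj
      apply strictAnti_eq ha hα
      intro q
      constructor
      · rintro ⟨j, rfl⟩
        obtain ⟨i, rfl⟩ := hsur j
        exact ⟨i, hf i⟩
      · rintro ⟨i, rfl⟩
        exact ⟨f i, (hf i).symm⟩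
    obtain ⟨i, hi⟩ := this
    apply Matrix.det_eq_zero_of_row_eq_zero i
    intro j
    rw [Matrix.of_apply, hn, if_neg (hi j)]

lemma conf_inj {a b α β : Fin k → ℕ} (ha : StrictAnti a) (hb : StrictAnti b) (hα : StrictAnti α) (hβ : StrictAnti β) :
    conf a b = conf α β ↔ a = α ∧ b = β := by
  constructor
  · intro h
    constructor
    · apply strictAnti_eq ha hα
      intro q
      rw [← mem_conf1 (b := b), h, mem_conf1]
    · apply strictAnti_eq hb hβ
      intro q
      rw [← mem_conf0 (a := a), h, mem_conf0]
  · rintro ⟨rfl, rfl⟩; rfl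

/-- the Jacobi–Trudi determinant with integer parameters -/
noncomputable def detZ (N : ℕ) (α β : Fin k → ℤ) : MvPolynomial (Fin N) ℤ :=
  Matrix.det (Matrix.of fun i j => homog N (α i - β j))

lemma GF_conf (N B : ℕ) {a b α β : Fin k → ℕ} (ha : StrictAnti a) (hb : StrictAnti b) (hα : StrictAnti α)
    (hβ : StrictAnti β) (h1 : ∀ i, α i < B) (h2 : ∀ i, β i < B) :
    GF N B (conf a b) (conf α β) = detZ N (fun i => (α i : ℤ)) (fun i => (a i : ℤ)) *
      detZ N (fun i => (β i : ℤ)) (fun i => (b i : ℤ)) := by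
  have hv : isDT (fun C => if C = conf α β then (1 : MvPolynomial (Fin N) ℤ) else 0) (fullh [] α) (fullh [] β) := by
    intro a b ha hb
    rw [DT_base hα ha, DT_base hβ hb]
    simp only [conf_inj ha hb hα hβ]
    by_cases e1 : a = α <;> by_cases e2 : b = β <;> simp [e1, e2]
  have := isDT_OP h1 h2 hv (List.ofFn fun t : Fin N => (MvPolynomial.X t : MvPolynomial (Fin N) ℤ)) a b ha hb
  rw [GF, this]
  unfold detZ DT fullh
  simp only [homog_eq_hl]

lemma cnt_conf1 {a b : Fin k → ℕ} (ha : StrictAnti a) (q : ℕ) :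
    cnt 1 (conf a b) q = (Finset.univ.filter (fun i => q ≤ a i)).card := by
  rw [← Finset.card_image_of_injective (f := fun i => 2 * a i + 1) _
    (fun x y h => ha.injective (by simp only at h; omega)), cnt]
  congr 1
  ext x
  simp only [conf, Finset.mem_filter, Finset.mem_union, Finset.mem_image, Finset.mem_univ, true_and]
  constructor
  · rintro ⟨⟨i, rfl⟩ | ⟨i, rfl⟩, h2, h3⟩
    · exact ⟨i, by omega, rfl⟩
    · omega
  · rintro ⟨i, h, rfl⟩
    exact ⟨Or.inl ⟨i, rfl⟩, by omega, by omega⟩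

lemma cnt_conf0 {a b : Fin k → ℕ} (hb : StrictAnti b) (q : ℕ) :
    cnt 0 (conf a b) q = (Finset.univ.filter (fun i => q ≤ b i)).card := by
  rw [← Finset.card_image_of_injective (f := fun i => 2 * b i) _
    (fun x y h => hb.injective (by simp only at h; omega)), cnt]
  congr 1
  ext x
  simp only [conf, Finset.mem_filter, Finset.mem_union, Finset.mem_image, Finset.mem_univ, true_and]
  constructor
  · rintro ⟨⟨i, rfl⟩ | ⟨i, rfl⟩, h2, h3⟩
    · omega
    · exact ⟨i, by omega, rfl⟩
  · rintro ⟨i, h, rfl⟩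
    exact ⟨Or.inr ⟨i, rfl⟩, by omega, by omega⟩

lemma isflip_conf {a b : Fin k → ℕ} (ha : StrictAnti a) (hb : StrictAnti b) :
    isflip (conf a b) (conf (fun i => max (a i) (b i)) (fun i => min (a i) (b i))) := by
  have hM : StrictAnti (fun i => max (a i) (b i)) := fun x y h => max_lt_max (ha h) (hb h)
  have hm : StrictAnti (fun i => min (a i) (b i)) := fun x y h => min_lt_min (ha h) (hb h)
  intro q
  rw [cnt_conf1 hM, cnt_conf0 hm, cnt_conf1 ha, cnt_conf0 hb]
  have hnest : (∀ i, q ≤ a i → q ≤ b i) ∨ (∀ i, q ≤ b i → q ≤ a i) := by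
    by_contra hc
    push Not at hc
    obtain ⟨⟨i, h1, h2⟩, ⟨j, h3, h4⟩⟩ := hc
    rcases le_total i j with hij | hij
    · have := hb.antitone hij; omega
    · have := ha.antitone hij; omega
  rcases hnest with hh | hh
  · have hc : (Finset.univ.filter (fun i => q ≤ a i)).card ≤ (Finset.univ.filter (fun i => q ≤ b i)).card :=
      Finset.card_le_card (fun i hi => by simp at hi ⊢; exact hh i hi)
    rw [max_eq_right hc, min_eq_left hc]
    constructor
    · congr 1; ext i; simp; intro h; exact hh i h
    · congr 1; ext i; simp; intro h; exact hh i h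
  · have hc : (Finset.univ.filter (fun i => q ≤ b i)).card ≤ (Finset.univ.filter (fun i => q ≤ a i)).card :=
      Finset.card_le_card (fun i hi => by simp at hi ⊢; exact hh i hi)
    rw [max_eq_left hc, min_eq_right hc]
    constructor
    · congr 1; ext i; simp; intro h; exact hh i h
    · congr 1; ext i; simp; intro h; exact hh i h

lemma conf_bd {a b : Fin k → ℕ} {B : ℕ} (ha : ∀ i, a i < B) (hb : ∀ i, b i < B) : ∀ x ∈ conf a b, x < 2*B := by
  intro x hx
  simp only [conf, Finset.mem_union, Finset.mem_image, Finset.mem_univ, true_and] at hx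
  rcases hx with ⟨i, rfl⟩ | ⟨i, rfl⟩
  · have := ha i; omega
  · have := hb i; omega

theorem meetjoinN (N : ℕ) {a b α β : Fin k → ℕ} (ha : StrictAnti a) (hb : StrictAnti b) (hα : StrictAnti α)
    (hβ : StrictAnti β) :
    IsSchurNonneg N (detZ N (fun i => ((max (α i) (β i) : ℕ) : ℤ)) (fun i => ((max (a i) (b i) : ℕ) : ℤ)) *
      detZ N (fun i => ((min (α i) (β i) : ℕ) : ℤ)) (fun i => ((min (a i) (b i) : ℕ) : ℤ)) -
      detZ N (fun i => (α i : ℤ)) (fun i => (a i : ℤ)) * detZ N (fun i => (β i : ℤ)) (fun i => (b i : ℤ))) := by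
  obtain ⟨B, hB⟩ : ∃ B, ∀ i, a i < B ∧ b i < B ∧ α i < B ∧ β i < B := by
    refine ⟨∑ i, (a i + b i + α i + β i) + 1, fun i => ?_⟩
    have := Finset.single_le_sum (f := fun i => a i + b i + α i + β i) (fun _ _ => Nat.zero_le _) (Finset.mem_univ i)
    omega
  have hM : ∀ {a b : Fin k → ℕ}, StrictAnti a → StrictAnti b → StrictAnti (fun i => max (a i) (b i)) :=
    fun ha hb x y h => max_lt_max (ha h) (hb h)
  have hm : ∀ {a b : Fin k → ℕ}, StrictAnti a → StrictAnti b → StrictAnti (fun i => min (a i) (b i)) :=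
    fun ha hb x y h => min_lt_min (ha h) (hb h)
  have := GF_meetjoin N B (isflip_conf ha hb) (isflip_conf hα hβ)
    (conf_bd (fun i => (hB i).1) (fun i => (hB i).2.1))
    (conf_bd (fun i => max_lt (hB i).1 (hB i).2.1) (fun i => min_lt_of_left_lt (hB i).1))
  rwa [GF_conf N B (hM ha hb) (hm ha hb) (hM hα hβ) (hm hα hβ)
    (fun i => max_lt (hB i).2.2.1 (hB i).2.2.2) (fun i => min_lt_of_left_lt (hB i).2.2.1),
    GF_conf N B ha hb hα hβ (fun i => (hB i).2.2.1) (fun i => (hB i).2.2.2)] at this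

lemma detZ_shift (N : ℕ) (α β : Fin k → ℤ) (c : ℤ) : detZ N (fun i => α i + c) (fun i => β i + c) = detZ N α β := by
  unfold detZ
  simp only [add_sub_add_right_eq_sub]

theorem meetjoinZ (N : ℕ) {a b α β : Fin k → ℤ} (ha : StrictAnti a) (hb : StrictAnti b) (hα : StrictAnti α)
    (hβ : StrictAnti β) :
    IsSchurNonneg N (detZ N (fun i => max (α i) (β i)) (fun i => max (a i) (b i)) *
      detZ N (fun i => min (α i) (β i)) (fun i => min (a i) (b i)) - detZ N α a * detZ N β b) := by
  obtain ⟨c, hc⟩ : ∃ c : ℤ, ∀ i, 0 ≤ a i + c ∧ 0 ≤ b i + c ∧ 0 ≤ α i + c ∧ 0 ≤ β i + c := by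
    refine ⟨∑ i, (|a i| + |b i| + |α i| + |β i|), fun i => ?_⟩
    have := Finset.single_le_sum (f := fun i => |a i| + |b i| + |α i| + |β i|) (fun _ _ => by positivity) (Finset.mem_univ i)
    have h1 := neg_abs_le (a i)
    have h2 := neg_abs_le (b i)
    have h3 := neg_abs_le (α i)
    have h4 := neg_abs_le (β i)
    have g1 := abs_nonneg (a i)
    have g2 := abs_nonneg (b i)
    have g3 := abs_nonneg (α i)
    have g4 := abs_nonneg (β i)
    refine ⟨?_, ?_, ?_, ?_⟩ <;> linarith
  have hT : ∀ {a : Fin k → ℤ}, StrictAnti a → (∀ i, 0 ≤ a i + c) → StrictAnti (fun i => (a i + c).toNat) := by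
    intro a ha h x y hxy
    have h1 := ha hxy
    have h2 := h x
    have h3 := h y
    show (a y + c).toNat < (a x + c).toNat
    omega
  have := meetjoinN N (hT ha fun i => (hc i).1) (hT hb fun i => (hc i).2.1) (hT hα fun i => (hc i).2.2.1)
    (hT hβ fun i => (hc i).2.2.2)
  have e1 : ∀ i, (((a i + c).toNat : ℕ) : ℤ) = a i + c := fun i => Int.toNat_of_nonneg (hc i).1
  have e2 : ∀ i, (((b i + c).toNat : ℕ) : ℤ) = b i + c := fun i => Int.toNat_of_nonneg (hc i).2.1
  have e3 : ∀ i, (((α i + c).toNat : ℕ) : ℤ) = α i + c := fun i => Int.toNat_of_nonneg (hc i).2.2.1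
  have e4 : ∀ i, (((β i + c).toNat : ℕ) : ℤ) = β i + c := fun i => Int.toNat_of_nonneg (hc i).2.2.2
  simp only [Nat.cast_max, Nat.cast_min, e1, e2, e3, e4, max_add_add_right, min_add_add_right] at this
  rwa [detZ_shift, detZ_shift, detZ_shift, detZ_shift] at this

end JT


/-! ### From meet-join to floor-ceiling -/
section Fold

variable {k : ℕ}

lemma fold_main (N : ℕ) (n : ℕ) : ∀ (α β γ δ : Fin k → ℤ) (p : ℤ), StrictAnti α → StrictAnti β → StrictAnti γ →
    StrictAnti δ → (∀ i, p ≤ α i - γ i ∧ α i - γ i ≤ p + n + 1) → (∀ i, p ≤ β i - δ i ∧ β i - δ i ≤ p + n + 1) →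
    IsSchurNonneg N (detZ N (fun i => (α i + γ i) / 2) (fun i => (β i + δ i) / 2) *
      detZ N (fun i => (α i + γ i + 1) / 2) (fun i => (β i + δ i + 1) / 2) - detZ N α β * detZ N γ δ) := by
  induction n with
  | zero =>
    intro α β γ δ p _ _ _ _ h1 h2
    have : detZ N (fun i => (α i + γ i) / 2) (fun i => (β i + δ i) / 2) *
      detZ N (fun i => (α i + γ i + 1) / 2) (fun i => (β i + δ i + 1) / 2) = detZ N α β * detZ N γ δ := by
      rcases Int.even_or_odd' p with ⟨m, rfl | rfl⟩
      · rw [← detZ_shift N (fun i => (α i + γ i) / 2) _ (-m), ← detZ_shift N (fun i => (α i + γ i + 1) / 2) _ m, mul_comm]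
        have e1 : (fun i => (α i + γ i + 1) / 2 + m) = α := by funext i; have := h1 i; push_cast at this; omega
        have e2 : (fun i => (β i + δ i + 1) / 2 + m) = β := by funext i; have := h2 i; push_cast at this; omega
        have e3 : (fun i => (α i + γ i) / 2 + -m) = γ := by funext i; have := h1 i; push_cast at this; omega
        have e4 : (fun i => (β i + δ i) / 2 + -m) = δ := by funext i; have := h2 i; push_cast at this; omega
        rw [e1, e2, e3, e4]
      · rw [← detZ_shift N (fun i => (α i + γ i) / 2) _ (m+1), ← detZ_shift N (fun i => (α i + γ i + 1) / 2) _ (-(m+1))]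
        have e1 : (fun i => (α i + γ i + 1) / 2 + -(m+1)) = γ := by funext i; have := h1 i; push_cast at this; omega
        have e2 : (fun i => (β i + δ i + 1) / 2 + -(m+1)) = δ := by funext i; have := h2 i; push_cast at this; omega
        have e3 : (fun i => (α i + γ i) / 2 + (m+1)) = α := by funext i; have := h1 i; push_cast at this; omega
        have e4 : (fun i => (β i + δ i) / 2 + (m+1)) = β := by funext i; have := h2 i; push_cast at this; omega
        rw [e1, e2, e3, e4]
    rw [this, sub_self]
    exact sn_zero N
  | succ n ih =>
    intro α β γ δ p hα hβ hγ hδ h1 h2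
    set a : ℤ := p + n + 1 with ha
    have hγa : StrictAnti (fun i => γ i + a) := fun x y h => by have := hγ h; dsimp only; omega
    have hδa : StrictAnti (fun i => δ i + a) := fun x y h => by have := hδ h; dsimp only; omega
    have s1 := meetjoinZ N hβ hδa hα hγa
    have s2 := ih (fun i => min (α i) (γ i + a)) (fun i => min (β i) (δ i + a))
      (fun i => max (α i) (γ i + a) - a) (fun i => max (β i) (δ i + a) - a) p
      (fun x y h => min_lt_min (hα h) (hγa h)) (fun x y h => min_lt_min (hβ h) (hδa h))
      (fun x y h => sub_lt_sub_right (max_lt_max (hα h) (hγa h)) _)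
      (fun x y h => sub_lt_sub_right (max_lt_max (hβ h) (hδa h)) _)
      (fun i => by have := h1 i; push_cast at this; constructor <;> omega)
      (fun i => by have := h2 i; push_cast at this; constructor <;> omega)
    have e1 : ∀ i, min (α i) (γ i + a) + (max (α i) (γ i + a) - a) = α i + γ i := fun i => by omega
    have e2 : ∀ i, min (β i) (δ i + a) + (max (β i) (δ i + a) - a) = β i + δ i := fun i => by omega
    simp only [e1, e2] at s2
    have e3 := detZ_shift N (fun i => max (α i) (γ i + a)) (fun i => max (β i) (δ i + a)) (-a)
    simp only [← sub_eq_add_neg] at e3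
    rw [detZ_shift N γ δ a] at s1
    rw [e3] at s2
    have := sn_add s2 s1
    convert this using 1
    ring

end Fold

lemma skewSchur_eq_detZ (N k : ℕ) (lam mu : ℕ → ℕ) :
    skewSchur N k lam mu = detZ N (fun i : Fin k => (lam i : ℤ) - i) (fun i : Fin k => (mu i : ℤ) - i) := by
  unfold skewSchur detZ
  congr 1
  ext i j : 2
  simp only [Matrix.of_apply]
  congr 1
  ring

/-- For any two skew shapes `λ/μ` and `ν/ρ`,
`s_{⌊(λ+ν)/2⌋/⌊(μ+ρ)/2⌋} s_{⌈(λ+ν)/2⌉/⌈(μ+ρ)/2⌉} ≥_s s_{λ/μ} s_{ν/ρ}`,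
where floors and ceilings are taken coordinatewise:
`⌊(λ+ν)/2⌋_i = (λ_i+ν_i)/2` and `⌈(λ+ν)/2⌉_i = (λ_i+ν_i+1)/2` (ℕ-division). -/
theorem schur_nonneg_floor_ceil (k : ℕ) (lam mu nu rho : ℕ → ℕ)
    (hlam : Antitone lam) (hmu : Antitone mu) (hnu : Antitone nu) (hrho : Antitone rho)
    (hlamk : ∀ j, k ≤ j → lam j = 0) (hmuk : ∀ j, k ≤ j → mu j = 0)
    (hnuk : ∀ j, k ≤ j → nu j = 0) (hrhok : ∀ j, k ≤ j → rho j = 0)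
    (hml : ∀ i, mu i ≤ lam i) (hrn : ∀ i, rho i ≤ nu i)
    (N : ℕ) :
    IsSchurNonneg N
      (skewSchur N k (fun i => (lam i + nu i) / 2) (fun i => (mu i + rho i) / 2)
          * skewSchur N k (fun i => (lam i + nu i + 1) / 2) (fun i => (mu i + rho i + 1) / 2)
        - skewSchur N k lam mu * skewSchur N k nu rho) := by
  have hs : ∀ f : ℕ → ℕ, Antitone f → StrictAnti (fun i : Fin k => (f i : ℤ) - i) := by
    intro f hf x y hxy
    have h1 : (x : ℕ) < y := hxy
    have h2 := hf h1.le
    show (f y : ℤ) - y < (f x : ℤ) - x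
    omega
  have hb : ∀ f : ℕ → ℕ, Antitone f → ∀ i, f i ≤ f 0 := fun f hf i => hf (Nat.zero_le i)
  set M := lam 0 + mu 0 + nu 0 + rho 0 with hM
  have key := fold_main N (2*M) (fun i : Fin k => (lam i : ℤ) - i) (fun i : Fin k => (mu i : ℤ) - i)
    (fun i : Fin k => (nu i : ℤ) - i) (fun i : Fin k => (rho i : ℤ) - i) (-(M:ℤ)) (hs _ hlam) (hs _ hmu) (hs _ hnu)
    (hs _ hrho)
    (fun i => by
      have h1 := hb lam hlam i
      have h2 := hb nu hnu i
      push_cast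
      constructor <;> omega)
    (fun i => by
      have h1 := hb mu hmu i
      have h2 := hb rho hrho i
      push_cast
      constructor <;> omega)
  have e1 : ∀ (f g : ℕ → ℕ) (i : Fin k), ((f i : ℤ) - i + ((g i : ℤ) - i)) / 2 = (((f i + g i) / 2 : ℕ) : ℤ) - i := by
    intro f g i; omega
  have e2 : ∀ (f g : ℕ → ℕ) (i : Fin k), ((f i : ℤ) - i + ((g i : ℤ) - i) + 1) / 2 = (((f i + g i + 1) / 2 : ℕ) : ℤ) - i := by
    intro f g i; omega
  simp only [e1, e2] at key
  rw [skewSchur_eq_detZ, skewSchur_eq_detZ, skewSchur_eq_detZ, skewSchur_eq_detZ]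
  exact key
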